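/- arXiv:2411.10439 — 2 statements merged into one kernel-verified Lean document; each statement's English description precedes it below -/
import Mathlib

section
/- Let p ∈ (0,∞) and n ≥ 1. Let f : ℝⁿ → ℝ ∪ {+∞} be measurable with V(f) > 0, and suppose there exist a > 0 and b ∈ ℝ such that f(x) ≥ a|x| + b for all x ∈ ℝⁿ. Then inf_{x∈ℝⁿ} M_p(T_x f) ≤ (2π·√((1+p)^{(1+p)/p}/p))ⁿ. -/
open MeasureTheory Real Filter
open scoped ENNReal RealInnerProductSpace Classical

noncomputable section

abbrev Euc (n : ℕ) : Type := EuclideanSpace ℝ (Fin n)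

/-- `e^t` as an extended nonnegative real, for `t : EReal` (`e^{-∞}=0`, `e^{+∞}=∞`). -/
def erealExp (t : EReal) : ℝ≥0∞ :=
  if t = ⊥ then 0 else if t = ⊤ then ⊤ else ENNReal.ofReal (Real.exp t.toReal)

/-- The volume `V(f) = ∫ e^{-f}` of `f : ℝⁿ → ℝ ∪ {+∞}`, as an extended nonnegative real. -/
def VolE {n : ℕ} (f : Euc n → EReal) : ℝ≥0∞ := ∫⁻ x, erealExp (-(f x))

/-- The volume `V(f) = ∫ e^{-f}` as a real number. -/
def Vol {n : ℕ} (f : Euc n → EReal) : ℝ := (VolE f).toReal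

/-- `∫ e^{p⟨x,y⟩ - (p+1) f(x)} dx`. -/
def LpIntE {n : ℕ} (p : ℝ) (f : Euc n → EReal) (y : Euc n) : ℝ≥0∞ :=
  ∫⁻ x, erealExp (((p * ⟪x, y⟫ : ℝ) : EReal) - ((p + 1 : ℝ) : EReal) * f x)

/-- The `L^p`-Legendre transform
`f^{*,p}(y) = (1/p) log ( ∫ e^{p⟨x,y⟩ - (p+1) f(x)} dx / V(f) )`,
with value `+∞` when the integral diverges. -/
def LpStar {n : ℕ} (p : ℝ) (f : Euc n → EReal) (y : Euc n) : EReal :=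
  if LpIntE p f y = ⊤ then ⊤
  else (((1 / p) * Real.log ((LpIntE p f y).toReal / Vol f) : ℝ) : EReal)

/-- The `L^p`-Mahler integral `M_p(f) = V(f) · V(f^{*,p})`, as an extended nonnegative real. -/
def MpE {n : ℕ} (p : ℝ) (f : Euc n → EReal) : ℝ≥0∞ := VolE f * VolE (LpStar p f)

/-- The translate `(T_a f)(x) = f(x + a)`. -/
def Transl {n : ℕ} (a : Euc n) (f : Euc n → EReal) : Euc n → EReal := fun x => f (x + a)

/-- Convexity of an `ℝ ∪ {+∞}`-valued function. -/
def ConvexE {n : ℕ} (φ : Euc n → EReal) : Prop :=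
  ∀ x y : Euc n, ∀ l : ℝ, 0 ≤ l → l ≤ 1 →
    φ ((1 - l) • x + l • y) ≤ ((1 - l : ℝ) : EReal) * φ x + ((l : ℝ) : EReal) * φ y

/-- The class `Cvx(ℝⁿ)`: convex, lower semicontinuous functions `ℝⁿ → ℝ ∪ {+∞}`,
not identically `+∞`, with `0 < V(φ) < ∞`. -/
structure InCvx {n : ℕ} (φ : Euc n → EReal) : Prop where
  noBot : ∀ x, φ x ≠ ⊥
  convex : ConvexE φ
  lsc : LowerSemicontinuous φ
  proper : ∃ x, φ x ≠ ⊤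
  volPos : 0 < VolE φ
  volFin : VolE φ < ⊤

/-- The barycenter `b(g) = ∫ x e^{-g(x)} dx / V(g)`. -/
def bary {n : ℕ} (g : Euc n → EReal) : Euc n :=
  (Vol g)⁻¹ • ∫ x, (erealExp (-(g x))).toReal • x

/-- The classical Legendre transform `f^*(y) = sup_x (⟨x,y⟩ - f(x))`. -/
def Lstar {n : ℕ} (f : Euc n → EReal) (y : Euc n) : EReal :=
  ⨆ x : Euc n, (((⟪x, y⟫ : ℝ) : EReal) - f x)



namespace LpS

open ProbabilityTheory

/-- standard Gaussian measure -/
abbrev gm : Measure ℝ := gaussianReal 0 1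

/-- standard Gaussian density -/
abbrev gd : ℝ → ℝ := gaussianPDFReal 0 1

/-- Mehler kernel -/
def mk (r w z : ℝ) : ℝ :=
  (√(1 - r ^ 2))⁻¹ * rexp ((2 * r * w * z - r ^ 2 * w ^ 2 - r ^ 2 * z ^ 2) / (2 * (1 - r ^ 2)))

/-- correlated Gaussian pair -/
def gr (r : ℝ) : Measure (ℝ × ℝ) :=
  (gm.prod gm).withDensity (fun q => ENNReal.ofReal (mk r q.1 q.2))

lemma mk_symm (r w z : ℝ) : mk r w z = mk r z w := by
  unfold mk; congr 2; ring

lemma mk_pos {r : ℝ} (hr : r ^ 2 < 1) (w z : ℝ) : 0 < mk r w z := by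
  unfold mk
  have : 0 < √(1 - r ^ 2) := Real.sqrt_pos.mpr (by linarith)
  positivity

lemma measurable_mk (r : ℝ) : Measurable (fun q : ℝ × ℝ => mk r q.1 q.2) := by
  unfold mk; fun_prop

lemma gd_eq (z : ℝ) : gd z = (√(2 * π))⁻¹ * rexp (- z ^ 2 / 2) := by
  simp [gd, gaussianPDFReal]

lemma mk_mul_gd {r : ℝ} (hr : r ^ 2 < 1) (w z : ℝ) :
    gd z * mk r w z = gaussianPDFReal (r * w) (Real.toNNReal (1 - r ^ 2)) z := by
  have h1 : 0 < 1 - r ^ 2 := by linarith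
  rw [gd_eq]
  simp only [gaussianPDFReal, mk]
  rw [Real.coe_toNNReal _ h1.le, Real.sqrt_mul (by positivity), Real.sqrt_mul (by positivity),
    Real.sqrt_mul (by positivity)]
  have : rexp (-z ^ 2 / 2) * rexp ((2 * r * w * z - r ^ 2 * w ^ 2 - r ^ 2 * z ^ 2) / (2 * (1 - r ^ 2)))
      = rexp (-(z - r * w) ^ 2 / (2 * (1 - r ^ 2))) := by
    rw [← Real.exp_add]; congr 1; field_simp; ring
  rw [← this, mul_inv]; ring

lemma gm_withDensity {r : ℝ} (hr : r ^ 2 < 1) (w : ℝ) :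
    gm.withDensity (fun z => ENNReal.ofReal (mk r w z))
      = gaussianReal (r * w) (Real.toNNReal (1 - r ^ 2)) := by
  have h1 : 0 < 1 - r ^ 2 := by linarith
  have hv : Real.toNNReal (1 - r ^ 2) ≠ 0 := by simpa using h1
  rw [gm, gaussianReal_of_var_ne_zero _ one_ne_zero, gaussianReal_of_var_ne_zero _ hv]
  rw [← withDensity_mul _ (measurable_gaussianPDF 0 1)]
  · congr 1; ext z
    simp only [Pi.mul_apply, gaussianPDF]
    rw [← ENNReal.ofReal_mul (gaussianPDFReal_nonneg _ _ _), mk_mul_gd hr]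
  · unfold mk; fun_prop

lemma lintegral_gr {r : ℝ} (hr : r ^ 2 < 1) {φ : ℝ × ℝ → ℝ≥0∞} (hφ : Measurable φ) :
    ∫⁻ q, φ q ∂(gr r) =
      ∫⁻ w, ∫⁻ z, φ (w, z) ∂(gaussianReal (r * w) (Real.toNNReal (1 - r ^ 2))) ∂gm := by
  have hm := measurable_mk r
  rw [gr, lintegral_withDensity_eq_lintegral_mul _ (by fun_prop) hφ,
    lintegral_prod _ (by fun_prop)]
  congr 1; ext w
  have hm2 : Measurable (fun z => mk r w z) := hm.comp measurable_prodMk_left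
  have h2 : Measurable (fun z => φ (w, z)) := hφ.comp measurable_prodMk_left
  rw [← gm_withDensity hr, lintegral_withDensity_eq_lintegral_mul _ (by fun_prop) h2]
  rfl

lemma gr_swap (r : ℝ) : (gr r).map Prod.swap = gr r := by
  have hm := measurable_mk r
  ext s hs
  rw [Measure.map_apply measurable_swap hs, gr, withDensity_apply _ (measurable_swap hs),
    withDensity_apply _ hs, ← lintegral_indicator (measurable_swap hs), ← lintegral_indicator hs,
    ← lintegral_prod_swap]
  congr 1; ext q
  simp only [Set.indicator, Set.mem_preimage, Prod.swap_swap]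
  congr 1
  simp only [Prod.fst_swap, Prod.snd_swap]
  rw [mk_symm]

lemma gr_fst {r : ℝ} (hr : r ^ 2 < 1) : (gr r).map Prod.fst = gm := by
  ext s hs
  rw [Measure.map_apply measurable_fst hs, ← lintegral_indicator_one (measurable_fst hs),
    lintegral_gr hr (by exact measurable_one.indicator (measurable_fst hs)),
    ← lintegral_indicator_one hs]
  congr 1; ext w
  have : ∀ z : ℝ, ((Prod.fst ⁻¹' s : Set (ℝ × ℝ)).indicator (1 : ℝ × ℝ → ℝ≥0∞) (w, z))
    = s.indicator 1 w := fun z => rfl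
  simp [this]

lemma gr_snd {r : ℝ} (hr : r ^ 2 < 1) : (gr r).map Prod.snd = gm := by
  conv_lhs => rw [← gr_swap r]
  rw [Measure.map_map measurable_snd measurable_swap]
  exact gr_fst hr

lemma gr_prob {r : ℝ} (hr : r ^ 2 < 1) : IsProbabilityMeasure (gr r) := by
  constructor
  have := congrArg (fun μ => μ Set.univ) (gr_fst hr)
  simpa [Measure.map_apply measurable_fst MeasurableSet.univ] using this

lemma mp_fst {r : ℝ} (hr : r ^ 2 < 1) : MeasurePreserving Prod.fst (gr r) gm :=
  ⟨measurable_fst, gr_fst hr⟩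

lemma mp_snd {r : ℝ} (hr : r ^ 2 < 1) : MeasurePreserving Prod.snd (gr r) gm :=
  ⟨measurable_snd, gr_snd hr⟩

/-- change back from the correlated measure to the product measure -/
lemma lintegral_gr_inv {r : ℝ} (hr : r ^ 2 < 1) {φ : ℝ × ℝ → ℝ≥0∞} (hφ : Measurable φ) :
    ∫⁻ q, φ q * ENNReal.ofReal ((mk r q.1 q.2)⁻¹) ∂(gr r) = ∫⁻ q, φ q ∂(gm.prod gm) := by
  have hm := measurable_mk r
  rw [gr, lintegral_withDensity_eq_lintegral_mul _ (by fun_prop) (by fun_prop)]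
  congr 1; ext q
  simp only [Pi.mul_apply]
  rw [mul_comm, mul_assoc, ← ENNReal.ofReal_mul (inv_nonneg.mpr (mk_pos hr _ _).le),
    inv_mul_cancel₀ (mk_pos hr _ _).ne']
  simp

lemma integrable_id_gm : Integrable (fun z : ℝ => z) gm := by
  exact (memLp_id_gaussianReal (μ := 0) (v := 1) 1).integrable (by simp)

lemma integrable_sq_gm : Integrable (fun z : ℝ => z ^ 2) gm := by
  simpa using (memLp_id_gaussianReal (μ := 0) (v := 1) 2).integrable_sq

lemma integral_sq_gm : ∫ z : ℝ, z ^ 2 ∂gm = 1 := by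
  have h := variance_id_gaussianReal (μ := 0) (v := 1)
  rw [variance_eq_sub (memLp_id_gaussianReal (μ := 0) (v := 1) 2)] at h
  simpa using h

lemma int_fst {r : ℝ} (hr : r ^ 2 < 1) {ψ : ℝ → ℝ} (h : Integrable ψ gm) :
    Integrable (fun q : ℝ × ℝ => ψ q.1) (gr r) :=
  Integrable.comp_measurable (f := Prod.fst) (g := ψ) (by rwa [gr_fst hr]) measurable_fst

lemma int_snd {r : ℝ} (hr : r ^ 2 < 1) {ψ : ℝ → ℝ} (h : Integrable ψ gm) :
    Integrable (fun q : ℝ × ℝ => ψ q.2) (gr r) :=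
  Integrable.comp_measurable (f := Prod.snd) (g := ψ) (by rwa [gr_snd hr]) measurable_snd

lemma integral_fst' {r : ℝ} (hr : r ^ 2 < 1) {ψ : ℝ → ℝ} (h : AEStronglyMeasurable ψ gm) :
    ∫ q : ℝ × ℝ, ψ q.1 ∂(gr r) = ∫ z, ψ z ∂gm := by
  have := integral_map (μ := gr r) (f := ψ) measurable_fst.aemeasurable (by rwa [gr_fst hr])
  rw [← this, gr_fst hr]

lemma integral_snd' {r : ℝ} (hr : r ^ 2 < 1) {ψ : ℝ → ℝ} (h : AEStronglyMeasurable ψ gm) :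
    ∫ q : ℝ × ℝ, ψ q.2 ∂(gr r) = ∫ z, ψ z ∂gm := by
  have := integral_map (μ := gr r) (f := ψ) measurable_snd.aemeasurable (by rwa [gr_snd hr])
  rw [← this, gr_snd hr]

lemma abs_mul_le_aux (x y : ℝ) : |x * y| ≤ x ^ 2 + y ^ 2 := by
  rw [abs_le]
  constructor
  · nlinarith [sq_nonneg (x + y), sq_nonneg (x - y)]
  · nlinarith [sq_nonneg (x + y), sq_nonneg (x - y)]

lemma integrable_mul_gr_aux {r : ℝ} (h1 : Integrable (fun q : ℝ × ℝ => q.1 ^ 2) (gr r))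
    (h2 : Integrable (fun q : ℝ × ℝ => q.2 ^ 2) (gr r)) :
    Integrable (fun q : ℝ × ℝ => q.1 * q.2) (gr r) := by
  refine Integrable.mono' (h1.add h2) (measurable_fst.mul measurable_snd).aestronglyMeasurable
    (ae_of_all _ fun q => ?_)
  exact abs_mul_le_aux q.1 q.2

lemma integrable_mul_gr {r : ℝ} (hr : r ^ 2 < 1) :
    Integrable (fun q : ℝ × ℝ => q.1 * q.2) (gr r) :=
  integrable_mul_gr_aux (int_fst (ψ := fun z => z ^ 2) hr integrable_sq_gm)
    (int_snd (ψ := fun z => z ^ 2) hr integrable_sq_gm)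

lemma integral_gr {r : ℝ} (hr : r ^ 2 < 1) {φ : ℝ × ℝ → ℝ} (hφ : Integrable φ (gr r)) :
    ∫ q, φ q ∂(gr r) =
      ∫ w, ∫ z, φ (w, z) ∂(gaussianReal (r * w) (Real.toNNReal (1 - r ^ 2))) ∂gm := by
  have hm := measurable_mk r
  have hi := hφ
  rw [gr, integrable_withDensity_iff_integrable_smul' (by fun_prop) (by simp)] at hi
  rw [gr, integral_withDensity_eq_integral_toReal_smul (by fun_prop) (by simp),
    integral_prod _ hi]
  congr 1; ext w
  rw [← gm_withDensity hr, integral_withDensity_eq_integral_toReal_smul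
    (by have : Measurable (fun z => mk r w z) := hm.comp measurable_prodMk_left
        fun_prop) (by simp)]

lemma integral_mul_gr {r : ℝ} (hr : r ^ 2 < 1) : ∫ q : ℝ × ℝ, q.1 * q.2 ∂(gr r) = r := by
  rw [integral_gr hr (integrable_mul_gr hr)]
  have h0 : ∀ w : ℝ, ∫ z, w * z ∂(gaussianReal (r * w) (Real.toNNReal (1 - r ^ 2)))
      = r * w ^ 2 := fun w => by
    rw [integral_const_mul, integral_id_gaussianReal]; ring
  simp only [h0, integral_const_mul, integral_sq_gm, mul_one]

lemma log_mk {r : ℝ} (hr : r ^ 2 < 1) (w z : ℝ) : Real.log (mk r w z) =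
    -(1/2) * Real.log (1 - r ^ 2) +
      (r / (1 - r ^ 2) * (w * z) - r ^ 2 / (2 * (1 - r ^ 2)) * w ^ 2
        - r ^ 2 / (2 * (1 - r ^ 2)) * z ^ 2) := by
  have h1 : 0 < 1 - r ^ 2 := by linarith
  have h2 : 0 < √(1 - r ^ 2) := Real.sqrt_pos.mpr h1
  unfold mk
  rw [Real.log_mul (by positivity) (by positivity), Real.log_exp, Real.log_inv,
    Real.log_sqrt h1.le]
  field_simp

lemma integrable_log_mk {r : ℝ} (hr : r ^ 2 < 1) :
    Integrable (fun q : ℝ × ℝ => Real.log (mk r q.1 q.2)) (gr r) := by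
  have := gr_prob hr
  simp only [log_mk hr]
  exact (integrable_const _).add ((((integrable_mul_gr hr).const_mul _).sub
    ((int_fst hr integrable_sq_gm).const_mul _)).sub
    ((int_snd hr integrable_sq_gm).const_mul _))

lemma integral_log_mk {r : ℝ} (hr : r ^ 2 < 1) :
    ∫ q : ℝ × ℝ, Real.log (mk r q.1 q.2) ∂(gr r) = -(1/2) * Real.log (1 - r ^ 2) := by
  have := gr_prob hr
  have h1 : 0 < 1 - r ^ 2 := by linarith
  have i0 := (integrable_mul_gr hr).const_mul (r / (1 - r ^ 2))
  have i1 : Integrable (fun q : ℝ × ℝ => r ^ 2 / (2 * (1 - r ^ 2)) * q.1 ^ 2) (gr r) :=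
    (int_fst hr integrable_sq_gm).const_mul _
  have i2 : Integrable (fun q : ℝ × ℝ => r ^ 2 / (2 * (1 - r ^ 2)) * q.2 ^ 2) (gr r) :=
    (int_snd hr integrable_sq_gm).const_mul _
  have e1 : ∫ q : ℝ × ℝ, q.1 ^ 2 ∂(gr r) = 1 := by
    rw [← integral_sq_gm, ← integral_fst' hr integrable_sq_gm.1]
  have e2 : ∫ q : ℝ × ℝ, q.2 ^ 2 ∂(gr r) = 1 := by
    rw [← integral_sq_gm, ← integral_snd' hr integrable_sq_gm.1]
  simp only [log_mk hr]
  rw [integral_add (integrable_const _) (by exact (i0.sub i1).sub i2),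
    integral_sub (by exact i0.sub i1) i2, integral_sub i0 i1]
  simp only [integral_const_mul, integral_mul_gr hr, e1, e2]
  simp
  field_simp
  ring

end LpS

namespace LpS

open ProbabilityTheory

/-- covariance of half-line indicators under the correlated Gaussian -/
def KK (r z t : ℝ) : ℝ :=
  (gr r).real (Set.Ioi z ×ˢ Set.Ioi t) - gm.real (Set.Ioi z) * gm.real (Set.Ioi t)

lemma KK_symm (r z t : ℝ) : KK r z t = KK r t z := by
  unfold KK
  rw [mul_comm]
  congr 1
  conv_lhs => rw [← gr_swap r]
  rw [map_measureReal_apply measurable_swap (measurableSet_Ioi.prod measurableSet_Ioi)]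
  congr 1
  ext q; simp [and_comm]

lemma gaussian_Ioi_mono (v : NNReal) (t : ℝ) :
    Monotone (fun m : ℝ => gaussianReal m v (Set.Ioi t)) := by
  intro m m' h
  have key : ∀ a : ℝ, gaussianReal a v (Set.Ioi t) = gaussianReal 0 v (Set.Ioi (t - a)) := by
    intro a
    have := gaussianReal_map_add_const (μ := 0) (v := v) a
    rw [zero_add] at this
    rw [← this, Measure.map_apply (by fun_prop) measurableSet_Ioi]
    congr 1; ext x; simp [sub_lt_iff_lt_add]
  simp only [key]
  exact measure_mono (Set.Ioi_subset_Ioi (by linarith))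

lemma gr_Ioi {r : ℝ} (hr : r ^ 2 < 1) (z t : ℝ) :
    gr r (Set.Ioi z ×ˢ Set.Ioi t) =
      ∫⁻ w in Set.Ioi z, gaussianReal (r * w) (Real.toNNReal (1 - r ^ 2)) (Set.Ioi t) ∂gm := by
  have hs : MeasurableSet (Set.Ioi z ×ˢ Set.Ioi t : Set (ℝ × ℝ)) :=
    measurableSet_Ioi.prod measurableSet_Ioi
  rw [← lintegral_indicator_one hs, lintegral_gr hr (by exact measurable_one.indicator hs),
    ← lintegral_indicator measurableSet_Ioi]
  congr 1; ext w
  by_cases hw : z < w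
  · rw [Set.indicator_of_mem (by exact hw), ← lintegral_indicator_one measurableSet_Ioi]
    congr 1; ext x
    simp [Set.indicator, hw]
  · rw [Set.indicator_of_notMem (by exact hw)]
    simp [Set.indicator, hw]

lemma gm_Ioi {r : ℝ} (hr : r ^ 2 < 1) (t : ℝ) :
    gm (Set.Ioi t) =
      ∫⁻ w, gaussianReal (r * w) (Real.toNNReal (1 - r ^ 2)) (Set.Ioi t) ∂gm := by
  have hs : MeasurableSet (Prod.snd ⁻¹' (Set.Ioi t) : Set (ℝ × ℝ)) :=
    measurable_snd measurableSet_Ioi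
  rw [← gr_snd hr, Measure.map_apply measurable_snd measurableSet_Ioi,
    ← lintegral_indicator_one hs, lintegral_gr hr (by exact measurable_one.indicator hs), gr_snd hr]
  congr 1; ext w
  rw [← lintegral_indicator_one measurableSet_Ioi]
  rfl

lemma KK_nonneg {r : ℝ} (hr0 : 0 ≤ r) (hr : r ^ 2 < 1) (z t : ℝ) : 0 ≤ KK r z t := by
  have := gr_prob hr
  set Q : ℝ → ℝ≥0∞ := fun w => gaussianReal (r * w) (Real.toNNReal (1 - r ^ 2)) (Set.Ioi t) with hQ
  have hmono : Monotone Q := fun a b h =>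
    gaussian_Ioi_mono _ t (mul_le_mul_of_nonneg_left h hr0)
  have hsplit : gm (Set.Ioi t) = ∫⁻ w in Set.Ioi z, Q w ∂gm + ∫⁻ w in (Set.Ioi z)ᶜ, Q w ∂gm := by
    rw [lintegral_add_compl _ measurableSet_Ioi]; exact gm_Ioi hr t
  have h1 : Q z * gm (Set.Ioi z) ≤ ∫⁻ w in Set.Ioi z, Q w ∂gm := by
    rw [← setLIntegral_const]
    exact setLIntegral_mono hmono.measurable (fun x hx => hmono (le_of_lt hx))
  have h2 : ∫⁻ w in (Set.Ioi z)ᶜ, Q w ∂gm ≤ Q z * gm (Set.Ioi z)ᶜ := by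
    rw [← setLIntegral_const]
    exact setLIntegral_mono measurable_const (fun x hx => hmono (by simpa using hx))
  have hone : gm (Set.Ioi z) + gm (Set.Ioi z)ᶜ = 1 := prob_add_prob_compl measurableSet_Ioi
  have key : gm (Set.Ioi z) * gm (Set.Ioi t) ≤ gr r (Set.Ioi z ×ˢ Set.Ioi t) := by
    rw [gr_Ioi hr, hsplit]
    calc gm (Set.Ioi z) * (∫⁻ w in Set.Ioi z, Q w ∂gm + ∫⁻ w in (Set.Ioi z)ᶜ, Q w ∂gm)
        ≤ gm (Set.Ioi z) * ∫⁻ w in Set.Ioi z, Q w ∂gm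
          + gm (Set.Ioi z) * (Q z * gm (Set.Ioi z)ᶜ) := by
            rw [mul_add]; gcongr
      _ = gm (Set.Ioi z) * ∫⁻ w in Set.Ioi z, Q w ∂gm
          + (Q z * gm (Set.Ioi z)) * gm (Set.Ioi z)ᶜ := by ring
      _ ≤ gm (Set.Ioi z) * ∫⁻ w in Set.Ioi z, Q w ∂gm
          + (∫⁻ w in Set.Ioi z, Q w ∂gm) * gm (Set.Ioi z)ᶜ := by gcongr
      _ = (gm (Set.Ioi z) + gm (Set.Ioi z)ᶜ) * ∫⁻ w in Set.Ioi z, Q w ∂gm := by ring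
      _ = ∫⁻ w in Set.Ioi z, Q w ∂gm := by rw [hone, one_mul]
  unfold KK
  rw [sub_nonneg]
  simp only [Measure.real]
  rw [← ENNReal.toReal_mul]
  exact ENNReal.toReal_mono (measure_ne_top _ _) key

lemma measurable_KK {r : ℝ} (hr : r ^ 2 < 1) : Measurable (fun q : ℝ × ℝ => KK r q.1 q.2) := by
  have := gr_prob hr
  have h1 : Measurable (fun z : ℝ => gm.real (Set.Ioi z)) := by
    apply Antitone.measurable
    intro a b h
    exact measureReal_mono (Set.Ioi_subset_Ioi h)
  have h2 : Measurable (fun q : ℝ × ℝ => gr r (Set.Ioi q.1 ×ˢ Set.Ioi q.2)) := by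
    have a : MeasurableSet {p : (ℝ × ℝ) × (ℝ × ℝ) | p.1.1 < p.2.1} :=
      measurableSet_lt (by fun_prop) (by fun_prop)
    have b : MeasurableSet {p : (ℝ × ℝ) × (ℝ × ℝ) | p.1.2 < p.2.2} :=
      measurableSet_lt (by fun_prop) (by fun_prop)
    have hs : MeasurableSet {p : (ℝ × ℝ) × (ℝ × ℝ) | p.1.1 < p.2.1 ∧ p.1.2 < p.2.2} :=
      a.inter b
    exact measurable_measure_prodMk_left hs
  exact h2.ennreal_toReal.sub ((h1.comp measurable_fst).mul (h1.comp measurable_snd))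

/-- signed step function -/
def cc (w t : ℝ) : ℝ := (if t < w then 1 else 0) - (if t < 0 then 1 else 0)

lemma measurable_cc : Measurable (fun q : ℝ × ℝ => cc q.1 q.2) := by
  unfold cc
  exact (Measurable.ite (measurableSet_lt measurable_snd measurable_fst) measurable_const
    measurable_const).sub
    (Measurable.ite (measurableSet_lt measurable_snd measurable_const) measurable_const
    measurable_const)

lemma cc_eq (w : ℝ) : cc w = fun t => (Set.Ico 0 w).indicator (fun _ => (1 : ℝ)) t
    - (Set.Ico w 0).indicator (fun _ => (1 : ℝ)) t := by
  ext t
  simp only [cc, Set.indicator, Set.mem_Ico]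
  by_cases h1 : t < w <;> by_cases h2 : t < 0 <;> simp [h1, h2] <;> grind

lemma abs_cc_eq (w : ℝ) : (fun t => |cc w t|) = fun t => (Set.Ico 0 w).indicator (fun _ => (1 : ℝ)) t
    + (Set.Ico w 0).indicator (fun _ => (1 : ℝ)) t := by
  ext t
  simp only [cc, Set.indicator, Set.mem_Ico]
  by_cases h1 : t < w <;> by_cases h2 : t < 0 <;> simp [h1, h2] <;> grind

lemma integrable_ind_Ico (a b : ℝ) :
    Integrable (fun t => (Set.Ico a b).indicator (fun _ => (1 : ℝ)) t) := by
  exact (integrable_indicator_iff measurableSet_Ico).mpr (by simp)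

lemma integrable_cc (w : ℝ) : Integrable (cc w) := by
  rw [cc_eq]; exact (integrable_ind_Ico _ _).sub (integrable_ind_Ico _ _)

lemma integral_cc (w : ℝ) : ∫ t, cc w t = w := by
  rw [cc_eq, integral_sub (integrable_ind_Ico _ _) (integrable_ind_Ico _ _),
    integral_indicator_const _ measurableSet_Ico, integral_indicator_const _ measurableSet_Ico]
  simp [Measure.real]
  rcases le_total 0 w with h | h
  · rw [ENNReal.ofReal_of_nonpos (show -w ≤ 0 by linarith)]; simp [h]
  · rw [ENNReal.ofReal_of_nonpos h]; simp [h]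

lemma integral_abs_cc (w : ℝ) : ∫ t, |cc w t| = |w| := by
  rw [abs_cc_eq, integral_add (integrable_ind_Ico _ _) (integrable_ind_Ico _ _),
    integral_indicator_const _ measurableSet_Ico, integral_indicator_const _ measurableSet_Ico]
  simp [Measure.real]
  rcases le_total 0 w with h | h
  · rw [ENNReal.ofReal_of_nonpos (show -w ≤ 0 by linarith)]; simp [h, abs_of_nonneg]
  · rw [ENNReal.ofReal_of_nonpos h]; simp [h, abs_of_nonpos]

lemma hoeff_half (P : Measure (ℝ × ℝ)) [IsFiniteMeasure P]
    (hP : Integrable (fun q : ℝ × ℝ => q.2) P) (z : ℝ) :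
    Integrable (fun t : ℝ => P.real (Set.Ioi z ×ˢ Set.Ioi t)
      - (if t < 0 then 1 else 0) * P.real (Prod.fst ⁻¹' Set.Ioi z)) ∧
    ∫ t : ℝ, (P.real (Set.Ioi z ×ˢ Set.Ioi t)
      - (if t < 0 then 1 else 0) * P.real (Prod.fst ⁻¹' Set.Ioi z))
      = ∫ q : ℝ × ℝ, (if z < q.1 then 1 else 0) * q.2 ∂P := by
  set Ψ : (ℝ × ℝ) × ℝ → ℝ := fun s => (if z < s.1.1 then 1 else 0) * cc s.1.2 s.2 with hΨ
  have hi : Measurable (fun q : ℝ × ℝ => (if z < q.1 then (1 : ℝ) else 0)) :=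
    Measurable.ite (measurableSet_lt measurable_const measurable_fst) measurable_const
      measurable_const
  have hmΨ : Measurable Ψ :=
    (hi.comp measurable_fst).mul (measurable_cc.comp
      ((measurable_snd.comp measurable_fst).prodMk measurable_snd))
  have hintg : Integrable Ψ (P.prod volume) := by
    rw [integrable_prod_iff hmΨ.aestronglyMeasurable]
    refine ⟨ae_of_all _ fun q => (integrable_cc q.2).const_mul (if z < q.1 then (1:ℝ) else 0), ?_⟩
    have : ∀ q : ℝ × ℝ, ∫ t, ‖Ψ (q, t)‖ = (if z < q.1 then 1 else 0) * |q.2| := by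
      intro q
      have : ∀ t, ‖Ψ (q, t)‖ = (if z < q.1 then (1:ℝ) else 0) * |cc q.2 t| := by
        intro t
        simp only [hΨ, norm_mul, Real.norm_eq_abs]
        split_ifs <;> simp
      simp only [this]
      rw [integral_const_mul, integral_abs_cc]
    simp only [this]
    refine Integrable.mono' hP.abs (hi.mul (measurable_snd.abs)).aestronglyMeasurable
      (ae_of_all _ fun q => ?_)
    split_ifs <;> simp
  have e1 : ∀ t : ℝ, ∫ q, Ψ (q, t) ∂P = P.real (Set.Ioi z ×ˢ Set.Ioi t)
      - (if t < 0 then 1 else 0) * P.real (Prod.fst ⁻¹' Set.Ioi z) := by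
    intro t
    have hA : MeasurableSet (Set.Ioi z ×ˢ Set.Ioi t : Set (ℝ × ℝ)) :=
      measurableSet_Ioi.prod measurableSet_Ioi
    have hB : MeasurableSet (Prod.fst ⁻¹' Set.Ioi z : Set (ℝ × ℝ)) :=
      measurable_fst measurableSet_Ioi
    have : ∀ q : ℝ × ℝ, Ψ (q, t) = (Set.Ioi z ×ˢ Set.Ioi t).indicator (fun _ => (1 : ℝ)) q
        - (if t < 0 then 1 else 0) * (Prod.fst ⁻¹' Set.Ioi z).indicator (fun _ => (1 : ℝ)) q := by
      intro q
      simp only [hΨ, cc, Set.indicator, Set.mem_prod, Set.mem_Ioi, Set.mem_preimage]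
      by_cases h1 : z < q.1 <;> by_cases h2 : t < q.2 <;> by_cases h3 : t < 0 <;> simp [h1, h2, h3]
    simp only [this]
    rw [integral_sub, integral_const_mul, integral_indicator_const _ hA,
      integral_indicator_const _ hB]
    · simp
    · exact (integrable_const _).indicator hA
    · exact ((integrable_const _).indicator hB).const_mul _
  constructor
  · simpa only [e1] using hintg.integral_prod_right
  · have := integral_integral_swap (f := fun q t => Ψ (q, t)) hintg
    simp only [e1] at this
    rw [← this]
    congr 1; ext q
    show ∫ t, (if z < q.1 then (1:ℝ) else 0) * cc q.2 t = _
    rw [integral_const_mul, integral_cc]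

lemma hasDerivAt_gd (z : ℝ) : HasDerivAt (fun z => - gd z) (z * gd z) z := by
  have : (fun z : ℝ => - gd z) = fun z => -((√(2 * π))⁻¹ * rexp (- z ^ 2 / 2)) := by
    ext z; rw [gd_eq]
  rw [this, gd_eq]
  have h := (((((hasDerivAt_id z).pow 2).neg.div_const 2).exp).const_mul (√(2 * π))⁻¹).neg
  refine HasDerivAt.congr_deriv (f' := _) (by exact h) ?_
  show -((√(2 * π))⁻¹ * (rexp (- z ^ 2 / 2) * (-(((2:ℕ):ℝ) * z ^ (2 - 1) * 1) / 2))) = _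
  push_cast
  ring

lemma integral_Ioi_id (z : ℝ) : ∫ w : ℝ, (if z < w then 1 else 0) * w ∂gm = gd z := by
  have h1 : ∫ w : ℝ, (if z < w then 1 else 0) * w ∂gm = ∫ w in Set.Ioi z, w * gd w := by
    rw [integral_gaussianReal_eq_integral_smul one_ne_zero, ← integral_indicator measurableSet_Ioi]
    congr 1; ext w
    simp only [Set.indicator, Set.mem_Ioi, smul_eq_mul]
    split_ifs <;> simp [mul_comm]
  have hintg : Integrable (fun w => w * gd w) := by
    have := integrable_id_gm
    rw [gm, gaussianReal_of_var_ne_zero _ one_ne_zero,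
      integrable_withDensity_iff_integrable_smul' (measurable_gaussianPDF _ _)
        (ae_of_all _ fun x => gaussianPDF_lt_top)] at this
    simpa [mul_comm] using this
  have hlim : Tendsto (fun z => - gd z) atTop (nhds 0) := by
    have : (fun z : ℝ => - gd z) = fun z => -((√(2 * π))⁻¹ * rexp (- z ^ 2 / 2)) := by
      ext z; rw [gd_eq]
    rw [this]
    have h2 : Tendsto (fun z : ℝ => rexp (- z ^ 2 / 2)) atTop (nhds 0) := by
      apply Real.tendsto_exp_atBot.comp
      have : Tendsto (fun z : ℝ => z ^ 2 / 2) atTop atTop :=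
        (tendsto_pow_atTop two_ne_zero).atTop_div_const two_pos
      refine (tendsto_neg_atTop_atBot.comp this).congr (fun z => ?_)
      simp only [Function.comp]; ring
    simpa using (h2.const_mul _).neg
  rw [h1, integral_Ioi_of_hasDerivAt_of_tendsto' (fun x _ => hasDerivAt_gd x) hintg.integrableOn hlim]
  simp

lemma KK_marginal {r : ℝ} (hr : r ^ 2 < 1) (z : ℝ) :
    Integrable (fun t => KK r z t) ∧ ∫ t, KK r z t = r * gd z := by
  have := gr_prob hr
  have i1 : Integrable (fun q : ℝ × ℝ => q.2) (gr r) := int_snd (ψ := fun z => z) hr integrable_id_gm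
  have i2 : Integrable (fun q : ℝ × ℝ => q.2) (gm.prod gm) := integrable_id_gm.comp_snd gm
  obtain ⟨a1, b1⟩ := hoeff_half (gr r) i1 z
  obtain ⟨a2, b2⟩ := hoeff_half (gm.prod gm) i2 z
  have e : ∀ t, KK r z t = ((gr r).real (Set.Ioi z ×ˢ Set.Ioi t)
      - (if t < 0 then 1 else 0) * (gr r).real (Prod.fst ⁻¹' Set.Ioi z)) -
      ((gm.prod gm).real (Set.Ioi z ×ˢ Set.Ioi t)
      - (if t < 0 then 1 else 0) * (gm.prod gm).real (Prod.fst ⁻¹' Set.Ioi z)) := by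
    intro t
    have h1 : (gr r).real (Prod.fst ⁻¹' Set.Ioi z) = gm.real (Set.Ioi z) := by
      rw [← map_measureReal_apply measurable_fst measurableSet_Ioi, gr_fst hr]
    have h2 : (gm.prod gm).real (Prod.fst ⁻¹' Set.Ioi z) = gm.real (Set.Ioi z) := by
      rw [← map_measureReal_apply measurable_fst measurableSet_Ioi]
      simp
    rw [h1, h2, measureReal_prod_prod, KK]; ring
  simp only [e]
  refine ⟨a1.sub a2, ?_⟩
  rw [integral_sub a1 a2, b1, b2]
  have hi : Measurable (fun q : ℝ × ℝ => (if z < q.1 then (1 : ℝ) else 0)) :=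
    Measurable.ite (measurableSet_lt measurable_const measurable_fst) measurable_const
      measurable_const
  have j : ∀ {P : Measure (ℝ × ℝ)}, Integrable (fun q : ℝ × ℝ => q.2) P →
      Integrable (fun q : ℝ × ℝ => (if z < q.1 then 1 else 0) * q.2) P := by
    intro P hP
    refine Integrable.mono' hP.abs (hi.mul measurable_snd).aestronglyMeasurable
      (ae_of_all _ fun q => ?_)
    split_ifs <;> simp
  rw [integral_gr hr (j i1), integral_prod _ (j i2)]
  have h0 : ∀ x : ℝ, ∫ y, (if z < x then (1:ℝ) else 0) * y ∂gm = 0 := by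
    intro x; rw [integral_const_mul, integral_id_gaussianReal, mul_zero]
  simp only [h0, integral_zero, sub_zero]
  have : ∀ w : ℝ, ∫ y, (if z < w then 1 else 0) * y
      ∂(gaussianReal (r * w) (Real.toNNReal (1 - r ^ 2))) = r * ((if z < w then 1 else 0) * w) := by
    intro w; rw [integral_const_mul, integral_id_gaussianReal]; ring
  simp only [this]
  rw [integral_const_mul, integral_Ioi_id]

/-- Gaussian coupling with density `KK/r` -/
def kap (r : ℝ) : Measure (ℝ × ℝ) :=
  volume.withDensity (fun q => ENNReal.ofReal (KK r q.1 q.2 / r))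

lemma kap_fst {r : ℝ} (hr0 : 0 < r) (hr : r ^ 2 < 1) : (kap r).map Prod.fst = gm := by
  ext s hs
  have hK : Measurable (fun q : ℝ × ℝ => ENNReal.ofReal (KK r q.1 q.2 / r)) :=
    ((measurable_KK hr).div_const _).ennreal_ofReal
  rw [Measure.map_apply measurable_fst hs, kap, withDensity_apply _ (measurable_fst hs),
    ← lintegral_indicator (measurable_fst hs), Measure.volume_eq_prod,
    lintegral_prod _ (hK.indicator (measurable_fst hs)).aemeasurable, gm,
    gaussianReal_of_var_ne_zero _ one_ne_zero, withDensity_apply _ hs, ← lintegral_indicator hs]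
  congr 1; ext z
  by_cases hz : z ∈ s
  · have : ∀ t : ℝ, (Prod.fst ⁻¹' s).indicator
        (fun q : ℝ × ℝ => ENNReal.ofReal (KK r q.1 q.2 / r)) (z, t) = ENNReal.ofReal (KK r z t / r) := by
      intro t; rw [Set.indicator_of_mem (by exact hz)]
    simp only [this]
    rw [Set.indicator_of_mem hz, ← ofReal_integral_eq_lintegral_ofReal
      ((KK_marginal hr z).1.div_const r)
      (ae_of_all _ fun t => div_nonneg (KK_nonneg hr0.le hr z t) hr0.le), integral_div,
      (KK_marginal hr z).2, gaussianPDF]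
    congr 1
    field_simp
  · have : ∀ t : ℝ, (Prod.fst ⁻¹' s).indicator
        (fun q : ℝ × ℝ => ENNReal.ofReal (KK r q.1 q.2 / r)) (z, t) = 0 := by
      intro t; rw [Set.indicator_of_notMem (by exact hz)]
    simp only [this]
    rw [Set.indicator_of_notMem hz]; simp

lemma kap_swap {r : ℝ} (hr : r ^ 2 < 1) : (kap r).map Prod.swap = kap r := by
  have hK : Measurable (fun q : ℝ × ℝ => ENNReal.ofReal (KK r q.1 q.2 / r)) :=
    ((measurable_KK hr).div_const _).ennreal_ofReal
  ext s hs
  rw [Measure.map_apply measurable_swap hs, kap, withDensity_apply _ (measurable_swap hs),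
    withDensity_apply _ hs, ← lintegral_indicator (measurable_swap hs), ← lintegral_indicator hs,
    Measure.volume_eq_prod, ← lintegral_prod_swap]
  congr 1; ext q
  simp only [Set.indicator, Set.mem_preimage, Prod.swap_swap]
  congr 1
  simp only [Prod.fst_swap, Prod.snd_swap]
  rw [KK_symm]

lemma kap_snd {r : ℝ} (hr0 : 0 < r) (hr : r ^ 2 < 1) : (kap r).map Prod.snd = gm := by
  conv_lhs => rw [← kap_swap hr]
  rw [Measure.map_map measurable_snd measurable_swap]
  exact kap_fst hr0 hr

lemma kap_prob {r : ℝ} (hr0 : 0 < r) (hr : r ^ 2 < 1) : IsProbabilityMeasure (kap r) := by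
  constructor
  have := congrArg (fun μ => μ Set.univ) (kap_fst hr0 hr)
  simpa [Measure.map_apply measurable_fst MeasurableSet.univ] using this

end LpS

namespace LpS

open ProbabilityTheory

/-- Lebesgue measure on a bounded interval -/
abbrev lam (R : ℝ) : Measure ℝ := volume.restrict (Set.Ioo (-R) R)

lemma cdf_continuous (P : Measure ℝ) [IsProbabilityMeasure P] (h : ∀ x, P {x} = 0) :
    Continuous (cdf P) := by
  rw [continuous_iff_continuousAt]
  intro x
  rw [(monotone_cdf P).continuousAt_iff_leftLim_eq_rightLim, (cdf P).rightLim_eq]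
  have h1 := (cdf P).measure_singleton x
  rw [measure_cdf, h x] at h1
  have h2 := (monotone_cdf P).leftLim_le (le_refl x)
  have h3 := ENNReal.ofReal_eq_zero.mp h1.symm
  linarith

lemma cdf_lt (P : Measure ℝ) [IsProbabilityMeasure P] {a b : ℝ} (hab : a < b)
    (h : P (Set.Ioo a b) ≠ 0) : cdf P a < cdf P b := by
  rw [cdf_eq_real, cdf_eq_real]
  have h1 : P.real (Set.Iic a) + P.real (Set.Ioo a b) ≤ P.real (Set.Iic b) := by
    rw [← measureReal_union (by
      rw [Set.disjoint_left]; intro x hx hx'; exact absurd hx'.1 (not_lt.mpr hx)) measurableSet_Ioo]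
    refine measureReal_mono ?_ (measure_ne_top _ _)
    rintro x (hx | hx)
    · exact le_trans hx hab.le
    · exact hx.2.le
  have h2 : 0 < P.real (Set.Ioo a b) := by
    rw [measureReal_def]; exact ENNReal.toReal_pos h (measure_ne_top _ _)
  linarith

lemma gm_cdf_strictMono : StrictMono (cdf gm) := by
  intro a b hab
  apply cdf_lt gm hab
  intro h
  have := gaussianReal_absolutelyContinuous' 0 (v := 1) one_ne_zero h
  simp at this
  linarith

lemma gm_cdf_continuous : Continuous (cdf gm) := by
  have := nullSingletonClass_gaussianReal (μ := 0) (v := 1) one_ne_zero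
  exact cdf_continuous gm (fun x => measure_singleton x)

lemma gm_cdf_mem (z : ℝ) : cdf gm z ∈ Set.Ioo (0 : ℝ) 1 := by
  constructor
  · exact lt_of_le_of_lt (cdf_nonneg _ (z - 1)) (gm_cdf_strictMono (by linarith))
  · exact lt_of_lt_of_le (gm_cdf_strictMono (show z < z + 1 by linarith)) (cdf_le_one _ _)

lemma gm_cdf_surj {c : ℝ} (hc : c ∈ Set.Ioo (0 : ℝ) 1) : ∃ z, cdf gm z = c := by
  apply mem_range_of_exists_le_of_exists_ge gm_cdf_continuous
  · obtain ⟨a, ha⟩ := ((tendsto_cdf_atBot gm).eventually_lt_const hc.1).exists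
    exact ⟨a, ha.le⟩
  · obtain ⟨a, ha⟩ := ((tendsto_cdf_atTop gm).eventually_const_lt hc.2).exists
    exact ⟨a, ha.le⟩

/-- monotone transport from the Gaussian to a density on an interval -/
structure Tr (R : ℝ) (u : ℝ → ℝ) (T : ℝ → ℝ) : Prop where
  meas : Measurable T
  mono : StrictMono T
  mem : ∀ z, T z ∈ Set.Ioo (-R) R
  map : gm.map T = (lam R).withDensity (fun x => ENNReal.ofReal (u x))

/-- a positive bounded measurable probability density -/
structure Dens {X : Type*} [MeasurableSpace X] (μ : Measure X) (m M : ℝ) (u : X → ℝ) : Prop where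
  meas : Measurable u
  lo : ∀ x, m ≤ u x
  hi : ∀ x, u x ≤ M
  int : ∫ x, u x ∂μ = 1

lemma Dens.integrable {X : Type*} [MeasurableSpace X] {μ : Measure X} [IsFiniteMeasure μ] {m M : ℝ}
    {u : X → ℝ} (h : Dens μ m M u) : Integrable u μ := by
  refine Integrable.of_bound h.meas.aestronglyMeasurable (|m| + |M|) (ae_of_all _ fun x => ?_)
  rw [Real.norm_eq_abs, abs_le]
  constructor
  · have := h.lo x; have := neg_abs_le m; have := abs_nonneg M; linarith
  · have := h.hi x; have := le_abs_self M; have := abs_nonneg m; linarith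

lemma Dens.prob {X : Type*} [MeasurableSpace X] {μ : Measure X} [IsFiniteMeasure μ] {m M : ℝ}
    {u : X → ℝ} (hm : 0 < m) (h : Dens μ m M u) :
    IsProbabilityMeasure (μ.withDensity (fun x => ENNReal.ofReal (u x))) := by
  constructor
  rw [withDensity_apply _ MeasurableSet.univ, Measure.restrict_univ,
    ← ofReal_integral_eq_lintegral_ofReal h.integrable
      (ae_of_all _ fun x => (hm.le.trans (h.lo x))), h.int, ENNReal.ofReal_one]

lemma lam_Iic_le {R x : ℝ} (P : Measure ℝ) (hP : P ≪ lam R) (hx : x ≤ -R) : P (Set.Iic x) = 0 := by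
  apply hP
  rw [Measure.restrict_apply measurableSet_Iic]
  have : Set.Iic x ∩ Set.Ioo (-R) R = ∅ := by
    ext y; simp; intro h1 h2; linarith
  rw [this]; simp

lemma lam_Iic_ge {R x : ℝ} (P : Measure ℝ) [IsProbabilityMeasure P] (hP : P ≪ lam R) (hx : R ≤ x) :
    P (Set.Iic x) = 1 := by
  rw [prob_compl_eq_zero_iff measurableSet_Iic |>.symm]
  apply hP
  rw [Measure.restrict_apply measurableSet_Iic.compl]
  have : (Set.Iic x)ᶜ ∩ Set.Ioo (-R) R = ∅ := by
    ext y; simp; intro h1 h2; linarith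
  rw [this]; simp

lemma cdf_u_lt {R : ℝ} {u : ℝ → ℝ} {m M : ℝ} (hm : 0 < m) (hu : Dens (lam R) m M u) 
    {a b : ℝ} (ha : -R ≤ a) (hab : a < b) (hb : b ≤ R) :
    cdf ((lam R).withDensity (fun x => ENNReal.ofReal (u x))) a <
    cdf ((lam R).withDensity (fun x => ENNReal.ofReal (u x))) b := by
  have := hu.prob hm
  apply cdf_lt _ hab
  intro h
  have h2 : lam R ≪ (lam R).withDensity (fun x => ENNReal.ofReal (u x)) := by
    apply withDensity_absolutelyContinuous' (hu.meas.ennreal_ofReal.aemeasurable)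
    refine ae_of_all _ fun x => ?_
    simpa using lt_of_lt_of_le hm (hu.lo x)
  have h3 := h2 h
  rw [Measure.restrict_apply measurableSet_Ioo, Set.inter_eq_left.mpr
    (Set.Ioo_subset_Ioo ha hb)] at h3
  simp at h3
  linarith

lemma exists_T {R : ℝ} (hR : 0 < R) {u : ℝ → ℝ} {m M : ℝ} (hm : 0 < m) (hu : Dens (lam R) m M u) 
    (z : ℝ) : ∃ x ∈ Set.Ioo (-R) R,
    cdf ((lam R).withDensity (fun x => ENNReal.ofReal (u x))) x = cdf gm z := by
  have hp := hu.prob hm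
  set P := (lam R).withDensity (fun x => ENNReal.ofReal (u x)) with hPdef
  have hP : P ≪ lam R := withDensity_absolutelyContinuous _ _
  have hc : Continuous (cdf P) := cdf_continuous P (fun x => hP (measure_singleton x))
  have := intermediate_value_Ioo (show -R ≤ R by linarith) hc.continuousOn
  rw [cdf_eq_real, cdf_eq_real, measureReal_def, measureReal_def, lam_Iic_le P hP le_rfl,
    lam_Iic_ge P hP le_rfl] at this
  simp only [ENNReal.toReal_zero, ENNReal.toReal_one] at this
  obtain ⟨x, hx, e⟩ := this (gm_cdf_mem z)
  exact ⟨x, hx, e⟩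

lemma T_le_iff {R : ℝ} {u : ℝ → ℝ} {m M : ℝ} (hm : 0 < m) (hu : Dens (lam R) m M u) 
    {x y z : ℝ} (hx : x ∈ Set.Ioo (-R) R)
    (hy : y ∈ Set.Ioo (-R) R)
    (e : cdf ((lam R).withDensity (fun x => ENNReal.ofReal (u x))) y = cdf gm z) :
    y ≤ x ↔ cdf gm z ≤ cdf ((lam R).withDensity (fun x => ENNReal.ofReal (u x))) x := by
  rw [← e]
  constructor
  · intro h; exact monotone_cdf _ h
  · intro h
    by_contra hc
    push Not at hc
    have := cdf_u_lt hm hu hx.1.le hc hy.2.le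
    linarith


lemma exists_transport {Θ : Type} [MeasurableSpace Θ] {R : ℝ} (hR : 0 < R) {m M : ℝ} (hm : 0 < m)
    (u : Θ → ℝ → ℝ) (hmeas : Measurable (Function.uncurry u))
    (hu : ∀ θ, Dens (lam R) m M (u θ)) :
    ∃ T : Θ → ℝ → ℝ, Measurable (Function.uncurry T) ∧ ∀ θ, Tr R (u θ) (T θ) := by
  choose T hT hTe using fun θ z => exists_T hR hm (hu θ) z
  have hF : ∀ θ x, cdf ((lam R).withDensity (fun x => ENNReal.ofReal (u θ x))) x =
      (∫⁻ t in Set.Iic x, ENNReal.ofReal (u θ t) ∂(lam R)).toReal := by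
    intro θ x
    have := (hu θ).prob hm
    rw [cdf_eq_real, measureReal_def, withDensity_apply _ measurableSet_Iic]
  have hTm : Measurable (Function.uncurry T) := by
    apply measurable_of_Iic
    intro x
    by_cases h1 : x ≤ -R
    · have : Function.uncurry T ⁻¹' Set.Iic x = ∅ := by
        ext ⟨θ, z⟩; simp; linarith [(hT θ z).1]
      rw [this]; exact MeasurableSet.empty
    by_cases h2 : R ≤ x
    · have : Function.uncurry T ⁻¹' Set.Iic x = Set.univ := by
        ext ⟨θ, z⟩; simp; linarith [(hT θ z).2]
      rw [this]; exact MeasurableSet.univ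
    have : Function.uncurry T ⁻¹' Set.Iic x = {q : Θ × ℝ | cdf gm q.2 ≤
        (∫⁻ t in Set.Iic x, ENNReal.ofReal (u q.1 t) ∂(lam R)).toReal} := by
      ext ⟨θ, z⟩
      simp only [Set.mem_preimage, Function.uncurry, Set.mem_Iic, Set.mem_ofPred_eq]
      rw [T_le_iff hm (hu θ) ⟨not_le.mp h1, not_le.mp h2⟩ (hT θ z) (hTe θ z), hF]
    rw [this]
    apply measurableSet_le
    · exact gm_cdf_continuous.measurable.comp measurable_snd
    · have : Measurable fun θ => ∫⁻ t in Set.Iic x, ENNReal.ofReal (u θ t) ∂(lam R) :=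
        Measurable.lintegral_prod_right (f := fun θ t => ENNReal.ofReal (u θ t))
          hmeas.ennreal_ofReal
      exact this.ennreal_toReal.comp measurable_fst
  refine ⟨T, hTm, fun θ => ?_⟩
  have hTθ : Measurable (T θ) := hTm.comp (measurable_const.prodMk measurable_id)
  have hp := (hu θ).prob hm
  refine ⟨hTθ, ?_, hT θ, ?_⟩
  · intro z z' h
    by_contra hc
    push Not at hc
    have := gm_cdf_strictMono h
    rw [← hTe θ z, ← hTe θ z'] at this
    exact absurd (monotone_cdf _ hc) (not_le.mpr this)
  · have : IsProbabilityMeasure (gm.map (T θ)) :=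
      Measure.isProbabilityMeasure_map hTθ.aemeasurable
    apply Measure.ext_of_Iic
    intro x
    rw [Measure.map_apply hTθ measurableSet_Iic]
    have hP : (lam R).withDensity (fun x => ENNReal.ofReal (u θ x)) ≪ lam R :=
      withDensity_absolutelyContinuous _ _
    by_cases h1 : x ≤ -R
    · have : T θ ⁻¹' Set.Iic x = ∅ := by
        ext z; simp; linarith [(hT θ z).1]
      rw [this, lam_Iic_le _ hP h1]; simp
    by_cases h2 : R ≤ x
    · have : T θ ⁻¹' Set.Iic x = Set.univ := by
        ext z; simp; linarith [(hT θ z).2]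
      rw [this, lam_Iic_ge _ hP h2]; simp
    have hx : x ∈ Set.Ioo (-R) R := ⟨not_le.mp h1, not_le.mp h2⟩
    have hmem : cdf ((lam R).withDensity (fun x => ENNReal.ofReal (u θ x))) x ∈ Set.Ioo (0 : ℝ) 1 := by
      constructor
      · exact lt_of_le_of_lt (cdf_nonneg _ (-R)) (cdf_u_lt hm (hu θ) le_rfl hx.1 hx.2.le)
      · exact lt_of_lt_of_le (cdf_u_lt hm (hu θ) hx.1.le hx.2 le_rfl) (cdf_le_one _ _)
    obtain ⟨z0, hz0⟩ := gm_cdf_surj hmem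
    have : T θ ⁻¹' Set.Iic x = Set.Iic z0 := by
      ext z
      simp only [Set.mem_preimage, Set.mem_Iic]
      rw [T_le_iff hm (hu θ) hx (hT θ z) (hTe θ z), ← hz0, gm_cdf_strictMono.le_iff_le]
    rw [this, ← ofReal_cdf, hz0, ofReal_cdf]

end LpS

namespace LpS

open ProbabilityTheory

lemma lam_ind {R x : ℝ} (hx : x ∈ Set.Ioo (-R) R) :
    ∫ s, (if s < x then (1 : ℝ) else 0) ∂(lam R) = x + R := by
  have : (fun s => if s < x then (1 : ℝ) else 0) = (Set.Iio x).indicator (fun _ => (1 : ℝ)) := by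
    ext s; simp [Set.indicator]
  rw [this, integral_indicator_const _ measurableSet_Iio, measureReal_def,
    Measure.restrict_apply measurableSet_Iio]
  have : Set.Iio x ∩ Set.Ioo (-R) R = Set.Ioo (-R) x := by
    ext s; simp only [Set.mem_inter_iff, Set.mem_Iio, Set.mem_Ioo]
    constructor
    · intro h; exact ⟨h.2.1, h.1⟩
    · intro h; exact ⟨h.2, h.1, h.2.trans hx.2⟩
  rw [this, Real.volume_Ioo, ENNReal.toReal_ofReal (by linarith [hx.1])]
  simp

/-- layer-cake representation of a mixed moment -/
lemma layer {X : Type} [MeasurableSpace X] (P : Measure X) [IsProbabilityMeasure P] {R : ℝ}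
    {A B : X → ℝ} (hA : Measurable A) (hB : Measurable B) (hA' : ∀ q, A q ∈ Set.Ioo (-R) R)
    (hB' : ∀ q, B q ∈ Set.Ioo (-R) R) :
    Measurable (fun s : ℝ × ℝ => P.real {q | s.1 < A q ∧ s.2 < B q}) ∧
    ∫ q, (A q + R) * (B q + R) ∂P =
      ∫ s : ℝ × ℝ, P.real {q | s.1 < A q ∧ s.2 < B q} ∂((lam R).prod (lam R)) := by
  have a : MeasurableSet {p : (ℝ × ℝ) × X | p.1.1 < A p.2} :=
    measurableSet_lt (by fun_prop) (by fun_prop)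
  have b : MeasurableSet {p : (ℝ × ℝ) × X | p.1.2 < B p.2} :=
    measurableSet_lt (by fun_prop) (by fun_prop)
  have hs : MeasurableSet {p : (ℝ × ℝ) × X | p.1.1 < A p.2 ∧ p.1.2 < B p.2} := a.inter b
  refine ⟨(measurable_measure_prodMk_left hs).ennreal_toReal, ?_⟩
  have hg : Measurable (Function.uncurry fun (s : ℝ × ℝ) (q : X) =>
      (if s.1 < A q then (1 : ℝ) else 0) * (if s.2 < B q then 1 else 0)) :=
    (Measurable.ite a measurable_const measurable_const).mul
      (Measurable.ite b measurable_const measurable_const)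
  have hintg : Integrable (Function.uncurry fun (s : ℝ × ℝ) (q : X) =>
      (if s.1 < A q then (1 : ℝ) else 0) * (if s.2 < B q then 1 else 0))
      (((lam R).prod (lam R)).prod P) := by
    refine Integrable.of_bound hg.aestronglyMeasurable 1 (ae_of_all _ fun s => ?_)
    simp only [Function.uncurry]
    split_ifs <;> simp
  have h := integral_integral_swap hintg
  have e1 : ∀ q, ∫ s : ℝ × ℝ, (if s.1 < A q then (1 : ℝ) else 0) * (if s.2 < B q then 1 else 0)
      ∂((lam R).prod (lam R)) = (A q + R) * (B q + R) := by
    intro q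
    rw [integral_prod_mul (fun x => if x < A q then (1 : ℝ) else 0)
      (fun x => if x < B q then (1 : ℝ) else 0), lam_ind (hA' q), lam_ind (hB' q)]
  have e2 : ∀ s : ℝ × ℝ, ∫ q, (if s.1 < A q then (1 : ℝ) else 0) * (if s.2 < B q then 1 else 0) ∂P =
      P.real {q | s.1 < A q ∧ s.2 < B q} := by
    intro s
    have hm : MeasurableSet {q | s.1 < A q ∧ s.2 < B q} := measurable_prodMk_left hs
    have : ∀ q, (if s.1 < A q then (1 : ℝ) else 0) * (if s.2 < B q then 1 else 0) =
        {q | s.1 < A q ∧ s.2 < B q}.indicator (fun _ => (1 : ℝ)) q := by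
      intro q
      by_cases h1 : s.1 < A q <;> by_cases h2 : s.2 < B q <;> simp [Set.indicator, h1, h2]
    simp only [this]
    rw [integral_indicator_const _ hm]; simp
  simp only [e1, e2] at h
  exact h.symm

lemma chg {R m M : ℝ} {u T : ℝ → ℝ} (hm : 0 < m) (hu : Dens (lam R) m M u) (hT : Tr R u T)
    {h : ℝ → ℝ} (hh : Measurable h) :
    ∫ x, h x ∂(lam R) = ∫ z, h (T z) / u (T z) ∂gm := by
  have := integral_map (μ := gm) hT.meas.aemeasurable
    (f := fun x => h x / u x) (hh.div hu.meas).aestronglyMeasurable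
  rw [← this, hT.map, integral_withDensity_eq_integral_toReal_smul hu.meas.ennreal_ofReal (by simp)]
  congr 1; ext x
  have : 0 < u x := lt_of_lt_of_le hm (hu.lo x)
  rw [ENNReal.toReal_ofReal this.le, smul_eq_mul]
  field_simp

lemma chg2 {R m M m' M' : ℝ} {u T v S : ℝ → ℝ} (hm : 0 < m) (hu : Dens (lam R) m M u)
    (hT : Tr R u T) (hm' : 0 < m') (hv : Dens (lam R) m' M' v) (hS : Tr R v S)
    {h : ℝ × ℝ → ℝ} (hh : Measurable h) (C : ℝ) (hC : ∀ q, |h q| ≤ C) :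
    ∫ q, h q ∂((lam R).prod (lam R)) =
      ∫ q : ℝ × ℝ, h (T q.1, S q.2) / (u (T q.1) * v (S q.2)) ∂(gm.prod gm) := by
  have hTm := hT.meas
  have hSm := hS.meas
  have hum := hu.meas
  have hvm := hv.meas
  have hC0 : 0 ≤ C := (abs_nonneg _).trans (hC (0, 0))
  rw [integral_prod _ (Integrable.of_bound hh.aestronglyMeasurable C (ae_of_all _ hC)),
    integral_prod]
  · have h1 : ∀ x, ∫ y, h (x, y) ∂(lam R) = ∫ z, h (x, S z) / v (S z) ∂gm := fun x =>
      chg hm' hv hS (h := fun y => h (x, y)) (by fun_prop)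
    rw [chg hm hu hT (h := fun x => ∫ y, h (x, y) ∂(lam R))
      (hh.stronglyMeasurable.integral_prod_right').measurable]
    congr 1; ext z
    rw [h1, ← integral_div]
    congr 1; ext w
    rw [div_div, mul_comm]
  · refine Integrable.of_bound (Measurable.aestronglyMeasurable (by fun_prop)) (C / (m * m'))
      (ae_of_all _ fun q => ?_)
    have a1 : 0 < u (T q.1) := lt_of_lt_of_le hm (hu.lo _)
    have a2 : 0 < v (S q.2) := lt_of_lt_of_le hm' (hv.lo _)
    rw [Real.norm_eq_abs, abs_div, abs_of_pos (mul_pos a1 a2)]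
    have := hu.lo (T q.1)
    have := hv.lo (S q.2)
    gcongr
    exact hC _

lemma log_gd (z : ℝ) : Real.log (gd z) = -(1/2) * Real.log (2 * π) - z ^ 2 / 2 := by
  rw [gd_eq, Real.log_mul (by positivity) (by positivity), Real.log_exp, Real.log_inv,
    Real.log_sqrt (by positivity)]
  ring

lemma integrable_log_gd : Integrable (fun z => Real.log (gd z)) gm := by
  simp only [log_gd]
  exact (integrable_const _).sub (integrable_sq_gm.div_const 2)

lemma integral_log_gd : ∫ z, Real.log (gd z) ∂gm = -(1/2) * Real.log (2 * π) - 1/2 := by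
  simp only [log_gd]
  rw [integral_sub (integrable_const _) (integrable_sq_gm.div_const 2), integral_div,
    integral_sq_gm]
  simp

lemma kap_int_fst {r : ℝ} (hr0 : 0 < r) (hr : r ^ 2 < 1) {ψ : ℝ → ℝ} (h : Integrable ψ gm) :
    Integrable (fun q : ℝ × ℝ => ψ q.1) (kap r) ∧ ∫ q : ℝ × ℝ, ψ q.1 ∂(kap r) = ∫ z, ψ z ∂gm := by
  refine ⟨Integrable.comp_measurable (f := Prod.fst) (g := ψ) (by rwa [kap_fst hr0 hr])
    measurable_fst, ?_⟩
  have := integral_map (μ := kap r) (f := ψ) measurable_fst.aemeasurable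
    (by rw [kap_fst hr0 hr]; exact h.1)
  rw [← this, kap_fst hr0 hr]

lemma kap_int_snd {r : ℝ} (hr0 : 0 < r) (hr : r ^ 2 < 1) {ψ : ℝ → ℝ} (h : Integrable ψ gm) :
    Integrable (fun q : ℝ × ℝ => ψ q.2) (kap r) ∧ ∫ q : ℝ × ℝ, ψ q.2 ∂(kap r) = ∫ z, ψ z ∂gm := by
  refine ⟨Integrable.comp_measurable (f := Prod.snd) (g := ψ) (by rwa [kap_snd hr0 hr])
    measurable_snd, ?_⟩
  have := integral_map (μ := kap r) (f := ψ) measurable_snd.aemeasurable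
    (by rw [kap_snd hr0 hr]; exact h.1)
  rw [← this, kap_snd hr0 hr]

/-- change of measure to `kap` -/
lemma to_kap {r : ℝ} (hr0 : 0 < r) (hr : r ^ 2 < 1) (w : ℝ × ℝ → ℝ) :
    ∫ q : ℝ × ℝ, KK r q.1 q.2 * w q ∂(gm.prod gm) =
      ∫ q : ℝ × ℝ, r * gd q.1 * gd q.2 * w q ∂(kap r) := by
  have hK : Measurable (fun q : ℝ × ℝ => ENNReal.ofReal (KK r q.1 q.2 / r)) :=
    ((measurable_KK hr).div_const _).ennreal_ofReal
  have hG := measurable_gaussianPDF 0 1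
  rw [gm, gaussianReal_of_var_ne_zero _ one_ne_zero, prod_withDensity hG hG,
    integral_withDensity_eq_integral_toReal_smul (by fun_prop)
      (ae_of_all _ fun q => ENNReal.mul_lt_top gaussianPDF_lt_top gaussianPDF_lt_top), kap,
    integral_withDensity_eq_integral_toReal_smul hK (by simp), Measure.volume_eq_prod]
  congr 1; ext q
  rw [ENNReal.toReal_mul, toReal_gaussianPDF, toReal_gaussianPDF, ENNReal.toReal_ofReal
    (div_nonneg (KK_nonneg hr0.le hr _ _) hr0.le), smul_eq_mul, smul_eq_mul]
  field_simp

lemma gd_le_one (z : ℝ) : gd z ≤ 1 := by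
  rw [gd_eq]
  have h1 : 1 ≤ √(2 * π) := by
    rw [Real.one_le_sqrt]; nlinarith [Real.pi_gt_three]
  have h2 : rexp (- z ^ 2 / 2) ≤ 1 := by
    rw [Real.exp_le_one_iff]; nlinarith [sq_nonneg z]
  have h3 : (√(2 * π))⁻¹ ≤ 1 := inv_le_one_of_one_le₀ h1
  exact mul_le_one₀ h3 (Real.exp_pos _).le h2

lemma gd_pos (z : ℝ) : 0 < gd z := gaussianPDFReal_pos 0 1 z one_ne_zero

lemma log_bdd {m M x : ℝ} (hm : 0 < m) (h1 : m ≤ x) (h2 : x ≤ M) :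
    |Real.log x| ≤ |Real.log m| + |Real.log M| := by
  have a := Real.log_le_log hm h1
  have b := Real.log_le_log (hm.trans_le h1) h2
  rw [abs_le]
  constructor
  · linarith [neg_abs_le (Real.log m), abs_nonneg (Real.log M)]
  · linarith [le_abs_self (Real.log M), abs_nonneg (Real.log m)]

lemma integrable_log_u {m M : ℝ} {u T : ℝ → ℝ} (hm : 0 < m) (hum : Measurable u)
    (h1 : ∀ x, m ≤ u x) (h2 : ∀ x, u x ≤ M) (hTm : Measurable T) :
    Integrable (fun z => Real.log (u (T z))) gm :=
  Integrable.of_bound (Measurable.aestronglyMeasurable (by fun_prop))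
    (|Real.log m| + |Real.log M|) (ae_of_all _ fun _ => log_bdd hm (h1 _) (h2 _))

lemma kap_lower {r : ℝ} (hr0 : 0 < r) (hr : r ^ 2 < 1) {R m M m' M' : ℝ} {u T v S : ℝ → ℝ}
    (hm : 0 < m) (hu : Dens (lam R) m M u)
    (hT : Measurable T) (hm' : 0 < m') (hv : Dens (lam R) m' M' v) (hS : Measurable S) :
    Real.log r - Real.log (2 * π) - ∫ z, Real.log (u (T z)) ∂gm - ∫ z, Real.log (v (S z)) ∂gm ≤
    ∫ q : ℝ × ℝ, r * gd q.1 * gd q.2 * (u (T q.1) * v (S q.2))⁻¹ ∂(kap r) := by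
  have := kap_prob hr0 hr
  have hum := hu.meas
  have hvm := hv.meas
  have iu := integrable_log_u hm hum hu.lo hu.hi hT
  have iv := integrable_log_u hm' hvm hv.lo hv.hi hS
  obtain ⟨g1, g1'⟩ := kap_int_fst hr0 hr integrable_log_gd
  obtain ⟨g2, g2'⟩ := kap_int_snd hr0 hr integrable_log_gd
  obtain ⟨u1, u1'⟩ := kap_int_fst hr0 hr iu
  obtain ⟨v1, v1'⟩ := kap_int_snd hr0 hr iv
  have e : ∫ q : ℝ × ℝ, ((1 + Real.log r) + Real.log (gd q.1) + Real.log (gd q.2)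
      - Real.log (u (T q.1)) - Real.log (v (S q.2))) ∂(kap r) =
      Real.log r - Real.log (2 * π) - ∫ z, Real.log (u (T z)) ∂gm - ∫ z, Real.log (v (S z)) ∂gm := by
    have c0 : Integrable (fun _ : ℝ × ℝ => 1 + Real.log r) (kap r) := integrable_const _
    rw [integral_sub (((c0.fun_add g1).fun_add g2).sub' u1) v1,
      integral_sub ((c0.fun_add g1).fun_add g2) u1,
      integral_add (c0.fun_add g1) g2, integral_add c0 g1, g1', g2', u1', v1', integral_log_gd]
    simp
    ring
  rw [← e]
  have c0 : Integrable (fun _ : ℝ × ℝ => 1 + Real.log r) (kap r) := integrable_const _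
  apply integral_mono ((((c0.add g1).add g2).sub u1).sub v1)
  · have hg : Measurable gd := measurable_gaussianPDFReal 0 1
    refine Integrable.of_bound (Measurable.aestronglyMeasurable (by fun_prop)) (r * 1 * 1 * (m * m')⁻¹)
      (ae_of_all _ fun q => ?_)
    have a1 : 0 < u (T q.1) := lt_of_lt_of_le hm (hu.lo _)
    have a2 : 0 < v (S q.2) := lt_of_lt_of_le hm' (hv.lo _)
    have b1 := gd_pos q.1
    have b2 := gd_pos q.2
    rw [Real.norm_eq_abs, abs_of_pos (by positivity)]
    have := hu.lo (T q.1)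
    have := hv.lo (S q.2)
    have := gd_le_one q.1
    have := gd_le_one q.2
    gcongr
  · intro q
    have a1 : 0 < u (T q.1) := lt_of_lt_of_le hm (hu.lo _)
    have a2 : 0 < v (S q.2) := lt_of_lt_of_le hm' (hv.lo _)
    have b1 := gd_pos q.1
    have b2 := gd_pos q.2
    have hX : 0 < r * gd q.1 * gd q.2 * (u (T q.1) * v (S q.2))⁻¹ := by positivity
    have := Real.log_le_sub_one_of_pos hX
    rw [Real.log_mul (by positivity) (by positivity), Real.log_mul (by positivity) b2.ne',
      Real.log_mul hr0.ne' b1.ne', Real.log_inv, Real.log_mul a1.ne' a2.ne'] at this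
    show (1 + Real.log r) + Real.log (gd q.1) + Real.log (gd q.2)
      - Real.log (u (T q.1)) - Real.log (v (S q.2)) ≤ _
    linarith

lemma Tr.integrable {R : ℝ} {u T : ℝ → ℝ} (hT : Tr R u T) : Integrable T gm := by
  refine Integrable.of_bound hT.meas.aestronglyMeasurable R (ae_of_all _ fun z => ?_)
  have := hT.mem z
  rw [Real.norm_eq_abs, abs_le]; exact ⟨this.1.le, this.2.le⟩

lemma shift_eq {R : ℝ} (P : Measure (ℝ × ℝ)) [IsProbabilityMeasure P] {A B : ℝ × ℝ → ℝ}
    (hA : Measurable A) (hB : Measurable B) (hA' : ∀ q, A q ∈ Set.Ioo (-R) R)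
    (hB' : ∀ q, B q ∈ Set.Ioo (-R) R) :
    ∫ q, (A q + R) * (B q + R) ∂P =
      ∫ q, A q * B q ∂P + R * ∫ q, A q ∂P + R * ∫ q, B q ∂P + R ^ 2 := by
  have hA2 : ∀ q, |A q| ≤ R := fun q => abs_le.mpr ⟨(hA' q).1.le, (hA' q).2.le⟩
  have hB2 : ∀ q, |B q| ≤ R := fun q => abs_le.mpr ⟨(hB' q).1.le, (hB' q).2.le⟩
  have iA : Integrable A P := Integrable.of_bound hA.aestronglyMeasurable R (ae_of_all _ hA2)
  have iB : Integrable B P := Integrable.of_bound hB.aestronglyMeasurable R (ae_of_all _ hB2)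
  have iAB : Integrable (fun q => A q * B q) P := by
    refine Integrable.of_bound (hA.mul hB).aestronglyMeasurable (R * R) (ae_of_all _ fun q => ?_)
    rw [norm_mul]
    exact mul_le_mul (hA2 q) (hB2 q) (norm_nonneg _) ((abs_nonneg _).trans (hA2 q))
  have c0 : Integrable (fun _ : ℝ × ℝ => R ^ 2) P := integrable_const _
  have : ∀ q, (A q + R) * (B q + R) = A q * B q + R * A q + R * B q + R ^ 2 := fun q => by ring
  simp only [this]
  rw [integral_add ((iAB.fun_add (iA.const_mul R)).fun_add (iB.const_mul R)) c0,
    integral_add (iAB.fun_add (iA.const_mul R)) (iB.const_mul R), integral_add iAB (iA.const_mul R),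
    integral_const_mul, integral_const_mul]
  simp

/-- the one dimensional covariance inequality -/
lemma one_dim {r : ℝ} (hr0 : 0 < r) (hr : r ^ 2 < 1) {R m M m' M' : ℝ} {u T v S : ℝ → ℝ}
    (hm : 0 < m) (hu : Dens (lam R) m M u) (hT : Tr R u T)
    (hm' : 0 < m') (hv : Dens (lam R) m' M' v) (hS : Tr R v S) :
    (∫ z, T z ∂gm) * (∫ z, S z ∂gm) + Real.log r - Real.log (2 * π)
      - ∫ z, Real.log (u (T z)) ∂gm - ∫ z, Real.log (v (S z)) ∂gm ≤
    ∫ q : ℝ × ℝ, T q.1 * S q.2 ∂(gr r) := by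
  have := gr_prob hr
  have hA : Measurable (fun q : ℝ × ℝ => T q.1) := hT.meas.comp measurable_fst
  have hB : Measurable (fun q : ℝ × ℝ => S q.2) := hS.meas.comp measurable_snd
  have hA' : ∀ q : ℝ × ℝ, T q.1 ∈ Set.Ioo (-R) R := fun q => hT.mem _
  have hB' : ∀ q : ℝ × ℝ, S q.2 ∈ Set.Ioo (-R) R := fun q => hS.mem _
  obtain ⟨m1, e1⟩ := layer (gr r) hA hB hA' hB'
  obtain ⟨m2, e2⟩ := layer (gm.prod gm) hA hB hA' hB'
  rw [shift_eq _ hA hB hA' hB'] at e1 e2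
  rw [integral_fst' hr hT.meas.aestronglyMeasurable,
    integral_snd' hr hS.meas.aestronglyMeasurable] at e1
  rw [integral_prod_mul T S, integral_fun_fst, integral_fun_snd] at e2
  simp only [probReal_univ, one_smul] at e2
  have i1 : Integrable (fun s : ℝ × ℝ => (gr r).real {q | s.1 < T q.1 ∧ s.2 < S q.2})
      ((lam R).prod (lam R)) :=
    Integrable.of_bound m1.aestronglyMeasurable 1 (ae_of_all _ fun s => by
      rw [Real.norm_eq_abs, abs_of_nonneg measureReal_nonneg]; exact measureReal_le_one)
  have i2 : Integrable (fun s : ℝ × ℝ => (gm.prod gm).real {q | s.1 < T q.1 ∧ s.2 < S q.2})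
      ((lam R).prod (lam R)) :=
    Integrable.of_bound m2.aestronglyMeasurable 1 (ae_of_all _ fun s => by
      rw [Real.norm_eq_abs, abs_of_nonneg measureReal_nonneg]; exact measureReal_le_one)
  have e3 := integral_sub i1 i2
  rw [chg2 hm hu hT hm' hv hS (m1.fun_sub m2) 2 (fun q => by
    have a1 : (gr r).real {s | q.1 < T s.1 ∧ q.2 < S s.2} ≤ 1 := measureReal_le_one
    have a2 : (gm.prod gm).real {s | q.1 < T s.1 ∧ q.2 < S s.2} ≤ 1 := measureReal_le_one
    have a3 : 0 ≤ (gr r).real {s | q.1 < T s.1 ∧ q.2 < S s.2} := measureReal_nonneg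
    have a4 : 0 ≤ (gm.prod gm).real {s | q.1 < T s.1 ∧ q.2 < S s.2} := measureReal_nonneg
    rw [abs_le]; constructor <;> linarith)] at e3
  have e4 : ∀ q : ℝ × ℝ, ((gr r).real {s | T q.1 < T s.1 ∧ S q.2 < S s.2} -
      (gm.prod gm).real {s | T q.1 < T s.1 ∧ S q.2 < S s.2}) /
      (u (T q.1) * v (S q.2)) = KK r q.1 q.2 * (u (T q.1) * v (S q.2))⁻¹ := by
    intro q
    rw [div_eq_mul_inv]
    congr 1
    have : {s : ℝ × ℝ | T q.1 < T s.1 ∧ S q.2 < S s.2} = Set.Ioi q.1 ×ˢ Set.Ioi q.2 := by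
      ext s; simp [hT.mono.lt_iff_lt, hS.mono.lt_iff_lt]
    simp only [this, KK, measureReal_prod_prod]
  simp only [e4] at e3
  rw [to_kap hr0 hr] at e3
  have := kap_lower hr0 hr hm hu hT.meas hm' hv hS.meas
  linarith

end LpS

namespace LpS

open ProbabilityTheory

lemma mp_integral {P X : Type} [MeasurableSpace P] [MeasurableSpace X] {ρ : Measure P}
    {μ : Measure X} {e : P → X} (he : MeasurePreserving e ρ μ) {ψ : X → ℝ} (h : Integrable ψ μ) :
    Integrable (fun q => ψ (e q)) ρ ∧ ∫ q, ψ (e q) ∂ρ = ∫ x, ψ x ∂μ := by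
  constructor
  · exact Integrable.comp_measurable (f := e) (g := ψ) (by rwa [he.map_eq]) he.measurable
  · have := integral_map (μ := ρ) (f := ψ) he.measurable.aemeasurable (by rw [he.map_eq]; exact h.1)
    rw [← this, he.map_eq]

lemma mp_lintegral {P X : Type} [MeasurableSpace P] [MeasurableSpace X] {ρ : Measure P}
    {μ : Measure X} {e : P → X} (he : MeasurePreserving e ρ μ) {ψ : X → ℝ≥0∞} (h : Measurable ψ) :
    ∫⁻ q, ψ (e q) ∂ρ = ∫⁻ x, ψ x ∂μ := by
  rw [← lintegral_map h he.measurable, he.map_eq]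

lemma glue1 {X P Y Q : Type} [MeasurableSpace X] [MeasurableSpace P] [MeasurableSpace Y]
    [MeasurableSpace Q] (μ : Measure X) (ρ : Measure P) (ν : Measure Y) (κ : Measure Q)
    [IsProbabilityMeasure μ] [IsProbabilityMeasure ρ] [IsProbabilityMeasure ν]
    [IsProbabilityMeasure κ] {e1 e2 : P → X} {f2 : Q → Y}
    (hf2 : MeasurePreserving f2 κ ν)
    (A : X → ℝ) (B : X × Y → ℝ) (a : X → ℝ) (b1 : X × Y → ℝ) (c : ℝ)
    (hB : Integrable B (μ.prod ν)) (hb1 : Integrable b1 (μ.prod ν))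
    (G1 : Integrable (fun p : P × Q => A (e1 p.1) * B (e2 p.1, f2 p.2)) (ρ.prod κ))
    (h1 : ∀ y, (∫ x, A x ∂μ) * (∫ x, B (x, y) ∂μ) + c - ∫ x, a x ∂μ - ∫ x, b1 (x, y) ∂μ ≤
      ∫ p, A (e1 p) * B (e2 p, y) ∂ρ) :
    (∫ x, A x ∂μ) * (∫ p, B p ∂(μ.prod ν)) + c - ∫ x, a x ∂μ - ∫ p, b1 p ∂(μ.prod ν) ≤
      ∫ p : P × Q, A (e1 p.1) * B (e2 p.1, f2 p.2) ∂(ρ.prod κ) := by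
  rw [integral_prod_symm _ G1]
  obtain ⟨iB, eB⟩ := mp_integral hf2 hB.integral_prod_right
  obtain ⟨ib, eb⟩ := mp_integral hf2 hb1.integral_prod_right
  have c0 : Integrable (fun _ : Q => c) κ := integrable_const _
  have c1 : Integrable (fun _ : Q => ∫ x, a x ∂μ) κ := integrable_const _
  have i1 := iB.const_mul (∫ x, A x ∂μ)
  have key := integral_mono (((i1.fun_add c0).sub' c1).sub' ib) G1.integral_prod_right
    (fun q => h1 (f2 q))
  rw [integral_sub ((i1.fun_add c0).sub' c1) ib, integral_sub (i1.fun_add c0) c1,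
    integral_add i1 c0, integral_const_mul, eB, eb, ← integral_prod_symm _ hB,
    ← integral_prod_symm _ hb1] at key
  simpa using key

lemma glue2 {X P Y Q : Type} [MeasurableSpace X] [MeasurableSpace P] [MeasurableSpace Y]
    [MeasurableSpace Q] (μ : Measure X) (ρ : Measure P) (ν : Measure Y) (κ : Measure Q)
    [IsProbabilityMeasure μ] [IsProbabilityMeasure ρ] [IsProbabilityMeasure ν]
    [IsProbabilityMeasure κ] {e1 : P → X} {f1 f2 : Q → Y} {n : ℕ}
    (he1 : MeasurePreserving e1 ρ μ)
    (C : X × Y → Fin n → ℝ) (D : Y → Fin n → ℝ) (a2 : X × Y → ℝ) (b2 : Y → ℝ) (c : ℝ)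
    (hC : ∀ i, Integrable (fun p => C p i) (μ.prod ν)) (ha2 : Integrable a2 (μ.prod ν))
    (G2 : Integrable (fun p : P × Q => ∑ i, C (e1 p.1, f1 p.2) i * D (f2 p.2) i) (ρ.prod κ))
    (h2 : ∀ x, ∑ i, (∫ y, C (x, y) i ∂ν) * (∫ y, D y i ∂ν) + c - ∫ y, a2 (x, y) ∂ν
      - ∫ y, b2 y ∂ν ≤ ∫ q, ∑ i, C (x, f1 q) i * D (f2 q) i ∂κ) :
    ∑ i, (∫ p, C p i ∂(μ.prod ν)) * (∫ y, D y i ∂ν) + c - ∫ p, a2 p ∂(μ.prod ν)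
      - ∫ y, b2 y ∂ν ≤ ∫ p : P × Q, ∑ i, C (e1 p.1, f1 p.2) i * D (f2 p.2) i ∂(ρ.prod κ) := by
  rw [integral_prod _ G2]
  have hCi : ∀ i, Integrable (fun p => (∫ y, C (e1 p, y) i ∂ν) * (∫ y, D y i ∂ν)) ρ := fun i =>
    (mp_integral he1 (hC i).integral_prod_left).1.mul_const _
  obtain ⟨ib, eb⟩ := mp_integral he1 ha2.integral_prod_left
  have c0 : Integrable (fun _ : P => c) ρ := integrable_const _
  have c1 : Integrable (fun _ : P => ∫ y, b2 y ∂ν) ρ := integrable_const _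
  have i1 := integrable_finsetSum Finset.univ (fun i _ => hCi i)
  have key := integral_mono (((i1.fun_add c0).sub' ib).sub' c1) G2.integral_prod_left
    (fun q => h2 (e1 q))
  rw [integral_sub ((i1.fun_add c0).sub' ib) c1, integral_sub (i1.fun_add c0) ib,
    integral_add i1 c0, integral_finsetSum _ (fun i _ => hCi i), eb, ← integral_prod _ ha2] at key
  have : ∀ i, ∫ p, (∫ y, C (e1 p, y) i ∂ν) * (∫ y, D y i ∂ν) ∂ρ =
      (∫ p, C p i ∂(μ.prod ν)) * (∫ y, D y i ∂ν) := by
    intro i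
    rw [integral_mul_const, (mp_integral he1 (hC i).integral_prod_left).2, ← integral_prod _ (hC i)]
  simp only [this] at key
  simpa using key

/-- product Lebesgue measure on a cube -/
abbrev lamn (R : ℝ) (n : ℕ) : Measure (Fin n → ℝ) := Measure.pi (fun _ => lam R)
/-- standard Gaussian in dimension `n` -/
abbrev gmn (n : ℕ) : Measure (Fin n → ℝ) := Measure.pi (fun _ => gm)
/-- correlated Gaussian pair in dimension `n` -/
abbrev grn (r : ℝ) (n : ℕ) : Measure (Fin n → ℝ × ℝ) := Measure.pi (fun _ => gr r)

/-- uncurried `Fin.cons` -/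
def cns {α : Type} {n : ℕ} (q : α × (Fin n → α)) : Fin (n + 1) → α := Fin.cons q.1 q.2

lemma cns_zero {α : Type} {n : ℕ} (q : α × (Fin n → α)) : cns q 0 = q.1 := rfl
lemma cns_succ {α : Type} {n : ℕ} (q : α × (Fin n → α)) (i : Fin n) : cns q i.succ = q.2 i := rfl
lemma cns_tail {α : Type} {n : ℕ} (q : α × (Fin n → α)) : (fun i : Fin n => cns q i.succ) = q.2 := rfl

lemma measurable_cns {α : Type} [MeasurableSpace α] {n : ℕ} :
    Measurable (cns : α × (Fin n → α) → (Fin (n + 1) → α)) := by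
  rw [measurable_pi_iff]
  intro i
  refine Fin.cases ?_ (fun j => ?_) i
  · exact measurable_fst
  · exact (measurable_pi_apply j).comp measurable_snd

lemma mp_cns {α : Type} [MeasurableSpace α] {n : ℕ} (μ : Measure α) [SigmaFinite μ] :
    MeasurePreserving (cns : α × (Fin n → α) → (Fin (n + 1) → α))
      (μ.prod (Measure.pi fun _ => μ)) (Measure.pi fun _ => μ) := by
  have h := (measurePreserving_piFinSuccAbove (fun _ : Fin (n + 1) => μ) 0).symm
  convert h using 1
  ext q i
  refine Fin.cases ?_ (fun j => ?_) i
  · simp [cns, MeasurableEquiv.piFinSuccAbove]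
  · simp [cns, MeasurableEquiv.piFinSuccAbove]

end LpS

namespace LpS

open ProbabilityTheory

/-- push-forward property in functional form -/
def PF {X : Type} [MeasurableSpace X] (g μ : Measure X) (u : X → ℝ) (T : X → X) : Prop :=
  ∀ h : X → ℝ≥0∞, Measurable h → ∫⁻ z, h (T z) ∂g = ∫⁻ x, ENNReal.ofReal (u x) * h x ∂μ

lemma Tr.pf {R : ℝ} {u T : ℝ → ℝ} (hu : Measurable u) (hT : Tr R u T) : PF gm (lam R) u T := by
  intro h hh
  rw [← lintegral_map hh hT.meas, hT.map,
    lintegral_withDensity_eq_lintegral_mul _ hu.ennreal_ofReal hh]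
  rfl

section gen
variable {Θ X Y : Type} [MeasurableSpace Θ] [MeasurableSpace X] [MeasurableSpace Y]

/-- marginal density -/
def mg (ν : Measure Y) (w : Θ → X × Y → ℝ) (θ : Θ) (x : X) : ℝ := ∫ y, w θ (x, y) ∂ν

/-- conditional density -/
def cd (ν : Measure Y) (w : Θ → X × Y → ℝ) (p : Θ × X) (y : Y) : ℝ :=
  w p.1 (p.2, y) / mg ν w p.1 p.2

lemma measurable_mg (ν : Measure Y) [IsFiniteMeasure ν] {w : Θ → X × Y → ℝ}
    (hw : Measurable (Function.uncurry w)) : Measurable (Function.uncurry (mg ν w)) := by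
  have : Measurable (fun q : (Θ × X) × Y => w q.1.1 (q.1.2, q.2)) :=
    hw.comp (f := fun q : (Θ × X) × Y => (q.1.1, (q.1.2, q.2))) (by fun_prop)
  exact (this.stronglyMeasurable.integral_prod_right' (ν := ν)).measurable

lemma measurable_cd (ν : Measure Y) [IsFiniteMeasure ν] {w : Θ → X × Y → ℝ}
    (hw : Measurable (Function.uncurry w)) : Measurable (Function.uncurry (cd ν w)) := by
  have h1 : Measurable (fun q : (Θ × X) × Y => w q.1.1 (q.1.2, q.2)) :=
    hw.comp (f := fun q : (Θ × X) × Y => (q.1.1, (q.1.2, q.2))) (by fun_prop)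
  exact h1.div ((measurable_mg ν hw).comp measurable_fst)

lemma slice_integrable (ν : Measure Y) [IsFiniteMeasure ν] {μ : Measure X} {m M : ℝ} (hm : 0 < m)
    {w : X × Y → ℝ} (hw : Dens (μ.prod ν) m M w) (x : X) : Integrable (fun y => w (x, y)) ν := by
  refine Integrable.of_bound (hw.meas.comp (by fun_prop)).aestronglyMeasurable M
    (ae_of_all _ fun y => ?_)
  rw [Real.norm_eq_abs, abs_of_nonneg (hm.le.trans (hw.lo _))]
  exact hw.hi _

lemma mg_bounds (ν : Measure Y) [IsFiniteMeasure ν] {μ : Measure X} {m M : ℝ} (hm : 0 < m)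
    {w : Θ → X × Y → ℝ} {θ : Θ} (hw : Dens (μ.prod ν) m M (w θ)) (x : X) :
    m * ν.real Set.univ ≤ mg ν w θ x ∧ mg ν w θ x ≤ M * ν.real Set.univ := by
  have hi := slice_integrable ν hm hw x
  constructor
  · have := integral_mono (integrable_const m) hi (fun y => hw.lo (x, y))
    simpa [mg, mul_comm] using this
  · have := integral_mono hi (integrable_const M) (fun y => hw.hi (x, y))
    simpa [mg, mul_comm] using this

lemma mg_dens {μ : Measure X} {ν : Measure Y} [IsFiniteMeasure μ] [IsFiniteMeasure ν] {m M : ℝ}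
    (hm : 0 < m) {w : Θ → X × Y → ℝ} (hwm : Measurable (Function.uncurry w)) {θ : Θ}
    (hw : Dens (μ.prod ν) m M (w θ)) :
    Dens μ (m * ν.real Set.univ) (M * ν.real Set.univ) (mg ν w θ) := by
  refine ⟨(measurable_mg ν hwm).comp (by fun_prop : Measurable fun x => (θ, x)),
    fun x => (mg_bounds ν hm hw x).1, fun x => (mg_bounds ν hm hw x).2, ?_⟩
  rw [← hw.int, integral_prod _ hw.integrable]
  rfl

lemma cd_dens {μ : Measure X} {ν : Measure Y} [IsFiniteMeasure μ] [IsFiniteMeasure ν] {m M : ℝ}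
    (hm : 0 < m) (hν : 0 < ν.real Set.univ) {w : Θ → X × Y → ℝ}
    (hwm : Measurable (Function.uncurry w)) {p : Θ × X} (hw : Dens (μ.prod ν) m M (w p.1)) :
    Dens ν (m / (M * ν.real Set.univ)) (M / (m * ν.real Set.univ)) (cd ν w p) := by
  obtain ⟨h1, h2⟩ := mg_bounds ν hm hw p.2
  have h0 : 0 < mg ν w p.1 p.2 := lt_of_lt_of_le (by positivity) h1
  refine ⟨(measurable_cd ν hwm).comp (by fun_prop : Measurable fun x => (p, x)),
    fun y => ?_, fun y => ?_, ?_⟩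
  · have := hw.lo (p.2, y)
    have : 0 < w p.1 (p.2, y) := hm.trans_le this
    unfold cd; gcongr
  · have := hw.hi (p.2, y)
    have h3 := hw.lo (p.2, y)
    have : 0 < w p.1 (p.2, y) := hm.trans_le h3
    have : 0 ≤ M := this.le.trans (hw.hi _)
    unfold cd; gcongr
  · unfold cd
    rw [integral_div]
    exact div_self h0.ne'

lemma mg_mul_cd {μ : Measure X} {ν : Measure Y} [IsFiniteMeasure ν] {m M : ℝ}
    (hm : 0 < m) (hν : 0 < ν.real Set.univ) {w : Θ → X × Y → ℝ}
    {p : Θ × X} (hw : Dens (μ.prod ν) m M (w p.1)) (y : Y) :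
    0 < mg ν w p.1 p.2 ∧ 0 < cd ν w p y ∧ mg ν w p.1 p.2 * cd ν w p y = w p.1 (p.2, y) := by
  obtain ⟨h1, h2⟩ := mg_bounds ν hm hw p.2
  have h0 : 0 < mg ν w p.1 p.2 := lt_of_lt_of_le (by positivity) h1
  have : 0 < w p.1 (p.2, y) := hm.trans_le (hw.lo _)
  refine ⟨h0, div_pos this h0, ?_⟩
  unfold cd; field_simp

lemma pf_glue {gX μ : Measure X} {gY ν : Measure Y} [SFinite gX] [SFinite gY] [IsFiniteMeasure μ]
    [IsFiniteMeasure ν] {m M : ℝ}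
    (hm : 0 < m) (hν : 0 < ν.real Set.univ) {w : Θ → X × Y → ℝ}
    (hwm : Measurable (Function.uncurry w)) {θ : Θ} (hw : Dens (μ.prod ν) m M (w θ))
    {T1 : X → X} {T2 : Θ × X → Y → Y} (hT1m : Measurable T1)
    (hT2m : Measurable (Function.uncurry T2))
    (hT1 : PF gX μ (mg ν w θ) T1) (hT2 : ∀ x, PF gY ν (cd ν w (θ, x)) (T2 (θ, x))) :
    ∀ h : X × Y → ℝ≥0∞, Measurable h →
    ∫⁻ z : X × Y, h (T1 z.1, T2 (θ, T1 z.1) z.2) ∂(gX.prod gY) =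
      ∫⁻ x, ENNReal.ofReal (w θ x) * h x ∂(μ.prod ν) := by
  intro h hh
  have hm1 : Measurable (fun z : X × Y => T2 (θ, T1 z.1) z.2) :=
    hT2m.comp (f := fun z : X × Y => ((θ, T1 z.1), z.2)) (by fun_prop)
  have hwθ := hw.meas
  have hc : Measurable (fun z : X × Y => cd ν w (θ, z.1) z.2) :=
    (measurable_cd ν hwm).comp (f := fun z : X × Y => ((θ, z.1), z.2)) (by fun_prop)
  rw [lintegral_prod _ (by fun_prop), lintegral_prod _ (by fun_prop)]
  have e1 : ∀ x, ∫⁻ y, h (T1 x, T2 (θ, T1 x) y) ∂gY =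
      ∫⁻ y, ENNReal.ofReal (cd ν w (θ, T1 x) y) * h (T1 x, y) ∂ν := fun x =>
    hT2 (T1 x) (fun y => h (T1 x, y)) (by fun_prop)
  simp only [e1]
  have hinner : Measurable (fun x => ∫⁻ y, ENNReal.ofReal (cd ν w (θ, x) y) * h (x, y) ∂ν) :=
    Measurable.lintegral_prod_right' (f := fun z : X × Y =>
      ENNReal.ofReal (cd ν w (θ, z.1) z.2) * h (z.1, z.2)) (by fun_prop)
  rw [hT1 _ hinner]
  congr 1; ext x
  rw [← lintegral_const_mul' _ _ (by simp)]
  congr 1; ext y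
  obtain ⟨h1, h2, h3⟩ := mg_mul_cd (p := (θ, x)) hm hν hw y
  rw [← mul_assoc, ← ENNReal.ofReal_mul h1.le, h3]

end gen

/-- transport map for a density on the cube -/
structure KT (R : ℝ) (n : ℕ) (u : (Fin n → ℝ) → ℝ) (T : (Fin n → ℝ) → (Fin n → ℝ)) : Prop where
  meas : Measurable T
  mem : ∀ z i, T z i ∈ Set.Ioo (-R) R
  pf : PF (gmn n) (lamn R n) u T

/-- the covariance inequality -/
def KIneq (r : ℝ) (n : ℕ) (u v : (Fin n → ℝ) → ℝ) (T S : (Fin n → ℝ) → (Fin n → ℝ)) : Prop :=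
  ∑ i, (∫ z, T z i ∂(gmn n)) * (∫ z, S z i ∂(gmn n)) + n * (Real.log r - Real.log (2 * π))
    - ∫ z, Real.log (u (T z)) ∂(gmn n) - ∫ z, Real.log (v (S z)) ∂(gmn n) ≤
  ∫ q, ∑ i, T (fun j => (q j).1) i * S (fun j => (q j).2) i ∂(grn r n)

/-- the induction claim -/
def Claim (r R : ℝ) (n : ℕ) : Prop :=
  ∀ (Θ Ω : Type) [MeasurableSpace Θ] [MeasurableSpace Ω] [Nonempty Θ] [Nonempty Ω]
    (m M m' M' : ℝ)
    (u : Θ → (Fin n → ℝ) → ℝ) (v : Ω → (Fin n → ℝ) → ℝ), 0 < m → 0 < m' →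
    Measurable (Function.uncurry u) → Measurable (Function.uncurry v) →
    (∀ θ, Dens (lamn R n) m M (u θ)) → (∀ ω, Dens (lamn R n) m' M' (v ω)) →
    ∃ (T : Θ → (Fin n → ℝ) → (Fin n → ℝ)) (S : Ω → (Fin n → ℝ) → (Fin n → ℝ)),
      Measurable (Function.uncurry T) ∧ Measurable (Function.uncurry S) ∧
      (∀ θ, KT R n (u θ) (T θ)) ∧ (∀ ω, KT R n (v ω) (S ω)) ∧
      ∀ θ ω, KIneq r n (u θ) (v ω) (T θ) (S ω)

lemma dens_zero {R m M : ℝ} {u : (Fin 0 → ℝ) → ℝ} (hu : Dens (lamn R 0) m M u) :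
    ∀ x, u x = 1 := by
  have := hu.int
  rw [lamn, Measure.pi_of_empty _ (0 : Fin 0 → ℝ), integral_dirac] at this
  intro x
  rw [← this]; congr 1; exact Subsingleton.elim _ _

lemma claim_zero (r R : ℝ) : Claim r R 0 := by
  intro Θ Ω _ _ _ _ m M m' M' u v hm hm' hum hvm hu hv
  have aux : ∀ (u : (Fin 0 → ℝ) → ℝ), (∀ x, u x = 1) → KT R 0 u (fun z => z) := by
    intro u h
    refine ⟨measurable_id, fun z i => i.elim0, ?_⟩
    intro h' _
    rw [gmn, lamn, Measure.pi_of_empty _ (0 : Fin 0 → ℝ), Measure.pi_of_empty _ (0 : Fin 0 → ℝ)]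
    simp [h]
  refine ⟨fun _ z => z, fun _ z => z, measurable_snd, measurable_snd,
    fun θ => aux _ (dens_zero (hu θ)), fun ω => aux _ (dens_zero (hv ω)), fun θ ω => ?_⟩
  unfold KIneq
  simp [dens_zero (hu θ), dens_zero (hv ω)]

end LpS

namespace LpS

open ProbabilityTheory

lemma bint {X : Type} [MeasurableSpace X] {μ : Measure X} [IsFiniteMeasure μ] {f : X → ℝ}
    (hf : Measurable f) {K : ℝ} (h : ∀ x, |f x| ≤ K) : Integrable f μ :=
  Integrable.of_bound hf.aestronglyMeasurable K (ae_of_all _ h)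

lemma mp_fstn {r : ℝ} (hr : r ^ 2 < 1) (n : ℕ) :
    MeasurePreserving (fun (q : Fin n → ℝ × ℝ) j => (q j).1) (grn r n) (gmn n) := by
  have := gr_prob hr
  exact measurePreserving_pi (fun _ : Fin n => gr r) (fun _ => gm) (fun _ => mp_fst hr)

lemma mp_sndn {r : ℝ} (hr : r ^ 2 < 1) (n : ℕ) :
    MeasurePreserving (fun (q : Fin n → ℝ × ℝ) j => (q j).2) (grn r n) (gmn n) := by
  have := gr_prob hr
  exact measurePreserving_pi (fun _ : Fin n => gr r) (fun _ => gm) (fun _ => mp_snd hr)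

lemma mul_bdd {x y K : ℝ} (hx : |x| ≤ K) (hy : |y| ≤ K) : |x * y| ≤ K * K := by
  rw [abs_mul]
  exact mul_le_mul hx hy (abs_nonneg _) ((abs_nonneg _).trans hx)

lemma sum_bdd {n : ℕ} {x y : Fin n → ℝ} {K : ℝ} (hx : ∀ i, |x i| ≤ K) (hy : ∀ i, |y i| ≤ K) :
    |∑ i, x i * y i| ≤ n * (K * K) := by
  refine (Finset.abs_sum_le_sum_abs _ _).trans ?_
  refine (Finset.sum_le_sum (fun i _ => mul_bdd (hx i) (hy i))).trans ?_
  simp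

lemma kineq_succ {r : ℝ} (hr : r ^ 2 < 1) (n : ℕ)
    {u v : (Fin (n + 1) → ℝ) → ℝ} {T S : (Fin (n + 1) → ℝ) → (Fin (n + 1) → ℝ)}
    {A : ℝ → ℝ} {B : ℝ × (Fin n → ℝ) → ℝ} {C : ℝ × (Fin n → ℝ) → Fin n → ℝ}
    {D : (Fin n → ℝ) → Fin n → ℝ} {a : ℝ → ℝ} {a2 b1 : ℝ × (Fin n → ℝ) → ℝ}
    {b2 : (Fin n → ℝ) → ℝ} {K : ℝ}
    (mA : Measurable A) (mB : Measurable B) (mC : Measurable C) (mD : Measurable D)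
    (ma : Measurable a) (ma2 : Measurable a2) (mb1 : Measurable b1) (mb2 : Measurable b2)
    (kA : ∀ x, |A x| ≤ K) (kB : ∀ x, |B x| ≤ K) (kC : ∀ x i, |C x i| ≤ K) (kD : ∀ x i, |D x i| ≤ K)
    (ka : ∀ x, |a x| ≤ K) (ka2 : ∀ x, |a2 x| ≤ K) (kb1 : ∀ x, |b1 x| ≤ K) (kb2 : ∀ x, |b2 x| ≤ K)
    (mT : Measurable T) (mS : Measurable S)
    (eT : ∀ q, T (cns q) = cns (A q.1, C q)) (eS : ∀ q, S (cns q) = cns (B q, D q.2))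
    (eu : ∀ q, Real.log (u (T (cns q))) = a q.1 + a2 q)
    (ev : ∀ q, Real.log (v (S (cns q))) = b1 q + b2 q.2)
    (mu : Measurable u) (mv : Measurable v)
    (h1 : ∀ y, (∫ x, A x ∂gm) * (∫ x, B (x, y) ∂gm) + (Real.log r - Real.log (2 * π))
      - ∫ x, a x ∂gm - ∫ x, b1 (x, y) ∂gm ≤ ∫ p : ℝ × ℝ, A p.1 * B (p.2, y) ∂(gr r))
    (h2 : ∀ x, ∑ i, (∫ y, C (x, y) i ∂(gmn n)) * (∫ y, D y i ∂(gmn n))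
        + n * (Real.log r - Real.log (2 * π)) - ∫ y, a2 (x, y) ∂(gmn n) - ∫ y, b2 y ∂(gmn n) ≤
      ∫ q, ∑ i, C (x, fun j => (q j).1) i * D (fun j => (q j).2) i ∂(grn r n)) :
    KIneq r (n + 1) u v T S := by
  have := gr_prob hr
  have hmul := fun x y : ℝ => mul_bdd (x := x) (y := y) (K := K)
  have g1i : Integrable (fun p : (ℝ × ℝ) × (Fin n → ℝ × ℝ) => A p.1.1 * B (p.1.2, fun j => (p.2 j).2))
      ((gr r).prod (grn r n)) :=
    bint (K := K * K) (by fun_prop) (fun p => hmul _ _ (kA _) (kB _))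
  have g2i : Integrable (fun p : (ℝ × ℝ) × (Fin n → ℝ × ℝ) =>
      ∑ i, C (p.1.1, fun j => (p.2 j).1) i * D (fun j => (p.2 j).2) i)
      ((gr r).prod (grn r n)) :=
    bint (K := n * (K * K)) (by fun_prop) (fun p => sum_bdd (kC _) (kD _))
  have iA : Integrable A gm := bint mA kA
  have ia : Integrable a gm := bint ma ka
  have ib2 : Integrable b2 (gmn n) := bint mb2 kb2
  have iB : Integrable B (gm.prod (gmn n)) := bint mB kB
  have iC : ∀ i, Integrable (fun p => C p i) (gm.prod (gmn n)) := fun i =>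
    bint (by fun_prop) (fun p => kC p i)
  have iD : ∀ i, Integrable (fun p => D p i) (gmn n) := fun i =>
    bint (by fun_prop) (fun p => kD p i)
  have ia2 : Integrable a2 (gm.prod (gmn n)) := bint ma2 ka2
  have ib1 : Integrable b1 (gm.prod (gmn n)) := bint mb1 kb1
  have k1 := glue1 gm (gr r) (gmn n) (grn r n) (e1 := Prod.fst) (e2 := Prod.snd) (mp_sndn hr n)
    A B a b1 (Real.log r - Real.log (2 * π)) iB ib1 g1i h1
  have k2 := glue2 gm (gr r) (gmn n) (grn r n) (f1 := fun q j => (q j).1) (f2 := fun q j => (q j).2)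
    (mp_fst hr) C D a2 b2 (n * (Real.log r - Real.log (2 * π))) iC ia2 g2i h2
  have hKT : ∀ z i, |T z i| ≤ K := by
    intro z i
    have : z = cns (z 0, fun j => z j.succ) := by
      ext j; refine Fin.cases rfl (fun k => rfl) j
    rw [this, eT]
    exact Fin.cases (by simpa [cns] using kA _) (fun j => by simpa [cns] using kC _ j) i
  have hKS : ∀ z i, |S z i| ≤ K := by
    intro z i
    have : z = cns (z 0, fun j => z j.succ) := by
      ext j; refine Fin.cases rfl (fun k => rfl) j
    rw [this, eS]
    exact Fin.cases (by simpa [cns] using kB _) (fun j => by simpa [cns] using kD _ j) i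
  unfold KIneq
  have iT : ∀ i, Integrable (fun z => T z i) (gmn (n + 1)) := fun i =>
    bint (by fun_prop) (fun z => hKT z i)
  have iS : ∀ i, Integrable (fun z => S z i) (gmn (n + 1)) := fun i =>
    bint (by fun_prop) (fun z => hKS z i)
  have eTi : ∀ i, ∫ z, T z i ∂(gmn (n + 1)) = ∫ q, T (cns q) i ∂(gm.prod (gmn n)) := fun i =>
    (mp_integral (mp_cns gm) (iT i)).2.symm
  have eSi : ∀ i, ∫ z, S z i ∂(gmn (n + 1)) = ∫ q, S (cns q) i ∂(gm.prod (gmn n)) := fun i =>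
    (mp_integral (mp_cns gm) (iS i)).2.symm
  have iBig : Integrable (fun q : Fin (n + 1) → ℝ × ℝ =>
      ∑ i, T (fun j => (q j).1) i * S (fun j => (q j).2) i) (grn r (n + 1)) :=
    bint (K := (n + 1 : ℕ) * (K * K)) (by fun_prop) (fun p => sum_bdd (hKT _) (hKS _))
  have hz : ∀ z : Fin (n + 1) → ℝ, z = cns (z 0, fun j => z j.succ) := by
    intro z; ext j; refine Fin.cases rfl (fun k => rfl) j
  have iu : Integrable (fun z => Real.log (u (T z))) (gmn (n + 1)) := by
    refine bint (K := K + K) (by fun_prop) (fun z => ?_)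
    rw [hz z, eu]
    exact (abs_add_le _ _).trans (add_le_add (ka _) (ka2 _))
  have iv : Integrable (fun z => Real.log (v (S z))) (gmn (n + 1)) := by
    refine bint (K := K + K) (by fun_prop) (fun z => ?_)
    rw [hz z, ev]
    exact (abs_add_le _ _).trans (add_le_add (kb1 _) (kb2 _))
  rw [← (mp_integral (mp_cns gm) iu).2, ← (mp_integral (mp_cns gm) iv).2,
    ← (mp_integral (mp_cns (gr r)) iBig).2]
  simp only [eTi, eSi, eu, ev]
  have m1 : MeasurePreserving (Prod.fst : ℝ × (Fin n → ℝ) → ℝ) (gm.prod (gmn n)) gm :=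
    measurePreserving_fst
  have m2 : MeasurePreserving (Prod.snd : ℝ × (Fin n → ℝ) → _) (gm.prod (gmn n)) (gmn n) :=
    measurePreserving_snd
  obtain ⟨ja, ja'⟩ := mp_integral m1 ia
  obtain ⟨jb, jb'⟩ := mp_integral m2 ib2
  rw [integral_add ja ia2, integral_add ib1 jb, ja', jb', Fin.sum_univ_succ]
  simp only [eT, eS, cns_zero, cns_succ]
  have e0 : ∫ q : ℝ × (Fin n → ℝ), A q.1 ∂(gm.prod (gmn n)) = ∫ x, A x ∂gm :=
    (mp_integral m1 iA).2
  have eD : ∀ i, ∫ q : ℝ × (Fin n → ℝ), D q.2 i ∂(gm.prod (gmn n)) = ∫ x, D x i ∂(gmn n) := fun i =>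
    (mp_integral m2 (iD i)).2
  simp only [e0, eD]
  have eR : ∀ p : (ℝ × ℝ) × (Fin n → ℝ × ℝ),
      ∑ i, T (fun j => (cns p j).1) i * S (fun j => (cns p j).2) i =
      A p.1.1 * B (p.1.2, fun j => (p.2 j).2) +
        ∑ i, C (p.1.1, fun j => (p.2 j).1) i * D (fun j => (p.2 j).2) i := by
    intro p
    have c1 : (fun j => (cns p j).1) = cns (p.1.1, fun j => (p.2 j).1) := by
      ext j; refine Fin.cases rfl (fun k => rfl) j
    have c2 : (fun j => (cns p j).2) = cns (p.1.2, fun j => (p.2 j).2) := by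
      ext j; refine Fin.cases rfl (fun k => rfl) j
    rw [c1, c2, eT, eS, Fin.sum_univ_succ]
    simp only [cns_zero, cns_succ]
  simp only [eR]
  rw [integral_add g1i g2i]
  push_cast
  linarith

end LpS

namespace LpS

open ProbabilityTheory

lemma lam_real {R : ℝ} (hR : 0 < R) : (lam R).real Set.univ = 2 * R := by
  rw [lam, measureReal_restrict_apply MeasurableSet.univ, Set.univ_inter, Real.volume_real_Ioo_of_le (by linarith)]
  ring

instance lam_fin (R : ℝ) : IsFiniteMeasure (lam R) := by
  unfold lam; infer_instance

lemma lamn_real {R : ℝ} (hR : 0 < R) (n : ℕ) : (lamn R n).real Set.univ = (2 * R) ^ n := by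
  rw [Measure.real, lamn, Measure.pi_univ, ENNReal.toReal_prod]
  have : (lam R Set.univ).toReal = 2 * R := lam_real hR
  simp only [this, Finset.prod_const, Finset.card_univ, Fintype.card_fin]

lemma claim_succ {r : ℝ} (hr0 : 0 < r) (hr : r ^ 2 < 1) {R : ℝ} (hR : 0 < R) {n : ℕ}
    (IH : Claim r R n) : Claim r R (n + 1) := by
  intro Θ Ω _ _ hΘ hΩ m M m' M' u v hm hm' hum hvm hu hv
  have hL : 0 < (lam R).real Set.univ := by rw [lam_real hR]; positivity
  have hLn : 0 < (lamn R n).real Set.univ := by rw [lamn_real hR]; positivity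
  set ℓ := (lam R).real Set.univ with hℓ
  set ℓn := (lamn R n).real Set.univ with hℓn
  set w : Θ → ℝ × (Fin n → ℝ) → ℝ := fun θ x => u θ (cns x) with hw
  set wv : Ω → (Fin n → ℝ) × ℝ → ℝ := fun ω x => v ω (cns (x.2, x.1)) with hwv
  have mcns : Measurable (cns : ℝ × (Fin n → ℝ) → (Fin (n + 1) → ℝ)) := measurable_cns
  have hwm : Measurable (Function.uncurry w) :=
    hum.comp (f := fun q : Θ × (ℝ × (Fin n → ℝ)) => (q.1, cns q.2)) (by fun_prop)
  have hwvm : Measurable (Function.uncurry wv) :=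
    hvm.comp (f := fun q : Ω × ((Fin n → ℝ) × ℝ) => (q.1, cns (q.2.2, q.2.1))) (by fun_prop)
  have hwd : ∀ θ, Dens ((lam R).prod (lamn R n)) m M (w θ) := fun θ =>
    ⟨(hu θ).meas.comp mcns, fun x => (hu θ).lo _, fun x => (hu θ).hi _, by
      rw [← (hu θ).int, ← (mp_integral (mp_cns (lam R)) (hu θ).integrable).2]⟩
  have hwvd : ∀ ω, Dens ((lamn R n).prod (lam R)) m' M' (wv ω) := fun ω =>
    ⟨(hv ω).meas.comp (mcns.comp (by fun_prop)), fun x => (hv ω).lo _, fun x => (hv ω).hi _, by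
      rw [← (hv ω).int, ← (mp_integral (mp_cns (lam R)) (hv ω).integrable).2,
        ← integral_prod_swap]
      rfl⟩
  have hMpos : ∀ θ : Θ, 0 < M := fun θ =>
    hm.trans_le (((hu θ).lo 0).trans ((hu θ).hi 0))
  have hMpos' : ∀ ω : Ω, 0 < M' := fun ω =>
    hm'.trans_le (((hv ω).lo 0).trans ((hv ω).hi 0))
  set u1 := mg (lamn R n) w with hu1
  set u2 := cd (lamn R n) w with hu2
  set v2 := mg (lam R) wv with hv2
  set v1 := cd (lam R) wv with hv1
  have du1 : ∀ θ, Dens (lam R) (m * ℓn) (M * ℓn) (u1 θ) := fun θ => mg_dens hm hwm (hwd θ)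
  have du2 : ∀ p, Dens (lamn R n) (m / (M * ℓn)) (M / (m * ℓn)) (u2 p) := fun p =>
    cd_dens hm hLn hwm (hwd p.1)
  have dv2 : ∀ ω, Dens (lamn R n) (m' * ℓ) (M' * ℓ) (v2 ω) := fun θ => mg_dens hm' hwvm (hwvd θ)
  have dv1 : ∀ p, Dens (lam R) (m' / (M' * ℓ)) (M' / (m' * ℓ)) (v1 p) := fun p =>
    cd_dens hm' hL hwvm (hwvd p.1)
  have mu1 : Measurable (Function.uncurry u1) := measurable_mg _ hwm
  have mu2 : Measurable (Function.uncurry u2) := measurable_cd _ hwm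
  have mv2 : Measurable (Function.uncurry v2) := measurable_mg _ hwvm
  have mv1 : Measurable (Function.uncurry v1) := measurable_cd _ hwvm
  have M0 : 0 < M := hMpos hΘ.some
  have M0' : 0 < M' := hMpos' hΩ.some
  have p1 : 0 < m * ℓn := by positivity
  have p2 : 0 < m / (M * ℓn) := by positivity
  have p3 : 0 < m' * ℓ := by positivity
  have p4 : 0 < m' / (M' * ℓ) := by positivity
  obtain ⟨T1, mT1, hT1⟩ := exists_transport hR p1 u1 mu1 du1
  obtain ⟨S1, mS1, hS1⟩ := exists_transport hR p4 v1 mv1 dv1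
  obtain ⟨T2, S2, mT2, mS2, hT2, hS2, hTS⟩ := IH (Θ × ℝ) Ω _ _ _ _ u2 v2 p2 p3 mu2 mv2 du2 dv2
  have mtail : Measurable (fun (z : Fin (n + 1) → ℝ) (i : Fin n) => z i.succ) := by fun_prop
  set T : Θ → (Fin (n + 1) → ℝ) → (Fin (n + 1) → ℝ) := fun θ z =>
    cns (T1 θ (z 0), T2 (θ, T1 θ (z 0)) (fun i => z i.succ)) with hT
  set S : Ω → (Fin (n + 1) → ℝ) → (Fin (n + 1) → ℝ) := fun ω z =>
    cns (S1 (ω, S2 ω (fun i => z i.succ)) (z 0), S2 ω (fun i => z i.succ)) with hS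
  have mT1' : Measurable (fun q : Θ × (Fin (n + 1) → ℝ) => T1 q.1 (q.2 0)) :=
    mT1.comp (f := fun q : Θ × (Fin (n + 1) → ℝ) => (q.1, q.2 0)) (by fun_prop)
  have mS2' : Measurable (fun q : Ω × (Fin (n + 1) → ℝ) => S2 q.1 (fun i => q.2 i.succ)) :=
    mS2.comp (f := fun q : Ω × (Fin (n + 1) → ℝ) => (q.1, fun i : Fin n => q.2 i.succ)) (by fun_prop)
  have mT : Measurable (Function.uncurry T) := by
    refine mcns.comp (mT1'.prodMk (mT2.comp (f := fun q : Θ × (Fin (n + 1) → ℝ) =>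
      ((q.1, T1 q.1 (q.2 0)), fun i : Fin n => q.2 i.succ)) (by fun_prop)))
  have mS : Measurable (Function.uncurry S) := by
    refine mcns.comp ((mS1.comp (f := fun q : Ω × (Fin (n + 1) → ℝ) =>
      ((q.1, S2 q.1 (fun i => q.2 i.succ)), q.2 0)) (by fun_prop)).prodMk mS2')
  have mTθ : ∀ θ, Measurable (T θ) := fun θ => mT.comp (by fun_prop : Measurable fun z => (θ, z))
  have mSω : ∀ ω, Measurable (S ω) := fun θ => mS.comp (by fun_prop : Measurable fun z => (θ, z))
  refine ⟨T, S, mT, mS, fun θ => ⟨mTθ θ, ?_, ?_⟩, fun ω => ⟨mSω ω, ?_, ?_⟩, fun θ ω => ?_⟩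
  · intro z i
    refine Fin.cases ?_ (fun j => ?_) i
    · exact (hT1 θ).mem _
    · exact (hT2 _).mem _ j
  · intro h hh
    have := pf_glue hm hLn hwm (hwd θ) (hT1 θ).meas mT2 ((hT1 θ).pf (du1 θ).meas)
      (fun x => (hT2 (θ, x)).pf) (fun q => h (cns q)) (hh.comp mcns)
    have hum' := (hu θ).meas
    have mTh := mTθ θ
    rw [← mp_lintegral (mp_cns gm) (ψ := fun z => h (T θ z)) (by fun_prop),
      ← mp_lintegral (mp_cns (lam R)) (ψ := fun z => ENNReal.ofReal (u θ z) * h z) (by fun_prop)]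
    exact this
  · intro z i
    refine Fin.cases ?_ (fun j => ?_) i
    · exact (hS1 _).mem _
    · exact (hS2 ω).mem _ j
  · intro h hh
    have := pf_glue hm' hL hwvm (hwvd ω) (hS2 ω).meas mS1 (hS2 ω).pf
      (fun x => (hS1 (ω, x)).pf (dv1 (ω, x)).meas) (fun q => h (cns (q.2, q.1)))
      (hh.comp (mcns.comp (by fun_prop)))
    have hum' := (hv ω).meas
    have mTh := mSω ω
    rw [← mp_lintegral (mp_cns gm) (ψ := fun z => h (S ω z)) (by fun_prop),
      ← mp_lintegral (mp_cns (lam R)) (ψ := fun z => ENNReal.ofReal (v ω z) * h z) (by fun_prop),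
      ← lintegral_prod_swap,
      ← lintegral_prod_swap (f := fun q : ℝ × (Fin n → ℝ) => ENNReal.ofReal (v ω (cns q)) * h (cns q))]
    exact this
  · have hS2' : ∀ ω, Measurable (S2 ω) := fun ω => (hS2 ω).meas
    have mA : Measurable (T1 θ) := (hT1 θ).meas
    have mD : Measurable (S2 ω) := (hS2 ω).meas
    have mB : Measurable (fun q : ℝ × (Fin n → ℝ) => S1 (ω, S2 ω q.2) q.1) :=
      mS1.comp (f := fun q : ℝ × (Fin n → ℝ) => ((ω, S2 ω q.2), q.1)) (by fun_prop)
    have mC : Measurable (fun q : ℝ × (Fin n → ℝ) => T2 (θ, T1 θ q.1) q.2) :=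
      mT2.comp (f := fun q : ℝ × (Fin n → ℝ) => ((θ, T1 θ q.1), q.2)) (by fun_prop)
    have mu1' := (du1 θ).meas
    have mv2' := (dv2 ω).meas
    have ma2 : Measurable (fun q : ℝ × (Fin n → ℝ) =>
        Real.log (u2 (θ, T1 θ q.1) (T2 (θ, T1 θ q.1) q.2))) :=
      (mu2.comp (f := fun q : ℝ × (Fin n → ℝ) => ((θ, T1 θ q.1), T2 (θ, T1 θ q.1) q.2))
        (by fun_prop)).log
    have mb1 : Measurable (fun q : ℝ × (Fin n → ℝ) =>
        Real.log (v1 (ω, S2 ω q.2) (S1 (ω, S2 ω q.2) q.1))) :=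
      (mv1.comp (f := fun q : ℝ × (Fin n → ℝ) => ((ω, S2 ω q.2), S1 (ω, S2 ω q.2) q.1))
        (by fun_prop)).log
    obtain ⟨K, k0, k1, k2, k3, k4⟩ : ∃ K, R ≤ K ∧ |Real.log (m * ℓn)| + |Real.log (M * ℓn)| ≤ K ∧
        |Real.log (m / (M * ℓn))| + |Real.log (M / (m * ℓn))| ≤ K ∧
        |Real.log (m' * ℓ)| + |Real.log (M' * ℓ)| ≤ K ∧
        |Real.log (m' / (M' * ℓ))| + |Real.log (M' / (m' * ℓ))| ≤ K := by
      refine ⟨R + (|Real.log (m * ℓn)| + |Real.log (M * ℓn)|) +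
        (|Real.log (m / (M * ℓn))| + |Real.log (M / (m * ℓn))|) +
        (|Real.log (m' * ℓ)| + |Real.log (M' * ℓ)|) +
        (|Real.log (m' / (M' * ℓ))| + |Real.log (M' / (m' * ℓ))|), ?_, ?_, ?_, ?_, ?_⟩ <;>
      linarith [abs_nonneg (Real.log (m * ℓn)), abs_nonneg (Real.log (M * ℓn)),
        abs_nonneg (Real.log (m / (M * ℓn))), abs_nonneg (Real.log (M / (m * ℓn))),
        abs_nonneg (Real.log (m' * ℓ)), abs_nonneg (Real.log (M' * ℓ)),
        abs_nonneg (Real.log (m' / (M' * ℓ))), abs_nonneg (Real.log (M' / (m' * ℓ)))]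
    have kR : ∀ x : ℝ, x ∈ Set.Ioo (-R) R → |x| ≤ K := fun x hx =>
      (abs_le.2 ⟨hx.1.le, hx.2.le⟩).trans k0
    refine kineq_succ hr n (A := T1 θ) (B := fun q => S1 (ω, S2 ω q.2) q.1)
      (C := fun q => T2 (θ, T1 θ q.1) q.2) (D := S2 ω)
      (a := fun z => Real.log (u1 θ (T1 θ z)))
      (a2 := fun q => Real.log (u2 (θ, T1 θ q.1) (T2 (θ, T1 θ q.1) q.2)))
      (b1 := fun q => Real.log (v1 (ω, S2 ω q.2) (S1 (ω, S2 ω q.2) q.1)))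
      (b2 := fun z => Real.log (v2 ω (S2 ω z))) (K := K)
      mA mB mC mD (by fun_prop) ma2 mb1 (by fun_prop)
      (fun x => kR _ ((hT1 θ).mem _)) (fun x => kR _ ((hS1 _).mem _))
      (fun x i => kR _ ((hT2 _).mem _ i)) (fun x i => kR _ ((hS2 ω).mem _ i))
      (fun x => (log_bdd p1 ((du1 θ).lo _) ((du1 θ).hi _)).trans k1)
      (fun x => (log_bdd p2 ((du2 _).lo _) ((du2 _).hi _)).trans k2)
      (fun x => (log_bdd p4 ((dv1 _).lo _) ((dv1 _).hi _)).trans k4)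
      (fun x => (log_bdd p3 ((dv2 ω).lo _) ((dv2 ω).hi _)).trans k3)
      (mTθ θ) (mSω ω) (fun q => rfl) (fun q => rfl) ?_ ?_ (hu θ).meas (hv ω).meas ?_ ?_
    · intro q
      obtain ⟨h1, h2, h3⟩ := mg_mul_cd (p := (θ, T1 θ q.1)) hm hLn (hwd θ) (T2 (θ, T1 θ q.1) q.2)
      rw [← Real.log_mul h1.ne' h2.ne', h3]
      rfl
    · intro q
      obtain ⟨h1, h2, h3⟩ := mg_mul_cd (p := (ω, S2 ω q.2)) hm' hL (hwvd ω) (S1 (ω, S2 ω q.2) q.1)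
      rw [← Real.log_mul h2.ne' h1.ne', mul_comm, h3]
      rfl
    · intro y
      have := one_dim hr0 hr p1 (du1 θ) (hT1 θ) p4 (dv1 (ω, S2 ω y)) (hS1 (ω, S2 ω y))
      rw [← add_sub_assoc]
      exact this
    · intro x
      exact hTS (θ, T1 θ x) ω

lemma claim_all {r : ℝ} (hr0 : 0 < r) (hr : r ^ 2 < 1) {R : ℝ} (hR : 0 < R) (n : ℕ) :
    Claim r R n := by
  induction n with
  | zero => exact claim_zero r R
  | succ n ih => exact claim_succ hr0 hr hR ih

end LpS

namespace LpS

open ProbabilityTheory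

lemma jensen_exp {X : Type} [MeasurableSpace X] {μ : Measure X} [IsProbabilityMeasure μ]
    {G : X → ℝ} (hG : Integrable G μ) :
    ENNReal.ofReal (rexp (∫ x, G x ∂μ)) ≤ ∫⁻ x, ENNReal.ofReal (rexp (G x)) ∂μ := by
  by_cases hfin : ∫⁻ x, ENNReal.ofReal (rexp (G x)) ∂μ = ⊤
  · rw [hfin]; exact le_top
  set c := ∫ x, G x ∂μ with hc
  have hi : Integrable (fun x => rexp (G x)) μ := by
    refine ⟨Real.continuous_exp.comp_aestronglyMeasurable hG.1, ?_⟩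
    rw [hasFiniteIntegral_iff_ofReal (ae_of_all _ fun x => (Real.exp_pos _).le)]
    exact lt_top_iff_ne_top.2 hfin
  rw [← ofReal_integral_eq_lintegral_ofReal hi (ae_of_all _ fun x => (Real.exp_pos _).le)]
  apply ENNReal.ofReal_le_ofReal
  have h1 : Integrable (fun x => rexp c * (1 + (G x - c))) μ :=
    ((integrable_const _).add (hG.sub (integrable_const _))).const_mul _
  have := integral_mono h1 hi (fun x => by
    have h2 := Real.add_one_le_exp (G x - c)
    have h3 : rexp (G x) = rexp c * rexp (G x - c) := by rw [← Real.exp_add]; ring_nf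
    simp only [h3]
    have := Real.exp_pos c
    nlinarith)
  rw [integral_const_mul, integral_add (integrable_const _) (hG.sub' (integrable_const _)),
    integral_sub hG (integrable_const _)] at this
  simpa [← hc] using this

lemma lintegral_grn_inv {r : ℝ} (hr : r ^ 2 < 1) (n : ℕ) :
    ∀ {φ : (Fin n → ℝ × ℝ) → ℝ≥0∞}, Measurable φ →
    ∫⁻ q, φ q * ∏ i, ENNReal.ofReal ((mk r (q i).1 (q i).2)⁻¹) ∂(grn r n) =
      ∫⁻ q, φ q ∂(Measure.pi fun _ => gm.prod gm) := by
  have := gr_prob hr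
  have hm := measurable_mk r
  induction n with
  | zero =>
    intro φ hφ
    rw [grn, Measure.pi_of_empty _ (0 : Fin 0 → ℝ × ℝ), Measure.pi_of_empty _ (0 : Fin 0 → ℝ × ℝ)]
    simp
  | succ n ih =>
    intro φ hφ
    have mcns : Measurable (cns : (ℝ × ℝ) × (Fin n → ℝ × ℝ) → (Fin (n + 1) → ℝ × ℝ)) := measurable_cns
    have hmi : ∀ i : Fin (n + 1), Measurable (fun q : Fin (n + 1) → ℝ × ℝ =>
        ENNReal.ofReal ((mk r (q i).1 (q i).2)⁻¹)) := fun i =>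
      ((hm.comp (measurable_pi_apply i)).inv).ennreal_ofReal
    have hmj : ∀ i : Fin n, Measurable (fun q : (ℝ × ℝ) × (Fin n → ℝ × ℝ) =>
        ENNReal.ofReal ((mk r (q.2 i).1 (q.2 i).2)⁻¹)) := fun i =>
      ((hm.comp (f := fun q : (ℝ × ℝ) × (Fin n → ℝ × ℝ) => q.2 i) (by fun_prop)).inv).ennreal_ofReal
    have hm0 : Measurable (fun q : (ℝ × ℝ) => ENNReal.ofReal ((mk r q.1 q.2)⁻¹)) :=
      hm.inv.ennreal_ofReal
    have hmj' : Measurable (fun q : (ℝ × ℝ) × (Fin n → ℝ × ℝ) =>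
        ∏ i, ENNReal.ofReal ((mk r (q.2 i).1 (q.2 i).2)⁻¹)) :=
      Finset.measurable_prod _ (fun i _ => hmj i)
    have hmi' : Measurable (fun q : Fin (n + 1) → ℝ × ℝ =>
        φ q * ∏ i, ENNReal.ofReal ((mk r (q i).1 (q i).2)⁻¹)) :=
      hφ.mul (Finset.measurable_prod _ (fun i _ => hmi i))
    rw [← mp_lintegral (mp_cns (gr r)) hmi',
      ← mp_lintegral (mp_cns (gm.prod gm)) hφ]
    simp only [Fin.prod_univ_succ, cns_zero, cns_succ]
    have hF : Measurable (fun q : (ℝ × ℝ) × (Fin n → ℝ × ℝ) => φ (cns q)) := hφ.comp mcns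
    rw [lintegral_prod _ (by fun_prop), lintegral_prod _ (by fun_prop)]
    have e1 : ∀ x : ℝ × ℝ, ∫⁻ y, φ (cns (x, y)) * (ENNReal.ofReal ((mk r x.1 x.2)⁻¹) *
        ∏ i, ENNReal.ofReal ((mk r (y i).1 (y i).2)⁻¹)) ∂(grn r n) =
        (∫⁻ y, φ (cns (x, y)) ∂(Measure.pi fun _ => gm.prod gm)) *
          ENNReal.ofReal ((mk r x.1 x.2)⁻¹) := by
      intro x
      rw [← ih (φ := fun y => φ (cns (x, y))) (hF.comp (by fun_prop)),
        ← lintegral_mul_const' _ _ (by simp)]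
      congr 1; ext y; ring
    rw [lintegral_congr e1]
    exact lintegral_gr_inv hr hF.lintegral_prod_right'

lemma PF.map {X : Type} [MeasurableSpace X] {g μ : Measure X} {u : X → ℝ} {T : X → X}
    (hT : Measurable T) (h : PF g μ u T) :
    g.map T = μ.withDensity (fun x => ENNReal.ofReal (u x)) := by
  ext s hs
  have := h (s.indicator 1) (measurable_one.indicator hs)
  rw [Measure.map_apply hT hs, withDensity_apply _ hs, ← lintegral_indicator hs,
    ← lintegral_indicator_one (hT hs)]
  refine Eq.trans ?_ (this.trans ?_)
  · rfl
  · congr 1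
    funext x
    by_cases hx : x ∈ s
    · simp [hx]
    · simp [hx]

lemma PF.integral {X : Type} [MeasurableSpace X] {g μ : Measure X} {u : X → ℝ} {T : X → X}
    (hT : Measurable T) (h : PF g μ u T) (hu : Measurable u) (h0 : ∀ x, 0 ≤ u x) {φ : X → ℝ}
    (hφ : Measurable φ) : ∫ z, φ (T z) ∂g = ∫ x, φ x * u x ∂μ := by
  rw [← integral_map hT.aemeasurable hφ.aestronglyMeasurable, h.map hT,
    integral_withDensity_eq_integral_toReal_smul (by fun_prop) (by simp)]
  congr 1; ext x
  rw [ENNReal.toReal_ofReal (h0 x), smul_eq_mul, mul_comm]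

/-- the constant -/
def cst (p : ℝ) (n : ℕ) : ℝ :=
  rexp (n * (p * (Real.log (√(p / (1 + p))) - Real.log (2 * π)) - 1 / 2 * Real.log (1 + p)))

/-- the integrand -/
def Fk {n : ℕ} (p : ℝ) (u v : (Fin n → ℝ) → ℝ) (x y : Fin n → ℝ) : ℝ :=
  rexp (p * ∑ i, x i * y i) * (u x * v y) ^ p

lemma star0_change {p R : ℝ} {n : ℕ} {u v : (Fin n → ℝ) → ℝ} {T S : (Fin n → ℝ) → (Fin n → ℝ)}
    (u0 : ∀ x, 0 < u x) (v0 : ∀ x, 0 < v x) (hum : Measurable u) (hvm : Measurable v)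
    (hT : KT R n u T) (hS : KT R n v S) :
    ∫⁻ z : (Fin n → ℝ) × (Fin n → ℝ),
      ENNReal.ofReal (rexp (p * ∑ i, z.1 i * z.2 i) * (u z.1 * v z.2) ^ (1 + p))
        ∂((lamn R n).prod (lamn R n)) =
      ∫⁻ z : (Fin n → ℝ) × (Fin n → ℝ), ENNReal.ofReal (Fk p u v (T z.1) (S z.2))
        ∂((gmn n).prod (gmn n)) := by
  have mT := hT.meas
  have mS := hS.meas
  have mF : Measurable (fun z : (Fin n → ℝ) × (Fin n → ℝ) => ENNReal.ofReal (Fk p u v z.1 z.2)) := by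
    unfold Fk; fun_prop
  have mTS : Measurable (fun z : (Fin n → ℝ) × (Fin n → ℝ) =>
      ENNReal.ofReal (Fk p u v (T z.1) (S z.2))) :=
    mF.comp (f := fun z : (Fin n → ℝ) × (Fin n → ℝ) => (T z.1, S z.2)) (by fun_prop)
  have mS' : Measurable (fun z : (Fin n → ℝ) × (Fin n → ℝ) =>
      ENNReal.ofReal (Fk p u v z.1 (S z.2))) :=
    mF.comp (f := fun z : (Fin n → ℝ) × (Fin n → ℝ) => (z.1, S z.2)) (by fun_prop)
  rw [lintegral_prod _ (by fun_prop), lintegral_prod _ mTS.aemeasurable]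
  have a1 : ∀ x, ∫⁻ y, ENNReal.ofReal (Fk p u v x (S y)) ∂(gmn n) =
      ∫⁻ y, ENNReal.ofReal (v y) * ENNReal.ofReal (Fk p u v x y) ∂(lamn R n) := fun x =>
    hS.pf (fun y => ENNReal.ofReal (Fk p u v x y))
      (mF.comp (f := fun y => (x, y)) (by fun_prop))
  have a2 := hT.pf (fun x => ∫⁻ y, ENNReal.ofReal (Fk p u v x (S y)) ∂(gmn n))
    mS'.lintegral_prod_right'
  refine Eq.trans ?_ a2.symm
  congr 1; ext x
  rw [a1, ← lintegral_const_mul' _ _ (by simp)]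
  congr 1; ext y
  rw [← ENNReal.ofReal_mul (v0 y).le, ← ENNReal.ofReal_mul (u0 x).le]
  congr 1
  simp only [Fk]
  rw [Real.rpow_add (mul_pos (u0 x) (v0 y)), Real.rpow_one]
  ring

lemma star0 {p : ℝ} (hp : 0 < p) {R : ℝ} (hR : 0 < R) (n : ℕ) {m M m' M' : ℝ}
    {u v : (Fin n → ℝ) → ℝ} (hm : 0 < m) (hm' : 0 < m') (hu : Dens (lamn R n) m M u)
    (hv : Dens (lamn R n) m' M' v) (hc : ∀ i, ∫ y, y i * v y ∂(lamn R n) = 0) :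
    ENNReal.ofReal (cst p n) ≤ ∫⁻ z : (Fin n → ℝ) × (Fin n → ℝ),
      ENNReal.ofReal (rexp (p * ∑ i, z.1 i * z.2 i) * (u z.1 * v z.2) ^ (1 + p))
        ∂((lamn R n).prod (lamn R n)) := by
  set r := √(p / (1 + p)) with hrdef
  have hr0 : 0 < r := Real.sqrt_pos.2 (by positivity)
  have hr2 : r ^ 2 = p / (1 + p) := Real.sq_sqrt (by positivity)
  have hr : r ^ 2 < 1 := by rw [hr2, div_lt_one (by positivity)]; linarith
  have h1r : 1 - r ^ 2 = (1 + p)⁻¹ := by rw [hr2]; field_simp; ring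
  have := gr_prob hr
  have hum := hu.meas
  have hvm := hv.meas
  have u0 : ∀ x, 0 < u x := fun x => hm.trans_le (hu.lo x)
  have v0 : ∀ x, 0 < v x := fun x => hm'.trans_le (hv.lo x)
  obtain ⟨T', S', -, -, hT', hS', hTS⟩ := claim_all hr0 hr hR n Unit Unit m M m' M' (fun _ => u)
    (fun _ => v) hm hm' (by exact hum.comp measurable_snd) (by exact hvm.comp measurable_snd)
    (fun _ => hu) (fun _ => hv)
  set T := T' () with hTdef
  set S := S' () with hSdef
  have hT : KT R n u T := hT' ()
  have hS : KT R n v S := hS' ()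
  have key : KIneq r n u v T S := hTS () ()
  have mT := hT.meas
  have mS := hS.meas
  have F0 : ∀ x y, 0 < Fk p u v x y := fun x y => by
    have := u0 x; have := v0 y; unfold Fk; positivity
  have mF : Measurable (fun z : (Fin n → ℝ) × (Fin n → ℝ) => ENNReal.ofReal (Fk p u v z.1 z.2)) := by
    unfold Fk; fun_prop
  rw [star0_change u0 v0 hum hvm hT hS, ← mp_lintegral (measurePreserving_arrowProdEquivProdArrow ℝ ℝ (Fin n) (fun _ => gm)
    (fun _ => gm)) (ψ := fun z => ENNReal.ofReal (Fk p u v (T z.1) (S z.2)))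
    (mF.comp (f := fun z : (Fin n → ℝ) × (Fin n → ℝ) => (T z.1, S z.2)) (by fun_prop)),
    ← lintegral_grn_inv hr n (φ := fun q => ENNReal.ofReal (Fk p u v
      (T (MeasurableEquiv.arrowProdEquivProdArrow ℝ ℝ (Fin n) q).1)
      (S (MeasurableEquiv.arrowProdEquivProdArrow ℝ ℝ (Fin n) q).2)))
      ((mF.comp (f := fun z : (Fin n → ℝ) × (Fin n → ℝ) => (T z.1, S z.2))
        (by fun_prop)).comp (MeasurableEquiv.measurable _))]
  have kT : ∀ z i, |T z i| ≤ R := fun z i => abs_le.2 ⟨(hT.mem z i).1.le, (hT.mem z i).2.le⟩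
  have kS : ∀ z i, |S z i| ≤ R := fun z i => abs_le.2 ⟨(hS.mem z i).1.le, (hS.mem z i).2.le⟩
  have i1 : Integrable (fun q : Fin n → ℝ × ℝ =>
      ∑ i, T (fun j => (q j).1) i * S (fun j => (q j).2) i) (grn r n) :=
    bint (K := n * (R * R)) (by fun_prop) (fun q => sum_bdd (kT _) (kS _))
  have iu : Integrable (fun z => Real.log (u (T z))) (gmn n) :=
    bint (K := |Real.log m| + |Real.log M|) (by fun_prop)
      (fun z => log_bdd hm (hu.lo _) (hu.hi _))
  have iv : Integrable (fun z => Real.log (v (S z))) (gmn n) :=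
    bint (K := |Real.log m'| + |Real.log M'|) (by fun_prop)
      (fun z => log_bdd hm' (hv.lo _) (hv.hi _))
  obtain ⟨iu', eu'⟩ := mp_integral (mp_fstn hr n) iu
  obtain ⟨iv', ev'⟩ := mp_integral (mp_sndn hr n) iv
  have il : ∀ i, Integrable (fun q : Fin n → ℝ × ℝ => Real.log (mk r (q i).1 (q i).2)) (grn r n) ∧
      ∫ q : Fin n → ℝ × ℝ, Real.log (mk r (q i).1 (q i).2) ∂(grn r n) =
        -(1/2) * Real.log (1 - r ^ 2) := fun i => by
    have := mp_integral (measurePreserving_eval (fun _ : Fin n => gr r) i) (integrable_log_mk hr)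
    rw [integral_log_mk hr] at this
    exact this
  have il' := integrable_finsetSum Finset.univ (fun i _ => (il i).1)
  set G : (Fin n → ℝ × ℝ) → ℝ := fun q =>
    p * (∑ i, T (fun j => (q j).1) i * S (fun j => (q j).2) i)
      + p * Real.log (u (T (fun j => (q j).1))) + p * Real.log (v (S (fun j => (q j).2)))
      - ∑ i, Real.log (mk r (q i).1 (q i).2) with hG
  have iG : Integrable G (grn r n) :=
    (((i1.const_mul p).fun_add (iu'.const_mul p)).fun_add (iv'.const_mul p)).sub' il'
  have eG : ∫ q, G q ∂(grn r n) =
      p * (∫ q, ∑ i, T (fun j => (q j).1) i * S (fun j => (q j).2) i ∂(grn r n))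
      + p * (∫ z, Real.log (u (T z)) ∂(gmn n)) + p * (∫ z, Real.log (v (S z)) ∂(gmn n))
      - n * (-(1/2) * Real.log (1 - r ^ 2)) := by
    rw [hG, integral_sub (((i1.const_mul p).fun_add (iu'.const_mul p)).fun_add (iv'.const_mul p)) il',
      integral_add ((i1.const_mul p).fun_add (iu'.const_mul p)) (iv'.const_mul p),
      integral_add (i1.const_mul p) (iu'.const_mul p), integral_const_mul, integral_const_mul,
      integral_const_mul, eu', ev', integral_finsetSum _ (fun i _ => (il i).1)]
    simp only [fun i => (il i).2]
    simp
  have hS0 : ∀ i, ∫ z, S z i ∂(gmn n) = 0 := fun i => by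
    rw [hS.pf.integral mS hvm (fun x => (v0 x).le) (φ := fun y => y i) (by fun_prop), hc i]
  unfold KIneq at key
  simp only [hS0, mul_zero, Finset.sum_const_zero, zero_add] at key
  have hle : Real.log (cst p n) ≤ ∫ q, G q ∂(grn r n) := by
    rw [eG, cst, Real.log_exp, h1r, Real.log_inv, ← hrdef]
    have := mul_le_mul_of_nonneg_left key hp.le
    linarith
  calc ENNReal.ofReal (cst p n) ≤ ENNReal.ofReal (rexp (∫ q, G q ∂(grn r n))) := by
        apply ENNReal.ofReal_le_ofReal
        rw [← Real.exp_log (show 0 < cst p n by unfold cst; positivity)]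
        exact Real.exp_le_exp.2 hle
    _ ≤ ∫⁻ q, ENNReal.ofReal (rexp (G q)) ∂(grn r n) := jensen_exp iG
    _ = _ := by
        congr 1; ext q
        rw [← ENNReal.ofReal_prod_of_nonneg (fun i _ => (inv_pos.2 (mk_pos hr _ _)).le),
          ← ENNReal.ofReal_mul (F0 _ _).le]
        congr 1
        simp only [hG, Fk]
        rw [sub_eq_add_neg, Real.exp_add, ← Finset.sum_neg_distrib, Real.exp_sum, Real.exp_add,
          Real.exp_add]
        have e3 : ∀ i, rexp (-Real.log (mk r (q i).1 (q i).2)) = (mk r (q i).1 (q i).2)⁻¹ :=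
          fun i => by rw [Real.exp_neg, Real.exp_log (mk_pos hr _ _)]
        simp only [e3]
        rw [Real.mul_rpow (u0 _).le (v0 _).le, Real.rpow_def_of_pos (u0 _),
          Real.rpow_def_of_pos (v0 _), mul_comm p (Real.log (u _)), mul_comm p (Real.log (v _))]
        simp only [MeasurableEquiv.arrowProdEquivProdArrow, MeasurableEquiv.coe_mk,
          Equiv.arrowProdEquivProdArrow, Equiv.coe_fn_mk]
        ring

end LpS

namespace LpS

open ProbabilityTheory

/-- the open cube -/
def cube (R : ℝ) (n : ℕ) : Set (Fin n → ℝ) := Set.univ.pi (fun _ => Set.Ioo (-R) R)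

lemma measurableSet_cube (R : ℝ) (n : ℕ) : MeasurableSet (cube R n) :=
  MeasurableSet.univ_pi (fun _ => measurableSet_Ioo)

lemma lamn_eq (R : ℝ) (n : ℕ) : lamn R n = volume.restrict (cube R n) := by
  rw [lamn, cube, volume_pi, Measure.restrict_pi_pi]

lemma mp_neg (R : ℝ) (n : ℕ) : MeasurePreserving (fun (x : Fin n → ℝ) i => - x i) (lamn R n)
    (lamn R n) := by
  refine measurePreserving_pi (fun _ : Fin n => lam R) (fun _ => lam R) (fun _ => ?_)
  have h := (Measure.measurePreserving_neg (volume : Measure ℝ)).restrict_preimage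
    (s := Set.Ioo (-R) R) measurableSet_Ioo
  have e : (Neg.neg ⁻¹' Set.Ioo (-R) R : Set ℝ) = Set.Ioo (-R) R := by
    ext x; simp only [Set.mem_preimage, Set.mem_Ioo]; constructor <;> rintro ⟨a, b⟩ <;> constructor <;> linarith
  rw [e] at h
  exact h

lemma mem_cube_abs {R : ℝ} {n : ℕ} {x : Fin n → ℝ} (hx : x ∈ cube R n) (i : Fin n) : |x i| ≤ R := by
  have := hx i (Set.mem_univ i)
  exact abs_le.2 ⟨this.1.le, this.2.le⟩

lemma int_coord (R : ℝ) (n : ℕ) (i : Fin n) : Integrable (fun x : Fin n → ℝ => x i) (lamn R n) := by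
  refine Integrable.of_bound (measurable_pi_apply i).aestronglyMeasurable R ?_
  rw [lamn_eq]
  exact ae_restrict_of_forall_mem (measurableSet_cube R n) (fun x hx => mem_cube_abs hx i)

lemma center (R : ℝ) (n : ℕ) (i : Fin n) : ∫ x : Fin n → ℝ, x i ∂(lamn R n) = 0 := by
  have := (mp_integral (mp_neg R n) (int_coord R n i)).2
  rw [integral_neg] at this
  linarith

lemma star1 {p : ℝ} (hp : 0 < p) {R : ℝ} (hR : 0 < R) (n : ℕ) {m M : ℝ}
    {u v : (Fin n → ℝ) → ℝ} (hm : 0 < m) (hu : Measurable u) (hv : Measurable v)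
    (um : ∀ x, m ≤ u x) (uM : ∀ x, u x ≤ M) (vm : ∀ x, m ≤ v x) (vM : ∀ x, v x ≤ M)
    (hc : ∀ i, ∫ y, y i * v y ∂(lamn R n) = 0) :
    ENNReal.ofReal (((∫ x, u x ∂(lamn R n)) * (∫ x, v x ∂(lamn R n))) ^ (1 + p) * cst p n) ≤
      ∫⁻ z : (Fin n → ℝ) × (Fin n → ℝ),
      ENNReal.ofReal (rexp (p * ∑ i, z.1 i * z.2 i) * (u z.1 * v z.2) ^ (1 + p))
        ∂((lamn R n).prod (lamn R n)) := by
  have hLn : 0 < (lamn R n).real Set.univ := by rw [lamn_real hR]; positivity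
  have aux : ∀ {u : (Fin n → ℝ) → ℝ}, Measurable u → (∀ x, m ≤ u x) → (∀ x, u x ≤ M) →
      0 < ∫ x, u x ∂(lamn R n) ∧ Dens (lamn R n) (m / ∫ x, u x ∂(lamn R n))
        (M / ∫ x, u x ∂(lamn R n)) (fun x => u x / ∫ x, u x ∂(lamn R n)) := by
    intro u hu um uM
    have hi : Integrable u (lamn R n) := bint hu (K := M) (fun x => by
      rw [abs_of_pos (hm.trans_le (um x))]; exact uM x)
    have h1 := integral_mono (integrable_const m) hi um
    have h0 : 0 < ∫ x, u x ∂(lamn R n) := by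
      refine lt_of_lt_of_le ?_ h1
      rw [integral_const, smul_eq_mul]; positivity
    refine ⟨h0, by fun_prop, fun x => ?_, fun x => ?_, ?_⟩
    · exact div_le_div_of_nonneg_right (um x) h0.le
    · exact div_le_div_of_nonneg_right (uM x) h0.le
    · rw [integral_div, div_self h0.ne']
  obtain ⟨u0, du⟩ := aux hu um uM
  obtain ⟨v0, dv⟩ := aux hv vm vM
  set I := ∫ x, u x ∂(lamn R n) with hI
  set J := ∫ x, v x ∂(lamn R n) with hJ
  have := star0 hp hR n (div_pos hm u0) (div_pos hm v0) du dv (fun i => by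
    have : ∀ y : Fin n → ℝ, y i * (v y / J) = y i * v y / J := fun y => by ring
    simp only [this]
    rw [integral_div, hc i, zero_div])
  rw [ENNReal.ofReal_mul (by positivity)]
  refine (mul_le_mul_right this _).trans ?_
  rw [← lintegral_const_mul' _ _ (by simp)]
  refine lintegral_mono (fun z => ?_)
  simp only
  rw [← ENNReal.ofReal_mul (by positivity)]
  apply le_of_eq
  congr 1
  have hu' : 0 < u z.1 := hm.trans_le (um _)
  have hv' : 0 < v z.2 := hm.trans_le (vm _)
  have : u z.1 / I * (v z.2 / J) = (u z.1 * v z.2) / (I * J) := by field_simp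
  rw [this, Real.div_rpow (by positivity) (by positivity)]
  field_simp

lemma star2 {p : ℝ} (hp : 0 < p) {R : ℝ} (hR : 0 < R) (n : ℕ) {M : ℝ}
    {u v : (Fin n → ℝ) → ℝ} (hu : Measurable u) (hv : Measurable v)
    (u0 : ∀ x, 0 ≤ u x) (uM : ∀ x, u x ≤ M) (v0 : ∀ x, 0 ≤ v x) (vM : ∀ x, v x ≤ M)
    (hc : ∀ i, ∫ y, y i * v y ∂(lamn R n) = 0) :
    ENNReal.ofReal (((∫ x, u x ∂(lamn R n)) * (∫ x, v x ∂(lamn R n))) ^ (1 + p) * cst p n) ≤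
      ∫⁻ z : (Fin n → ℝ) × (Fin n → ℝ),
      ENNReal.ofReal (rexp (p * ∑ i, z.1 i * z.2 i) * (u z.1 * v z.2) ^ (1 + p))
        ∂((lamn R n).prod (lamn R n)) := by
  have hM : 0 ≤ M := (u0 0).trans (uM 0)
  have iu : Integrable u (lamn R n) := bint hu (K := M) (fun x => by
      rw [abs_of_nonneg (u0 x)]; exact uM x)
  have iv : Integrable v (lamn R n) := bint hv (K := M) (fun x => by
      rw [abs_of_nonneg (v0 x)]; exact vM x)
  set δ : ℕ → ℝ := fun k => 1 / ((k : ℝ) + 1) with hδ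
  have δ0 : ∀ k, 0 < δ k := fun k => by simp only [hδ]; positivity
  have δ1 : ∀ k, δ k ≤ 1 := fun k => by
    simp only [hδ]; rw [div_le_one (by positivity)]; have : (0:ℝ) ≤ k := k.cast_nonneg; linarith
  have δt : Tendsto δ atTop (nhds 0) := tendsto_one_div_add_atTop_nhds_zero_nat
  have key : ∀ k, _ ≤ _ := fun k => star1 hp hR n (m := δ k) (M := M + 1)
    (u := fun x => u x + δ k) (v := fun x => v x + δ k)
    (δ0 k) (hu.add_const _) (hv.add_const _) (fun x => by linarith [u0 x])
    (fun x => by linarith [uM x, δ1 k]) (fun x => by linarith [v0 x])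
    (fun x => by linarith [vM x, δ1 k]) (fun i => by
      simp only [mul_add]
      rw [integral_add _ ((int_coord R n i).mul_const _), hc i, integral_mul_const, center]
      · simp
      · exact (int_coord R n i).mul_bdd (c := M) hv.aestronglyMeasurable (ae_of_all _ fun x => by
          rw [Real.norm_eq_abs, abs_of_nonneg (v0 x)]; exact vM x))
  have eI : ∀ (w : (Fin n → ℝ) → ℝ) (k : ℕ), Integrable w (lamn R n) → ∫ x, (w x + δ k) ∂(lamn R n) =
      ∫ x, w x ∂(lamn R n) + (lamn R n).real Set.univ * δ k := fun w k hw => by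
    rw [integral_add hw (integrable_const _)]; simp
  simp only [eI u _ iu, eI v _ iv] at key
  have hr1 : (0 : ℝ) ≤ 1 + p := by linarith
  refine le_of_tendsto_of_tendsto' (b := atTop) ?_ ?_ key
  · refine ENNReal.tendsto_ofReal ?_
    refine Tendsto.mul_const _ ?_
    refine Tendsto.rpow_const ?_ (Or.inr hr1)
    have : ∀ A : ℝ, Tendsto (fun k => A + (lamn R n).real Set.univ * δ k) atTop (nhds A) := fun A => by
      simpa using (δt.const_mul ((lamn R n).real Set.univ)).const_add A
    exact (this _).mul (this _)
  · refine tendsto_lintegral_of_dominated_convergence (fun _ =>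
      ENNReal.ofReal (rexp (p * (n * (R * R))) * ((M + 1) * (M + 1)) ^ (1 + p))) ?_ ?_ ?_ ?_
    · intro k; fun_prop
    · intro k
      rw [lamn_eq, Measure.prod_restrict]
      refine ae_restrict_of_forall_mem ((measurableSet_cube R n).prod (measurableSet_cube R n)) ?_
      rintro ⟨x, y⟩ ⟨hx, hy⟩
      apply ENNReal.ofReal_le_ofReal
      have hs := (le_abs_self _).trans (sum_bdd (x := x) (y := y) (mem_cube_abs hx) (mem_cube_abs hy))
      have a1 := u0 x
      have a2 := v0 y
      have a3 := uM x
      have a4 := vM y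
      have a5 := δ0 k
      have a6 := δ1 k
      have : 0 ≤ u x + δ k := by linarith
      have : 0 ≤ v y + δ k := by linarith
      simp only
      gcongr
    · simp only [lintegral_const]
      exact ENNReal.mul_ne_top (by simp) (measure_ne_top _ _)
    · refine ae_of_all _ (fun z => ?_)
      refine ENNReal.tendsto_ofReal ?_
      refine Tendsto.const_mul _ ?_
      refine Tendsto.rpow_const ?_ (Or.inr hr1)
      have : ∀ A : ℝ, Tendsto (fun k => A + δ k) atTop (nhds A) := fun A => by
        simpa using δt.const_add A
      exact (this _).mul (this _)

end LpS

namespace LpS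

/-- exponential weight -/
def ex {n : ℕ} (a y : Fin n → ℝ) : ℝ := rexp (∑ i, a i * y i)

lemma ex_pos {n : ℕ} (a y : Fin n → ℝ) : 0 < ex a y := Real.exp_pos _

lemma measurable_ex {n : ℕ} (a : Fin n → ℝ) : Measurable (ex a) := by
  unfold ex; fun_prop

lemma ex_le {n : ℕ} {R : ℝ} {a y : Fin n → ℝ} {A : ℝ} (ha : ‖a‖ ≤ A) (hy : y ∈ cube R n) :
    ex a y ≤ rexp (n * (A * R)) := by
  unfold ex
  apply Real.exp_le_exp.2
  calc ∑ i, a i * y i ≤ ∑ _i : Fin n, A * R := by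
        refine Finset.sum_le_sum (fun i _ => ?_)
        refine (le_abs_self _).trans ?_
        rw [abs_mul]
        have h1 : |a i| ≤ A := (norm_le_pi_norm a i).trans ha
        exact mul_le_mul h1 (mem_cube_abs hy i) (abs_nonneg _) ((abs_nonneg _).trans h1)
    _ = _ := by simp

/-- hypotheses on the polar density -/
structure HH (n : ℕ) (H : (Fin n → ℝ) → ℝ) (r0 c0 : ℝ) : Prop where
  meas : Measurable H
  nonneg : ∀ y, 0 ≤ H y
  bdd : ∀ R, ∃ M, ∀ y ∈ cube R n, H y ≤ M
  rp : 0 < r0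
  cp : 0 < c0
  low : ∀ y ∈ cube r0 n, c0 ≤ H y

/-- partition function on the cube -/
def Zf {n : ℕ} (H : (Fin n → ℝ) → ℝ) (R : ℝ) (a : Fin n → ℝ) : ℝ := ∫ y, ex a y * H y ∂(lamn R n)

lemma ae_cube {R : ℝ} {n : ℕ} {P : (Fin n → ℝ) → Prop} (h : ∀ x ∈ cube R n, P x) :
    ∀ᵐ x ∂(lamn R n), P x := by
  rw [lamn_eq]
  exact ae_restrict_of_forall_mem (measurableSet_cube R n) h

variable {n : ℕ} {H : (Fin n → ℝ) → ℝ} {r0 c0 : ℝ}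

lemma HH.integrable (h : HH n H r0 c0) (R : ℝ) (a : Fin n → ℝ) :
    Integrable (fun y => ex a y * H y) (lamn R n) := by
  obtain ⟨M, hM⟩ := h.bdd R
  refine Integrable.of_bound ((measurable_ex a).mul h.meas).aestronglyMeasurable
    (rexp (n * (‖a‖ * R)) * M) (ae_cube fun y hy => ?_)
  rw [Real.norm_eq_abs, abs_of_nonneg (mul_nonneg (ex_pos _ _).le (h.nonneg _))]
  exact mul_le_mul (ex_le le_rfl hy) (hM y hy) (h.nonneg _) (Real.exp_pos _).le

lemma HH.continuous (h : HH n H r0 c0) (R : ℝ) : Continuous (Zf H R) := by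
  obtain ⟨M, hM⟩ := h.bdd R
  rw [continuous_iff_continuousAt]
  intro a
  refine continuousAt_of_dominated (bound := fun _ => rexp (n * ((‖a‖ + 1) * R)) * M) ?_ ?_ ?_ ?_
  · exact Eventually.of_forall fun b => ((measurable_ex b).mul h.meas).aestronglyMeasurable
  · have : ∀ᶠ b in nhds a, ‖b‖ < ‖a‖ + 1 :=
      (continuous_norm.tendsto a).eventually_lt_const (by linarith)
    filter_upwards [this] with b hb
    refine ae_cube fun y hy => ?_
    rw [Real.norm_eq_abs, abs_of_nonneg (mul_nonneg (ex_pos _ _).le (h.nonneg _))]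
    exact mul_le_mul (ex_le hb.le hy) (hM y hy) (h.nonneg _) (Real.exp_pos _).le
  · exact integrable_const _
  · refine ae_of_all _ fun y => ?_
    have : Continuous (fun x : Fin n → ℝ => rexp (∑ i, x i * y i) * H y) := by
      refine Continuous.mul (Real.continuous_exp.comp ?_) continuous_const
      exact continuous_finsetSum _ (fun i _ => (continuous_apply i).mul continuous_const)
    exact this.continuousAt

lemma cube_mono {R R' : ℝ} (hR : R ≤ R') : cube R n ⊆ cube R' n :=
  Set.pi_mono (fun _ _ => Set.Ioo_subset_Ioo (by linarith) hR)

lemma lamn_mono {R R' : ℝ} (hR : R ≤ R') : lamn R n ≤ lamn R' n := by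
  rw [lamn_eq, lamn_eq]
  exact Measure.restrict_mono (cube_mono hR) le_rfl

lemma HH.mono (h : HH n H r0 c0) {R R' : ℝ} (hR : R ≤ R') (a : Fin n → ℝ) :
    Zf H R a ≤ Zf H R' a :=
  integral_mono_measure (lamn_mono hR) (ae_of_all _ fun y => mul_nonneg (ex_pos _ _).le (h.nonneg _))
    (h.integrable R' a)

/-- orthant box -/
def obox (r0 : ℝ) (a : Fin n → ℝ) : Set (Fin n → ℝ) :=
  Set.univ.pi (fun i => if 0 ≤ a i then Set.Ioo (r0 / 2) r0 else Set.Ioo (-r0) (-(r0 / 2)))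

lemma HH.lower (h : HH n H r0 c0) {R : ℝ} (hR : r0 ≤ R) (a : Fin n → ℝ) :
    c0 * (r0 / 2) ^ n * (r0 / 2) * ‖a‖ ≤ Zf H R a := by
  have hr0 := h.rp
  have hc0 := h.cp
  refine le_trans ?_ (h.mono hR a)
  have hms : MeasurableSet (obox r0 a) := by
    refine MeasurableSet.univ_pi (fun i => ?_)
    split_ifs <;> exact measurableSet_Ioo
  have hsub : obox r0 a ⊆ cube r0 n := by
    refine Set.pi_mono (fun i _ => ?_)
    split_ifs
    · exact Set.Ioo_subset_Ioo (by linarith) le_rfl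
    · exact Set.Ioo_subset_Ioo le_rfl (by linarith)
  have hvol : volume.real (obox r0 a) = (r0 / 2) ^ n := by
    rw [Measure.real, obox, volume_pi_pi, ENNReal.toReal_prod]
    have : ∀ i, (volume (if 0 ≤ a i then Set.Ioo (r0 / 2) r0 else Set.Ioo (-r0) (-(r0 / 2)))).toReal
        = r0 / 2 := by
      intro i
      split_ifs
      · rw [Real.volume_Ioo, ENNReal.toReal_ofReal (by linarith)]; ring
      · rw [Real.volume_Ioo, ENNReal.toReal_ofReal (by linarith)]; ring
    simp [this, div_pow]
  have hfin : volume (obox r0 a) ≠ ⊤ := by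
    have := measure_mono (μ := volume) hsub
    refine (this.trans_lt ?_).ne
    have : volume (cube r0 n) = lamn r0 n Set.univ := by rw [lamn_eq]; simp
    rw [this]; exact measure_lt_top _ _
  have hlow : ∀ y ∈ obox r0 a, c0 * ((r0 / 2) * ‖a‖) ≤ ex a y * H y := by
    intro y hy
    have h1 : (r0 / 2) * ‖a‖ ≤ ∑ i, a i * y i := by
      have h2 : ∀ i, (r0 / 2) * |a i| ≤ a i * y i := by
        intro i
        have := hy i (Set.mem_univ i)
        simp only at this
        split_ifs at this with hi
        · rw [abs_of_nonneg hi]; nlinarith [this.1]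
        · rw [abs_of_neg (not_le.1 hi)]; nlinarith [this.2, not_le.1 hi]
      have h3 : ‖a‖ ≤ ∑ i, |a i| := (pi_norm_le_iff_of_nonneg (by positivity)).2 (fun i =>
        Finset.single_le_sum (f := fun i => |a i|) (fun _ _ => abs_nonneg _) (Finset.mem_univ i))
      calc (r0 / 2) * ‖a‖ ≤ (r0 / 2) * ∑ i, |a i| := by gcongr
        _ = ∑ i, (r0 / 2) * |a i| := by rw [Finset.mul_sum]
        _ ≤ _ := Finset.sum_le_sum (fun i _ => h2 i)
    have h4 : (r0 / 2) * ‖a‖ ≤ ex a y := by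
      unfold ex; linarith [Real.add_one_le_exp (∑ i, a i * y i)]
    have h5 := h.low y (hsub hy)
    calc c0 * ((r0 / 2) * ‖a‖) = ((r0 / 2) * ‖a‖) * c0 := by ring
      _ ≤ ex a y * H y := mul_le_mul h4 h5 hc0.le (ex_pos _ _).le
  have hi := h.integrable r0 a
  unfold Zf
  rw [lamn_eq] at hi ⊢
  calc c0 * (r0 / 2) ^ n * (r0 / 2) * ‖a‖ = ∫ _y in obox r0 a, c0 * ((r0 / 2) * ‖a‖) := by
        rw [setIntegral_const, hvol, smul_eq_mul]; ring
    _ ≤ ∫ y in obox r0 a, ex a y * H y :=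
        setIntegral_mono_on (integrableOn_const hfin) (hi.mono_measure
          (Measure.restrict_mono hsub le_rfl)) hms hlow
    _ ≤ ∫ y in cube r0 n, ex a y * H y :=
        setIntegral_mono_set hi (ae_of_all _ fun y => mul_nonneg (ex_pos _ _).le (h.nonneg _))
          (ae_of_all _ hsub)

lemma HH.cpos (h : HH n H r0 c0) : 0 < c0 * (r0 / 2) ^ n * (r0 / 2) := by
  have hr0 := h.rp
  have hc0 := h.cp
  positivity

lemma HH.exists_min (h : HH n H r0 c0) {R : ℝ} (hR : r0 ≤ R) :
    ∃ a, ∀ b, Zf H R a ≤ Zf H R b := by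
  refine (h.continuous R).exists_forall_le ?_
  refine tendsto_atTop_mono (h.lower hR) ?_
  exact (tendsto_norm_cocompact_atTop).const_mul_atTop h.cpos

lemma linear_zero {D E R : ℝ} (hR : 0 < R) (hE : 0 ≤ E)
    (h : ∀ t : ℝ, |t| * R ≤ 1 → 0 ≤ t * D + t ^ 2 * R ^ 2 * E) : D = 0 := by
  by_contra hD
  set Q := R * |D| + R ^ 2 * E + 1 with hQ
  have hQ0 : 0 < Q := by positivity
  have h1 := h (-D / Q) (by
    rw [abs_div, abs_neg, abs_of_pos hQ0, div_mul_eq_mul_div, div_le_one hQ0]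
    have : 0 ≤ R ^ 2 * E := by positivity
    nlinarith)
  have h2 : -D / Q * D + (-D / Q) ^ 2 * R ^ 2 * E = D ^ 2 / Q ^ 2 * (R ^ 2 * E - Q) := by
    field_simp; ring
  rw [h2] at h1
  have h3 : R ^ 2 * E - Q < 0 := by
    have : 0 ≤ R * |D| := by positivity
    rw [hQ]; linarith
  have h4 : 0 < D ^ 2 / Q ^ 2 := by positivity
  nlinarith

lemma HH.first_order (h : HH n H r0 c0) {R : ℝ} (hR : r0 ≤ R) {a : Fin n → ℝ}
    (ha : ∀ b, Zf H R a ≤ Zf H R b) (i : Fin n) :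
    ∫ y, y i * (ex a y * H y) ∂(lamn R n) = 0 := by
  have hR0 : 0 < R := h.rp.trans_le hR
  have hi := h.integrable R a
  have hyi : Integrable (fun y => y i * (ex a y * H y)) (lamn R n) := by
    refine hi.bdd_mul (c := R) (measurable_pi_apply i).aestronglyMeasurable ?_
    exact ae_cube fun y hy => mem_cube_abs hy i
  refine linear_zero (E := Zf H R a) hR0 (integral_nonneg fun y =>
    mul_nonneg (ex_pos _ _).le (h.nonneg _)) (fun t ht => ?_)
  have h1 := ha (a + Pi.single i t)
  have h2 : Zf H R (a + Pi.single i t) ≤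
      ∫ y, (ex a y * H y + t * (y i * (ex a y * H y)) + t ^ 2 * R ^ 2 * (ex a y * H y)) ∂(lamn R n) := by
    refine integral_mono_ae (h.integrable R _) ((hi.fun_add (hyi.const_mul t)).fun_add
      (hi.const_mul _)) (ae_cube fun y hy => ?_)
    have e1 : ex (a + Pi.single i t) y = ex a y * rexp (t * y i) := by
      unfold ex
      rw [← Real.exp_add]
      congr 1
      simp [add_mul, Finset.sum_add_distrib, Pi.single_apply]
    have hy := mem_cube_abs hy i
    have hty : |t * y i| ≤ 1 := by
      rw [abs_mul]; refine le_trans ?_ ht; gcongr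
    have h3 := (abs_le.1 (Real.abs_exp_sub_one_sub_id_le hty)).2
    have h4 : (t * y i) ^ 2 ≤ t ^ 2 * R ^ 2 := by
      rw [mul_pow]
      have : (y i) ^ 2 ≤ R ^ 2 := sq_le_sq' (abs_le.1 hy).1 (abs_le.1 hy).2
      gcongr
    have h5 : 0 ≤ ex a y * H y := mul_nonneg (ex_pos _ _).le (h.nonneg _)
    simp only [e1]
    have h6 : rexp (t * y i) ≤ 1 + t * y i + t ^ 2 * R ^ 2 := by linarith
    nlinarith [mul_le_mul_of_nonneg_left h6 h5]
  rw [integral_add (hi.fun_add (hyi.const_mul t)) (hi.const_mul _), integral_add hi (hyi.const_mul t),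
    integral_const_mul, integral_const_mul] at h2
  unfold Zf at h1 h2 ⊢
  linarith

lemma cube_iUnion (r0 : ℝ) : ⋃ k : ℕ, cube (r0 + k) n = Set.univ := by
  ext x
  simp only [Set.mem_iUnion, Set.mem_univ, iff_true]
  obtain ⟨k, hk⟩ := exists_nat_gt (‖x‖ - r0)
  refine ⟨k, fun i _ => ?_⟩
  have := norm_le_pi_norm x i
  rw [Real.norm_eq_abs] at this
  exact abs_lt.1 (by linarith)

lemma lintegral_cubes (r0 : ℝ) {g : (Fin n → ℝ) → ℝ≥0∞} {B : ℝ≥0∞}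
    (hB : ∀ k : ℕ, ∫⁻ y, g y ∂(lamn (r0 + k) n) ≤ B) : ∫⁻ y, g y ≤ B := by
  have hd : Monotone (fun k : ℕ => cube (r0 + k) n) := fun i j hij => cube_mono (by
    have : (i : ℝ) ≤ j := by exact_mod_cast hij
    linarith)
  have := setLIntegral_iUnion_of_directed (μ := volume) g hd.directed_le
  rw [cube_iUnion, setLIntegral_univ] at this
  rw [this]
  refine iSup_le fun k => ?_
  rw [← lamn_eq]; exact hB k

lemma HH.compact (h : HH n H r0 c0) {B : ℝ}
    (hB : ∀ k : ℕ, ∃ a, Zf H (r0 + k) a ≤ B) :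
    ∃ a, ∫⁻ y, ENNReal.ofReal (ex a y * H y) ≤ ENNReal.ofReal B := by
  set A : ℕ → Set (Fin n → ℝ) := fun k => {a | Zf H (r0 + k) a ≤ B} with hA
  have hcl : ∀ k, IsClosed (A k) := fun k => isClosed_le (h.continuous _) continuous_const
  have hdec : ∀ k, A (k + 1) ⊆ A k := fun k a ha =>
    le_trans (h.mono (by push_cast; linarith) a) ha
  have hcomp : IsCompact (A 0) := by
    refine Metric.isCompact_of_isClosed_isBounded (hcl 0) ?_
    refine (Metric.isBounded_closedBall (x := (0 : Fin n → ℝ))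
      (r := B / (c0 * (r0 / 2) ^ n * (r0 / 2)))).subset (fun a ha => ?_)
    rw [mem_closedBall_zero_iff, le_div_iff₀ h.cpos, mul_comm]
    exact (h.lower (by simp) a).trans ha
  obtain ⟨a, ha⟩ := IsCompact.nonempty_iInter_of_sequence_nonempty_isCompact_isClosed A hdec hB hcomp hcl
  refine ⟨a, lintegral_cubes r0 fun k => ?_⟩
  have hk : Zf H (r0 + k) a ≤ B := Set.mem_iInter.1 ha k
  rw [← ofReal_integral_eq_lintegral_ofReal (h.integrable _ a)
    (ae_of_all _ fun y => mul_nonneg (ex_pos _ _).le (h.nonneg _))]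
  exact ENNReal.ofReal_le_ofReal hk

end LpS

namespace LpS

variable {n : ℕ}

/-- the `L^p` Laplace transform -/
def LE (p : ℝ) (W : (Fin n → ℝ) → ℝ) (y : Fin n → ℝ) : ℝ≥0∞ :=
  ∫⁻ x, ENNReal.ofReal (rexp (p * ∑ i, x i * y i) * W x ^ (1 + p))

/-- the polar density -/
def HE (p : ℝ) (W : (Fin n → ℝ) → ℝ) (y : Fin n → ℝ) : ℝ :=
  if LE p W y = ⊤ then 0 else (LE p W y).toReal ^ (-(1 / p))

lemma measurable_LE {p : ℝ} {W : (Fin n → ℝ) → ℝ} (hW : Measurable W) : Measurable (LE p W) := by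
  refine Measurable.lintegral_prod_left' (f := fun z : (Fin n → ℝ) × (Fin n → ℝ) =>
    ENNReal.ofReal (rexp (p * ∑ i, z.1 i * z.2 i) * W z.1 ^ (1 + p))) ?_
  fun_prop

lemma measurable_HE {p : ℝ} {W : (Fin n → ℝ) → ℝ} (hW : Measurable W) : Measurable (HE p W) := by
  have h := measurable_LE (p := p) hW
  refine Measurable.ite (h (measurableSet_singleton ⊤)) measurable_const ?_
  exact h.ennreal_toReal.pow_const _

lemma HE_nonneg (p : ℝ) (W : (Fin n → ℝ) → ℝ) (y : Fin n → ℝ) : 0 ≤ HE p W y := by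
  unfold HE; split_ifs <;> positivity

lemma LE_translate (p : ℝ) (W : (Fin n → ℝ) → ℝ) (a y : Fin n → ℝ) :
    ∫⁻ x, ENNReal.ofReal (rexp (p * ∑ i, x i * y i) * W (x + a) ^ (1 + p)) =
      ENNReal.ofReal (rexp (-(p * ∑ i, a i * y i))) * LE p W y := by
  unfold LE
  rw [← lintegral_add_right_eq_self (μ := volume) (fun x : Fin n → ℝ =>
    ENNReal.ofReal (rexp (p * ∑ i, x i * y i) * W x ^ (1 + p))) a,
    ← lintegral_const_mul' _ _ (by simp)]
  congr 1; ext x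
  rw [← ENNReal.ofReal_mul (Real.exp_pos _).le, ← mul_assoc, ← Real.exp_add]
  congr 4
  simp only [Pi.add_apply, add_mul, Finset.sum_add_distrib]
  ring

lemma polar_ineq {p : ℝ} (hp : 0 < p) (W : (Fin n → ℝ) → ℝ) (a y : Fin n → ℝ) :
    ENNReal.ofReal ((ex a y * HE p W y) ^ (1 + p)) *
      (ENNReal.ofReal (rexp (-(p * ∑ i, a i * y i))) * LE p W y) ≤
      ENNReal.ofReal (ex a y * HE p W y) := by
  by_cases hL : LE p W y = ⊤
  · simp [HE, hL, Real.zero_rpow (show (1 + p) ≠ 0 by positivity)]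
  set ℓ := (LE p W y).toReal with hℓ
  have eL : LE p W y = ENNReal.ofReal ℓ := (ENNReal.ofReal_toReal hL).symm
  have eH : HE p W y = ℓ ^ (-(1 / p)) := by rw [HE, if_neg hL]
  have hℓ0 : 0 ≤ ℓ := ENNReal.toReal_nonneg
  have hx := ex_pos a y
  rw [eH, eL]
  rcases hℓ0.eq_or_lt with h0 | h0
  · simp [← h0]
  have hv : 0 < ex a y * ℓ ^ (-(1 / p)) := by positivity
  rw [← ENNReal.ofReal_mul (by positivity), ← ENNReal.ofReal_mul (by positivity)]
  apply ENNReal.ofReal_le_ofReal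
  rw [Real.rpow_add hv, Real.rpow_one, Real.mul_rpow hx.le (by positivity), ← Real.rpow_mul h0.le]
  have e1 : -(1 / p) * p = -1 := by field_simp
  have e2 : ex a y ^ p = rexp (p * ∑ i, a i * y i) := by
    unfold ex; rw [← Real.exp_mul, mul_comm]
  rw [e1, e2, Real.rpow_neg_one, Real.exp_neg]
  apply le_of_eq
  have := Real.exp_pos (p * ∑ i, a i * y i)
  field_simp

lemma stepB1 {p : ℝ} (hp : 0 < p) {W : (Fin n → ℝ) → ℝ} (hW : Measurable W) (W0 : ∀ x, 0 ≤ W x)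
    {C : ℝ} (WC : ∀ x, W x ≤ C) {r0 c0 : ℝ} (h : HH n (HE p W) r0 c0) {R R' : ℝ} (hR : r0 ≤ R)
    (hR' : R ≤ R') {a : Fin n → ℝ} (ha : ∀ b, Zf (HE p W) R a ≤ Zf (HE p W) R b) :
    ((∫ x, W (x + a) ∂(lamn R' n)) * Zf (HE p W) R a) ^ (1 + p) * cst p n ≤ Zf (HE p W) R a := by
  set v : (Fin n → ℝ) → ℝ := (cube R n).indicator (fun y => ex a y * HE p W y) with hv
  have hR0 : 0 < R' := (h.rp.trans_le hR).trans_le hR'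
  obtain ⟨M, hM⟩ := h.bdd R
  have hx := measurable_ex a
  have hmv : Measurable v := (hx.mul h.meas).indicator (measurableSet_cube R n)
  have v0 : ∀ y, 0 ≤ v y := fun y => Set.indicator_nonneg
    (fun y _ => mul_nonneg (ex_pos _ _).le (h.nonneg _)) y
  set M' := rexp (n * (‖a‖ * R)) * |M| with hM'
  have vM : ∀ y, v y ≤ |C| + M' := by
    intro y
    by_cases hy : y ∈ cube R n
    · rw [hv, Set.indicator_of_mem hy]
      have : ex a y * HE p W y ≤ M' :=
        mul_le_mul (ex_le le_rfl hy) ((hM y hy).trans (le_abs_self _)) (h.nonneg _) (Real.exp_pos _).le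
      linarith [abs_nonneg C]
    · rw [hv, Set.indicator_of_notMem hy]; positivity
  have eint : ∀ g : (Fin n → ℝ) → ℝ, ∫ y, (cube R n).indicator g y ∂(lamn R' n) = ∫ y, g y ∂(lamn R n) := by
    intro g
    rw [lamn_eq, lamn_eq, setIntegral_indicator (measurableSet_cube R n),
      Set.inter_eq_self_of_subset_right (cube_mono hR')]
  have hWa : Measurable (fun x => W (x + a)) := hW.comp (measurable_id.add_const a)
  have key := star2 hp hR0 n (u := fun x => W (x + a)) (v := v) (M := |C| + M') hWa hmv
    (fun x => W0 _) (fun x => (WC _).trans (by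
      have : 0 ≤ M' := by positivity
      linarith [le_abs_self C])) v0 vM (fun i => by
      rw [← h.first_order hR ha i, ← eint]
      congr 1; ext y
      by_cases hy : y ∈ cube R n
      · simp [hv, hy]
      · simp [hv, hy])
  rw [hv, eint] at key
  change ENNReal.ofReal ((_ * Zf (HE p W) R a) ^ (1 + p) * _) ≤ _ at key
  have hZ0 : 0 ≤ Zf (HE p W) R a := integral_nonneg fun y => mul_nonneg (ex_pos _ _).le (h.nonneg _)
  rw [← ENNReal.ofReal_le_ofReal_iff hZ0]
  refine key.trans ?_
  rw [← hv]
  rw [lintegral_prod_symm _ (by fun_prop)]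
  calc _ ≤ ∫⁻ y, ENNReal.ofReal (v y) ∂(lamn R' n) := by
        refine lintegral_mono fun y => ?_
        simp only
        have e1 : ∀ x : Fin n → ℝ, ENNReal.ofReal (rexp (p * ∑ i, x i * y i) *
            (W (x + a) * v y) ^ (1 + p)) = ENNReal.ofReal (v y ^ (1 + p)) *
            ENNReal.ofReal (rexp (p * ∑ i, x i * y i) * W (x + a) ^ (1 + p)) := by
          intro x
          have := v0 y
          rw [← ENNReal.ofReal_mul (by positivity), Real.mul_rpow (W0 _) this]
          congr 1; ring
        simp only [e1]
        rw [lintegral_const_mul' _ _ (by simp)]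
        by_cases hy : y ∈ cube R n
        · have e2 : v y = ex a y * HE p W y := by rw [hv, Set.indicator_of_mem hy]
          rw [e2]
          refine le_trans (mul_le_mul_right ?_ _) (polar_ineq hp W a y)
          rw [← LE_translate, lamn_eq]
          exact setLIntegral_le_lintegral _ _
        · have e2 : v y = 0 := by rw [hv, Set.indicator_of_notMem hy]
          rw [e2, Real.zero_rpow (by positivity)]; simp
    _ = ENNReal.ofReal (∫ y, v y ∂(lamn R' n)) := by
        rw [ofReal_integral_eq_lintegral_ofReal (bint hmv (K := |C| + M') (fun y => by
          rw [abs_of_nonneg (v0 y)]; exact vM y)) (ae_of_all _ v0)]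
    _ = _ := by rw [hv, eint]; rfl

lemma stepB {p : ℝ} (hp : 0 < p) {W : (Fin n → ℝ) → ℝ} (hW : Measurable W) (W0 : ∀ x, 0 ≤ W x)
    {C : ℝ} (WC : ∀ x, W x ≤ C) (Wi : Integrable W) (V0 : 0 < ∫ x, W x)
    {r0 c0 : ℝ} (h : HH n (HE p W) r0 c0) {R : ℝ} (hR : r0 ≤ R)
    {a : Fin n → ℝ} (ha : ∀ b, Zf (HE p W) R a ≤ Zf (HE p W) R b) :
    (∫ x, W x) ^ (1 + 1 / p) * Zf (HE p W) R a ≤ (cst p n) ^ (-(1 / p)) := by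
  have hc : 0 < cst p n := Real.exp_pos _
  have hZ0 : 0 ≤ Zf (HE p W) R a := integral_nonneg fun y => mul_nonneg (ex_pos _ _).le (h.nonneg _)
  set Z := Zf (HE p W) R a with hZ
  rcases hZ0.eq_or_lt with hz | hz
  · rw [← hz, mul_zero]; positivity
  have ht : Tendsto (fun k : ℕ => ∫ x, W (x + a) ∂(lamn (R + k) n)) atTop (nhds (∫ x, W x)) := by
    have hd : Monotone (fun k : ℕ => cube (R + k) n) := fun i j hij => cube_mono (by
      have : (i : ℝ) ≤ j := by exact_mod_cast hij
      linarith)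
    have := tendsto_setIntegral_of_monotone (μ := volume) (f := fun x => W (x + a))
      (fun k : ℕ => measurableSet_cube (R + k) n) hd (Wi.comp_add_right a).integrableOn
    rw [cube_iUnion, setIntegral_univ, integral_add_right_eq_self] at this
    simpa only [lamn_eq] using this
  have hlim : ((∫ x, W x) * Z) ^ (1 + p) * cst p n ≤ Z := by
    refine le_of_tendsto' (b := Z) (x := atTop) (f := fun k : ℕ =>
      ((∫ x, W (x + a) ∂(lamn (R + k) n)) * Z) ^ (1 + p) * cst p n) ?_
      (fun k => stepB1 hp hW W0 WC h hR (by simp) ha)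
    refine Tendsto.mul_const _ ?_
    exact Tendsto.rpow_const (ht.mul_const _) (Or.inr (by linarith))
  set V := ∫ x, W x with hV
  have h1 : V ^ (1 + p) * Z ^ p * cst p n ≤ 1 := by
    rw [Real.mul_rpow V0.le hZ0, Real.rpow_add hz, Real.rpow_one] at hlim
    have : Z * (V ^ (1 + p) * Z ^ p * cst p n) ≤ Z * 1 := by linarith
    exact le_of_mul_le_mul_left this hz
  have h2 : (V ^ (1 + 1 / p) * Z) ^ p ≤ (cst p n)⁻¹ := by
    rw [Real.mul_rpow (by positivity) hZ0, ← Real.rpow_mul V0.le]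
    have : (1 + 1 / p) * p = 1 + p := by field_simp; ring
    rw [this, ← one_div, le_div_iff₀ hc]
    exact h1
  have h3 := Real.rpow_le_rpow (by positivity) h2 (show 0 ≤ 1 / p by positivity)
  rw [← Real.rpow_mul (by positivity), mul_one_div_cancel hp.ne', Real.rpow_one,
    Real.inv_rpow hc.le, ← Real.rpow_neg hc.le] at h3
  exact h3

end LpS

namespace LpS

variable {n : ℕ}

lemma int_exp_abs {c : ℝ} (hc : 0 < c) : Integrable (fun x : ℝ => rexp (-(c * |x|))) := by
  have h1 : IntegrableOn (fun x : ℝ => rexp (-(c * |x|))) (Set.Ioi 0) := by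
    refine (exp_neg_integrableOn_Ioi 0 hc).congr_fun (fun x hx => ?_) measurableSet_Ioi
    simp only [abs_of_pos (Set.mem_Ioi.1 hx)]; ring_nf
  have h2 : IntegrableOn (fun x : ℝ => rexp (-(c * |x|))) (Set.Iic 0) := by
    refine (integrableOn_exp_mul_Iic hc 0).congr_fun (fun x hx => ?_) measurableSet_Iic
    simp only [abs_of_nonpos (Set.mem_Iic.1 hx)]; ring_nf
  have := h2.union h1
  rwa [Set.Iic_union_Ioi, integrableOn_univ] at this

lemma int_exp_sum {c : ℝ} (hc : 0 < c) :
    Integrable (fun x : Fin n → ℝ => rexp (-(c * ∑ i, |x i|))) := by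
  have := Integrable.fintype_prod (ι := Fin n) (μ := fun _ => (volume : Measure ℝ))
    (f := fun _ x => rexp (-(c * |x|))) (fun _ => int_exp_abs hc)
  rw [← volume_pi] at this
  refine this.congr (Eventually.of_forall fun x => ?_)
  simp only [← Real.exp_sum, Finset.mul_sum, Finset.sum_neg_distrib]

variable {W : (Fin n → ℝ) → ℝ} {p α C : ℝ}

lemma W_le_C (hα : 0 < α) (hC : 0 < C) (hWb : ∀ x, W x ≤ C * rexp (-(α * ∑ i, |x i|)))
    (x : Fin n → ℝ) : W x ≤ C := by
  refine (hWb x).trans (mul_le_of_le_one_right hC.le (Real.exp_le_one_iff.2 ?_))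
  have : 0 ≤ ∑ i, |x i| := Finset.sum_nonneg fun i _ => abs_nonneg _
  nlinarith [mul_nonneg hα.le this]

lemma W_int (hW : Measurable W) (W0 : ∀ x, 0 ≤ W x) (hα : 0 < α)
    (hWb : ∀ x, W x ≤ C * rexp (-(α * ∑ i, |x i|))) : Integrable W := by
  refine ((int_exp_sum hα).const_mul C).mono' hW.aestronglyMeasurable
    (Eventually.of_forall fun x => ?_)
  rw [Real.norm_eq_abs, abs_of_nonneg (W0 x)]
  exact hWb x

lemma pow_pos_lint (hp : 0 < p) (hW : Measurable W) (W0 : ∀ x, 0 ≤ W x)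
    (hV : 0 < ∫⁻ x, ENNReal.ofReal (W x)) : 0 < ∫⁻ x, ENNReal.ofReal (W x ^ (1 + p)) := by
  rw [lintegral_pos_iff_support (by fun_prop)] at hV ⊢
  refine hV.trans_le (measure_mono fun x hx => ?_)
  simp only [Function.mem_support, ne_eq, ENNReal.ofReal_eq_zero, not_le] at hx ⊢
  exact Real.rpow_pos_of_pos hx _

lemma LE_pos (hp : 0 < p) (hW : Measurable W) (W0 : ∀ x, 0 ≤ W x)
    (hV : 0 < ∫⁻ x, ENNReal.ofReal (W x)) (y : Fin n → ℝ) : 0 < LE p W y := by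
  unfold LE
  rw [lintegral_pos_iff_support (by fun_prop)] at hV ⊢
  refine hV.trans_le (measure_mono fun x hx => ?_)
  simp only [Function.mem_support, ne_eq, ENNReal.ofReal_eq_zero, not_le] at hx ⊢
  exact mul_pos (Real.exp_pos _) (Real.rpow_pos_of_pos hx _)

lemma sum_abs_le {r : ℝ} {x y : Fin n → ℝ} (h : ∀ i, |y i| ≤ r) :
    |∑ i, x i * y i| ≤ r * ∑ i, |x i| := by
  refine (Finset.abs_sum_le_sum_abs _ _).trans ?_
  rw [Finset.mul_sum]
  refine Finset.sum_le_sum fun i _ => ?_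
  rw [abs_mul, mul_comm]
  exact mul_le_mul_of_nonneg_right (h i) (abs_nonneg _)

lemma low_HE (hp : 0 < p) (hW : Measurable W) (W0 : ∀ x, 0 ≤ W x) (hα : 0 < α) (hC : 0 < C)
    (hWb : ∀ x, W x ≤ C * rexp (-(α * ∑ i, |x i|))) (hV : 0 < ∫⁻ x, ENNReal.ofReal (W x)) :
    ∃ r0 c0, 0 < r0 ∧ 0 < c0 ∧ ∀ y ∈ cube r0 n, c0 ≤ HE p W y := by
  set β := α * (1 + p) / 2 with hβ
  have hβ0 : 0 < β := by positivity
  have hr : 0 < β / p := by positivity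
  have hI := (int_exp_sum (n := n) hβ0).const_mul (C ^ (1 + p))
  set D := ∫ x : Fin n → ℝ, C ^ (1 + p) * rexp (-(β * ∑ i, |x i|)) with hD
  have key : ∀ y ∈ cube (β / p) n, LE p W y ≤ ENNReal.ofReal D := by
    intro y hy
    rw [hD, ofReal_integral_eq_lintegral_ofReal hI (Eventually.of_forall fun x => by positivity)]
    refine lintegral_mono fun x => ENNReal.ofReal_le_ofReal ?_
    have h1 := (abs_le.1 (sum_abs_le (x := x) (mem_cube_abs hy))).2
    have h2 : W x ^ (1 + p) ≤ C ^ (1 + p) * rexp (-(2 * β * ∑ i, |x i|)) := by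
      refine (Real.rpow_le_rpow (W0 x) (hWb x) (by positivity)).trans (le_of_eq ?_)
      rw [Real.mul_rpow hC.le (Real.exp_pos _).le, ← Real.exp_mul]
      congr 2; rw [hβ]; ring
    have h3 : p * ∑ i, x i * y i ≤ β * ∑ i, |x i| := by
      calc p * ∑ i, x i * y i ≤ p * (β / p * ∑ i, |x i|) := mul_le_mul_of_nonneg_left h1 hp.le
        _ = _ := by field_simp
    calc rexp (p * ∑ i, x i * y i) * W x ^ (1 + p)
        ≤ rexp (β * ∑ i, |x i|) * (C ^ (1 + p) * rexp (-(2 * β * ∑ i, |x i|))) :=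
          mul_le_mul (Real.exp_le_exp.2 h3) h2 (Real.rpow_nonneg (W0 x) _) (Real.exp_pos _).le
      _ = C ^ (1 + p) * (rexp (β * ∑ i, |x i|) * rexp (-(2 * β * ∑ i, |x i|))) := by ring
      _ = _ := by rw [← Real.exp_add]; ring_nf
  have key2 : ∀ y ∈ cube (β / p) n, LE p W y ≠ ⊤ ∧ 0 < (LE p W y).toReal ∧
      (LE p W y).toReal ≤ D := by
    intro y hy
    have ht : LE p W y ≠ ⊤ := ne_top_of_le_ne_top ENNReal.ofReal_ne_top (key y hy)
    refine ⟨ht, ENNReal.toReal_pos (LE_pos hp hW W0 hV y).ne' ht, ?_⟩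
    exact ENNReal.toReal_le_of_le_ofReal
      (integral_nonneg fun x => by positivity) (key y hy)
  have h0 : (0 : Fin n → ℝ) ∈ cube (β / p) n := by
    simp only [cube, Set.mem_univ_pi]; intro i; simp [hr]
  have hDp : 0 < D := (key2 0 h0).2.1.trans_le (key2 0 h0).2.2
  refine ⟨β / p, D ^ (-(1 / p)), hr, by positivity, fun y hy => ?_⟩
  obtain ⟨k1, k2, k3⟩ := key2 y hy
  rw [HE, if_neg k1]
  exact Real.rpow_le_rpow_of_nonpos k2 k3 (by simp [hp.le])

lemma bdd_HE (hp : 0 < p) (hW : Measurable W) (W0 : ∀ x, 0 ≤ W x)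
    (hV : 0 < ∫⁻ x, ENNReal.ofReal (W x)) (R : ℝ) :
    ∃ M, ∀ y ∈ cube R n, HE p W y ≤ M := by
  obtain ⟨K, hK⟩ : ∃ k : ℕ, 0 < ∫⁻ x, ENNReal.ofReal (W x ^ (1 + p)) ∂(lamn (0 + k) n) := by
    by_contra! hcon
    have := lintegral_cubes (n := n) 0 (g := fun x => ENNReal.ofReal (W x ^ (1 + p))) (B := 0) hcon
    exact absurd (pow_pos_lint hp hW W0 hV) (not_lt.2 this)
  rw [zero_add] at hK
  set D := ∫⁻ x, ENNReal.ofReal (W x ^ (1 + p)) ∂(lamn K n) with hD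
  set e := rexp (-(p * (R * (n * K)))) with he
  have key : ∀ y ∈ cube R n, ENNReal.ofReal e * D ≤ LE p W y := by
    intro y hy
    rw [hD, ← lintegral_const_mul' _ _ (by simp), lamn_eq]
    refine le_trans ?_ (setLIntegral_le_lintegral (cube (K : ℝ) n) _)
    refine setLIntegral_mono (by fun_prop) fun x hx => ?_
    rw [← ENNReal.ofReal_mul (Real.exp_pos _).le]
    refine ENNReal.ofReal_le_ofReal (mul_le_mul_of_nonneg_right ?_ (Real.rpow_nonneg (W0 x) _))
    refine Real.exp_le_exp.2 ?_
    have h1 := (abs_le.1 (sum_abs_le (x := x) (mem_cube_abs hy))).1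
    have h2 : ∑ i, |x i| ≤ n * K := by
      calc ∑ i, |x i| ≤ ∑ _i : Fin n, (K : ℝ) := Finset.sum_le_sum fun i _ => mem_cube_abs hx i
        _ = _ := by simp
    rcases isEmpty_or_nonempty (Fin n) with hn | ⟨⟨i⟩⟩
    · have : (n : ℝ) = 0 := by
        have : n = 0 := by
          by_contra h; exact hn.false ⟨0, Nat.pos_of_ne_zero h⟩
        simp [this]
      simp [this]
    have hR : 0 ≤ R := (abs_nonneg _).trans (mem_cube_abs hy i)
    nlinarith [mul_le_mul_of_nonneg_left h1 hp.le,
      mul_le_mul_of_nonneg_left (mul_le_mul_of_nonneg_left h2 hR) hp.le]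
  refine ⟨(ENNReal.ofReal e * D).toReal ^ (-(1 / p)), fun y hy => ?_⟩
  unfold HE
  split_ifs with h
  · positivity
  have hk := key y hy
  have ht : ENNReal.ofReal e * D ≠ ⊤ := ne_top_of_le_ne_top h hk
  refine Real.rpow_le_rpow_of_nonpos ?_ (ENNReal.toReal_mono h hk) (by simp [hp.le])
  refine ENNReal.toReal_pos (mul_ne_zero ?_ hK.ne') ht
  simp [he, Real.exp_pos]

lemma stepD (hp : 0 < p) (hW : Measurable W) (W0 : ∀ x, 0 ≤ W x) (hα : 0 < α) (hC : 0 < C)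
    (hWb : ∀ x, W x ≤ C * rexp (-(α * ∑ i, |x i|))) (hV : 0 < ∫⁻ x, ENNReal.ofReal (W x)) :
    0 < ∫ x, W x ∧ ∃ a, ∫⁻ y, ENNReal.ofReal (ex a y * HE p W y) ≤
      ENNReal.ofReal (cst p n ^ (-(1 / p)) / (∫ x, W x) ^ (1 + 1 / p)) := by
  have Wi := W_int hW W0 hα hWb
  have V0 : 0 < ∫ x, W x := by
    rw [integral_eq_lintegral_of_nonneg_ae (Eventually.of_forall W0) hW.aestronglyMeasurable]
    refine ENNReal.toReal_pos hV.ne' ?_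
    rw [← ofReal_integral_eq_lintegral_ofReal Wi (Eventually.of_forall W0)]
    simp
  obtain ⟨r0, c0, hr, hc, hl⟩ := low_HE hp hW W0 hα hC hWb hV
  have h : HH n (HE p W) r0 c0 :=
    ⟨measurable_HE hW, HE_nonneg p W, bdd_HE hp hW W0 hV, hr, hc, hl⟩
  refine ⟨V0, h.compact fun k => ?_⟩
  have hR : r0 ≤ r0 + k := by simp
  obtain ⟨a, ha⟩ := h.exists_min hR
  refine ⟨a, ?_⟩
  rw [le_div_iff₀ (by positivity), mul_comm]
  exact stepB hp hW W0 (W_le_C hα hC hWb) Wi V0 h hR ha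

end LpS

namespace LpS

variable {n : ℕ}

/-- real density of an extended real -/
def we (t : EReal) : ℝ := (erealExp (-t)).toReal

lemma we_top : we ⊤ = 0 := by simp [we, erealExp]

lemma we_coe (r : ℝ) : we (r : EReal) = rexp (-r) := by
  have h : -(r : EReal) = ((-r : ℝ) : EReal) := by simp
  rw [we, h, erealExp, if_neg (EReal.coe_ne_bot _), if_neg (EReal.coe_ne_top _), EReal.toReal_coe,
    ENNReal.toReal_ofReal (Real.exp_pos _).le]

lemma we_nonneg (t : EReal) : 0 ≤ we t := ENNReal.toReal_nonneg

lemma erealExp_coe (r : ℝ) : erealExp (r : EReal) = ENNReal.ofReal (rexp r) := by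
  rw [erealExp, if_neg (EReal.coe_ne_bot _), if_neg (EReal.coe_ne_top _), EReal.toReal_coe]

lemma erealExp_bot : erealExp ⊥ = 0 := by simp [erealExp]

lemma erealExp_neg {t : EReal} (ht : t ≠ ⊥) : erealExp (-t) = ENNReal.ofReal (we t) := by
  rw [we, ENNReal.ofReal_toReal]
  induction t with
  | bot => exact absurd rfl ht
  | top => simp [erealExp]
  | coe r =>
    rw [← EReal.coe_neg, erealExp_coe]
    simp

lemma erealExp_sub {t : EReal} (ht : t ≠ ⊥) {p : ℝ} (hp : 0 < p) (c : ℝ) :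
    erealExp ((c : EReal) - ((p + 1 : ℝ) : EReal) * t) =
      ENNReal.ofReal (rexp c * we t ^ (1 + p)) := by
  have hp1 : 0 < p + 1 := by positivity
  induction t with
  | bot => exact absurd rfl ht
  | top =>
    rw [we_top, Real.zero_rpow (by positivity), EReal.coe_mul_top_of_pos hp1, sub_eq_add_neg, EReal.neg_top,
      EReal.add_bot, erealExp_bot]
    simp
  | coe r =>
    rw [we_coe, ← EReal.coe_mul, ← EReal.coe_sub, erealExp_coe, ← Real.exp_mul, ← Real.exp_add]
    ring_nf

lemma measurable_erealExp : Measurable erealExp := by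
  unfold erealExp
  refine Measurable.ite (measurableSet_singleton ⊥) measurable_const ?_
  refine Measurable.ite (measurableSet_singleton ⊤) measurable_const ?_
  exact (Real.measurable_exp.comp measurable_ereal_toReal).ennreal_ofReal

lemma measurable_we : Measurable we := by
  unfold we
  exact (measurable_erealExp.comp measurable_neg).ennreal_toReal

lemma lint_toLp (ψ : Euc n → ℝ≥0∞) :
    ∫⁻ x, ψ x = ∫⁻ x : Fin n → ℝ, ψ (WithLp.toLp 2 x) :=
  ((PiLp.volume_preserving_toLp (Fin n)).lintegral_comp_emb
    (MeasurableEquiv.toLp 2 (Fin n → ℝ)).measurableEmbedding ψ).symm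

lemma star_eq {p : ℝ} (hp : 0 < p) {f : Euc n → EReal} (hf : ∀ x, f x ≠ ⊥)
    {W : (Fin n → ℝ) → ℝ} (hWf : ∀ x, W x = we (f (WithLp.toLp 2 x))) {V : ℝ} (V0 : 0 < V)
    (a y : Fin n → ℝ) (hL : 0 < LE p W y)
    (hV : Vol (Transl (WithLp.toLp 2 a) f) = V) :
    erealExp (-(LpStar p (Transl (WithLp.toLp 2 a) f) (WithLp.toLp 2 y))) =
      ENNReal.ofReal (V ^ (1 / p)) * ENNReal.ofReal (ex a y * HE p W y) := by
  have e1 : LpIntE p (Transl (WithLp.toLp 2 a) f) (WithLp.toLp 2 y) =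
      ENNReal.ofReal (rexp (-(p * ∑ i, a i * y i))) * LE p W y := by
    rw [← LE_translate, LpIntE, lint_toLp]
    congr 1; ext x
    rw [Transl, erealExp_sub (hf _) hp, hWf, ← WithLp.toLp_add]
    have hi : ⟪(WithLp.toLp 2 x : Euc n), WithLp.toLp 2 y⟫ = ∑ i, x i * y i := by
      simp [PiLp.inner_apply, mul_comm]
    rw [hi]
  have hee := Real.exp_pos (-(p * ∑ i, a i * y i))
  by_cases hT : LE p W y = ⊤
  · have : LpIntE p (Transl (WithLp.toLp 2 a) f) (WithLp.toLp 2 y) = ⊤ := by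
      rw [e1, hT, ENNReal.mul_top]
      simpa using hee
    rw [LpStar, if_pos this, EReal.neg_top, erealExp_bot, HE, if_pos hT]
    simp
  · have hne : LpIntE p (Transl (WithLp.toLp 2 a) f) (WithLp.toLp 2 y) ≠ ⊤ := by
      rw [e1]; exact ENNReal.mul_ne_top ENNReal.ofReal_ne_top hT
    rw [LpStar, if_neg hne, ← EReal.coe_neg, erealExp_coe, HE, if_neg hT, hV, e1, ENNReal.toReal_mul,
      ENNReal.toReal_ofReal hee.le, ← ENNReal.ofReal_mul (by positivity)]
    have hl : 0 < (LE p W y).toReal := ENNReal.toReal_pos hL.ne' hT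
    set ℓ := (LE p W y).toReal
    congr 1
    rw [Real.log_div (by positivity) V0.ne', Real.log_mul hee.ne' hl.ne', Real.log_exp, ex,
      Real.rpow_def_of_pos V0, Real.rpow_def_of_pos hl, ← Real.exp_add, ← Real.exp_add]
    congr 1
    field_simp
    ring

lemma const_eq {p : ℝ} (hp : 0 < p) (n : ℕ) : cst p n ^ (-(1 / p)) =
    (2 * π * Real.sqrt ((1 + p) ^ ((1 + p) / p) / p)) ^ n := by
  have hp1 : 0 < 1 + p := by positivity
  have hB : 0 < 2 * π * Real.sqrt ((1 + p) ^ ((1 + p) / p) / p) := by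
    have := Real.pi_pos
    positivity
  rw [cst, ← Real.exp_mul, ← Real.rpow_natCast, Real.rpow_def_of_pos hB]
  congr 1
  rw [Real.log_mul (x := 2 * π) (y := √((1 + p) ^ ((1 + p) / p) / p)) (by positivity)
    (by positivity), Real.log_sqrt (by positivity),
    Real.log_sqrt (by positivity), Real.log_div (by positivity) (by positivity),
    Real.log_div (by positivity) (by positivity), Real.log_rpow hp1]
  field_simp
  ring

lemma sum_le_norm (x : Fin n → ℝ) : ∑ i, |x i| ≤ n * ‖(WithLp.toLp 2 x : Euc n)‖ := by
  calc ∑ i, |x i| ≤ ∑ _i : Fin n, ‖(WithLp.toLp 2 x : Euc n)‖ :=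
        Finset.sum_le_sum fun i _ => PiLp.norm_apply_le (WithLp.toLp 2 x : Euc n) i
    _ = _ := by simp

theorem main (hn : 1 ≤ n) {p : ℝ} (hp : 0 < p)
    (f : Euc n → EReal) (hreal : ∀ x, f x ≠ ⊥) (hmeas : Measurable f)
    (hV : 0 < VolE f) {a : ℝ} (ha : 0 < a) (b : ℝ)
    (hgrowth : ∀ x, ((a * ‖x‖ + b : ℝ) : EReal) ≤ f x) :
    ⨅ x : Euc n, MpE p (Transl x f) ≤
      ENNReal.ofReal ((2 * π * Real.sqrt ((1 + p) ^ ((1 + p) / p) / p)) ^ n) := by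
  have hn0 : (0 : ℝ) < n := by exact_mod_cast hn
  set W : (Fin n → ℝ) → ℝ := fun x => we (f (WithLp.toLp 2 x)) with hWd
  have hW : Measurable W :=
    measurable_we.comp (hmeas.comp (MeasurableEquiv.toLp 2 (Fin n → ℝ)).measurable)
  have W0 : ∀ x, 0 ≤ W x := fun x => we_nonneg _
  have hVe : VolE f = ∫⁻ x, ENNReal.ofReal (W x) := by
    rw [VolE, lint_toLp]
    congr 1; ext x
    exact erealExp_neg (hreal _)
  have hα : 0 < a / n := by positivity
  have hWb : ∀ x, W x ≤ rexp (-b) * rexp (-(a / n * ∑ i, |x i|)) := by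
    intro x
    have hg := hgrowth (WithLp.toLp 2 x)
    have hs := sum_le_norm x
    simp only [hWd]
    generalize f (WithLp.toLp 2 x) = t at hg
    induction t with
    | bot => exact absurd (le_bot_iff.1 hg) (EReal.coe_ne_bot _)
    | top => rw [we_top]; positivity
    | coe r =>
      rw [we_coe, ← Real.exp_add]
      refine Real.exp_le_exp.2 ?_
      have hg' := EReal.coe_le_coe_iff.1 hg
      have : a / n * ∑ i, |x i| ≤ a * ‖(WithLp.toLp 2 x : Euc n)‖ := by
        calc a / n * ∑ i, |x i| ≤ a / n * (n * ‖(WithLp.toLp 2 x : Euc n)‖) :=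
              mul_le_mul_of_nonneg_left hs hα.le
          _ = _ := by field_simp
      linarith
  rw [hVe] at hV
  obtain ⟨V0, A, hA⟩ := stepD hp hW W0 hα (Real.exp_pos (-b)) hWb hV
  set V := ∫ x, W x with hVdef
  have Wi := W_int hW W0 hα hWb
  have hVt : VolE (Transl (WithLp.toLp 2 A) f) = ENNReal.ofReal V := by
    rw [hVdef, ofReal_integral_eq_lintegral_ofReal Wi (Eventually.of_forall W0), ← hVe]
    unfold VolE Transl
    exact lintegral_add_right_eq_self (fun x => erealExp (-(f x))) _
  have hVr : Vol (Transl (WithLp.toLp 2 A) f) = V := by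
    rw [Vol, hVt, ENNReal.toReal_ofReal V0.le]
  refine (iInf_le _ (WithLp.toLp 2 A)).trans ?_
  have e2 : VolE (LpStar p (Transl (WithLp.toLp 2 A) f)) =
      ENNReal.ofReal (V ^ (1 / p)) * ∫⁻ y, ENNReal.ofReal (ex A y * HE p W y) := by
    rw [VolE, lint_toLp, ← lintegral_const_mul' _ _ (by simp)]
    congr 1; ext y
    exact star_eq hp hreal (fun x => rfl) V0 A y (LE_pos hp hW W0 hV y) hVr
  rw [MpE, hVt, e2, ← const_eq hp]
  refine (mul_le_mul_right (mul_le_mul_right hA _) _).trans (le_of_eq ?_)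
  rw [← ENNReal.ofReal_mul (by positivity), ← ENNReal.ofReal_mul (by positivity)]
  congr 1
  rw [Real.rpow_add V0, Real.rpow_one]
  field_simp

end LpS

/-- functional `L^p`-Santaló inequality under a linear growth condition.
If `f : ℝⁿ → ℝ ∪ {+∞}` is measurable with `V(f) > 0` and `f(x) ≥ a|x| + b` for some
`a > 0`, `b ∈ ℝ`, then `inf_x M_p(T_x f) ≤ (2π √((1+p)^((1+p)/p)/p))ⁿ`. -/
theorem lp_santalo_general (n : ℕ) (hn : 1 ≤ n) (p : ℝ) (hp : 0 < p)
    (f : Euc n → EReal) (hreal : ∀ x, f x ≠ ⊥) (hmeas : Measurable f)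
    (hV : 0 < VolE f)
    (a : ℝ) (ha : 0 < a) (b : ℝ)
    (hgrowth : ∀ x, ((a * ‖x‖ + b : ℝ) : EReal) ≤ f x) :
    ⨅ x : Euc n, MpE p (Transl x f) ≤
      ENNReal.ofReal ((2 * π * Real.sqrt ((1 + p) ^ ((1 + p) / p) / p)) ^ n) := by
  exact LpS.main hn hp f hreal hmeas hV ha b hgrowth

end
end

section
/- Let a ∈ (0,1) and set p := (1−a)/a ∈ (0,∞). Let F : ℝⁿ → [0,∞) be measurable with 0 < ∫_{ℝⁿ} F(x)^a dx < ∞, and set φ := −a·log F. Then ‖F‖_{L^a} / ‖𝓛F‖_{L^{a/(a−1)}} = p^{np} · M_p(φ)^p. -/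
open MeasureTheory Real Filter
open scoped ENNReal RealInnerProductSpace Classical

noncomputable section

theorem erealExp_coe (t : ℝ) : erealExp (t : EReal) = ENNReal.ofReal (Real.exp t) := by
  simp [erealExp]

theorem erealExp_bot : erealExp ⊥ = 0 := by simp [erealExp]

theorem lintegral_smul_euc (n : ℕ) (p : ℝ) (hp : 0 < p) (G : Euc n → ℝ≥0∞) :
    ENNReal.ofReal p ^ n * ∫⁻ y : Euc n, G (p • y) = ∫⁻ y : Euc n, G y := by
  have h := Measure.map_addHaar_smul (volume : Measure (Euc n)) hp.ne'
  have e : ∫⁻ y : Euc n, G (p • y) = ∫⁻ y, G y ∂(Measure.map (p • ·) (volume : Measure (Euc n))) := by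
    have := MeasureTheory.lintegral_map_equiv (μ := (volume : Measure (Euc n))) G
      (Homeomorph.smulOfNeZero p hp.ne' : Euc n ≃ₜ Euc n).toMeasurableEquiv
    exact this.symm
  rw [e, h, lintegral_smul_measure, smul_eq_mul, ← mul_assoc]
  have hn : Module.finrank ℝ (Euc n) = n := by simp
  rw [hn, abs_of_pos (by positivity), ← ENNReal.ofReal_pow hp.le, ← ENNReal.ofReal_mul (by positivity),
    mul_inv_cancel₀ (by positivity)]
  simp

theorem detropicalized_equivalence (n : ℕ) (a : ℝ) (ha0 : 0 < a) (ha1 : a < 1)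
    (p : ℝ) (hpdef : p = (1 - a) / a)
    (F : Euc n → ℝ) (hFmeas : Measurable F) (hFnonneg : ∀ x, 0 ≤ F x)
    (hpos : 0 < ∫⁻ x, ENNReal.ofReal (F x ^ a))
    (hfin : (∫⁻ x, ENNReal.ofReal (F x ^ a)) < ⊤)
    (φ : Euc n → EReal)
    (hφdef : φ = fun x =>
      if F x = 0 then (⊤ : EReal) else (((-a) * Real.log (F x) : ℝ) : EReal)) :
    (∫⁻ x, ENNReal.ofReal (F x ^ a)) ^ (1 / a) /
        ((∫⁻ y : Euc n,
            (∫⁻ x, ENNReal.ofReal (F x) * ENNReal.ofReal (Real.exp ⟪x, y⟫)) ^ (a / (a - 1)))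
          ^ ((a - 1) / a)) =
      ENNReal.ofReal p ^ ((n : ℝ) * p) * (MpE p φ) ^ p := by
  have hp : 0 < p := by rw [hpdef]; exact div_pos (by linarith) ha0
  have hpa : (p + 1) * a = 1 := by rw [hpdef]; field_simp; ring
  have e1 : 1 / a = p + 1 := by rw [hpdef]; field_simp; ring
  have e2 : (a - 1) / a = -p := by rw [hpdef]; field_simp; ring
  have e3 : a / (a - 1) = -(1 / p) := by
    rw [hpdef]
    have : a - 1 ≠ 0 := by linarith
    have : 1 - a ≠ 0 := by linarith
    field_simp
    ring
  have hV : VolE φ = ∫⁻ x, ENNReal.ofReal (F x ^ a) := by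
    unfold VolE
    congr 1
    funext x
    rw [hφdef]
    by_cases h : F x = 0
    · simp [h, erealExp_bot, Real.zero_rpow ha0.ne']
    · have hx : 0 < F x := lt_of_le_of_ne (hFnonneg x) (Ne.symm h)
      simp only [h, if_false]
      rw [← EReal.coe_neg, erealExp_coe, Real.rpow_def_of_pos hx]
      congr 2
      ring
  rw [e1, e2, e3, ← hV]
  rw [← hV] at hpos hfin
  set V := VolE φ with hVdef
  set L : Euc n → ℝ≥0∞ :=
    fun y => ∫⁻ x, ENNReal.ofReal (F x) * ENNReal.ofReal (Real.exp ⟪x, y⟫) with hL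
  have hLp : ∀ y, LpIntE p φ y = L (p • y) := by
    intro y
    unfold LpIntE
    rw [hL]
    congr 1
    funext x
    rw [hφdef]
    by_cases h : F x = 0
    · have hc : (((p + 1 : ℝ) : EReal)) * ⊤ = ⊤ := EReal.coe_mul_top_of_pos (by linarith)
      simp only [h, if_true]
      rw [hc, EReal.sub_top, erealExp_bot]
      simp
    · have hx : 0 < F x := lt_of_le_of_ne (hFnonneg x) (Ne.symm h)
      simp only [h, if_false]
      rw [← EReal.coe_mul, ← EReal.coe_sub, erealExp_coe, ← ENNReal.ofReal_mul hx.le,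
        inner_smul_right]
      congr 1
      have : p * ⟪x, y⟫ - (p + 1) * (-a * Real.log (F x)) = Real.log (F x) + p * ⟪x, y⟫ := by
        linear_combination (Real.log (F x)) * hpa
      rw [this, Real.exp_add, Real.exp_log hx]
  have hLpos : ∀ y, L y ≠ 0 := by
    intro y h0
    have hm : Measurable fun x : Euc n =>
        ENNReal.ofReal (F x) * ENNReal.ofReal (Real.exp ⟪x, y⟫) := by fun_prop
    have h1 := (lintegral_eq_zero_iff hm).1 h0
    refine hpos.ne' ?_
    rw [hV]
    refine (lintegral_congr_ae ?_).trans lintegral_zero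
    filter_upwards [h1] with x hx
    have h2 : F x ≤ 0 := by
      have h4 : F x ≤ 0 ∨ Real.exp ⟪x, y⟫ ≤ 0 := by simpa using hx
      exact h4.resolve_right (not_le.2 (Real.exp_pos _))
    have h3 : F x = 0 := le_antisymm h2 (hFnonneg x)
    simp [h3, Real.zero_rpow ha0.ne']
  have hS : ∀ y, erealExp (-(LpStar p φ y)) = V ^ (1 / p) * (L (p • y)) ^ (-(1 / p)) := by
    intro y
    unfold LpStar
    rw [hLp]
    by_cases h : L (p • y) = ⊤
    · simp only [h, if_true]
      rw [EReal.neg_top, erealExp_bot, ENNReal.top_rpow_of_neg (by simpa using hp), mul_zero]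
    · simp only [h, if_false]
      have hl : 0 < (L (p • y)).toReal := ENNReal.toReal_pos (hLpos _) h
      have hv : 0 < V.toReal := ENNReal.toReal_pos hpos.ne' hfin.ne
      have q1 : V = ENNReal.ofReal V.toReal := (ENNReal.ofReal_toReal hfin.ne).symm
      have q2 : L (p • y) = ENNReal.ofReal (L (p • y)).toReal := (ENNReal.ofReal_toReal h).symm
      rw [← EReal.coe_neg, erealExp_coe]
      conv_rhs => rw [q1, q2]
      rw [ENNReal.ofReal_rpow_of_pos hl, ENNReal.ofReal_rpow_of_pos hv,
        ← ENNReal.ofReal_mul (by positivity), Real.rpow_def_of_pos hl, Real.rpow_def_of_pos hv,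
        ← Real.exp_add]
      have : Vol φ = V.toReal := rfl
      rw [this, Real.log_div hl.ne' hv.ne']
      congr 2
      ring
  have hVS : VolE (LpStar p φ) = V ^ (1 / p) * ∫⁻ y, (L (p • y)) ^ (-(1 / p)) := by
    unfold VolE
    simp_rw [hS]
    rw [lintegral_const_mul']
    exact ENNReal.rpow_ne_top_of_nonneg (by positivity) hfin.ne
  have hJ := lintegral_smul_euc n p hp (fun y => (L y) ^ (-(1 / p)))
  unfold MpE
  rw [← hVdef, hVS, ← hJ, ENNReal.rpow_neg, div_eq_mul_inv, inv_inv]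
  rw [ENNReal.mul_rpow_of_nonneg _ _ hp.le, ENNReal.mul_rpow_of_nonneg _ _ hp.le,
    ENNReal.mul_rpow_of_nonneg _ _ hp.le, ← ENNReal.rpow_mul, one_div_mul_cancel hp.ne',
    ENNReal.rpow_mul, ENNReal.rpow_natCast, ENNReal.rpow_add _ _ hpos.ne' hfin.ne]
  ring

end
end
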